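/- arXiv:2305.03146 — 5 statements merged into one kernel-verified Lean document; each statement's English description precedes it below -/
import Mathlib

section
/- Let (Ω, 𝒜, π) be a probability space and let ω ↦ K_ω assign to each ω ∈ Ω a symmetric convex set K_ω ⊆ ℝⁿ with vol(K_ω) > 0, such that ω ↦ N(0,I_n)|_{K_ω} is a Markov kernel from Ω to ℝⁿ. Let D = ∫_Ω N(0,I_n)|_{K_ω} dπ(ω) be the mixture measure, and define a : Ω → ℝ by a(ω) = E_{x ∼ N(0,I_n)|_{K_ω}}[‖x‖²]. Then E_{x ∼ D}[‖x‖²] = E_{ω ∼ π}[a(ω)], and Var_{x ∼ D}[‖x‖²] ≤ 4n + Var_{ω ∼ π}[a(ω)]. -/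
open MeasureTheory ProbabilityTheory Real

/-- The standard Gaussian measure `N(0, I_n)` on `ℝⁿ`. -/
noncomputable def stdGaussian (n : ℕ) : Measure (EuclideanSpace ℝ (Fin n)) :=
  volume.withDensity fun x =>
    ENNReal.ofReal ((2 * π) ^ (-(n : ℝ) / 2) * Real.exp (-‖x‖ ^ 2 / 2))

/-- The standard Gaussian measure conditioned on the set `K`. -/
noncomputable def truncGaussian (n : ℕ) (K : Set (EuclideanSpace ℝ (Fin n))) :
    Measure (EuclideanSpace ℝ (Fin n)) :=
  (stdGaussian n K)⁻¹ • (stdGaussian n).restrict K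

/-- One-dimensional Brunn-Minkowski, compact case. -/
lemma bm_compact {A B C : Set ℝ} (hA : IsCompact A) (hB : IsCompact B)
    (hAn : A.Nonempty) (hBn : B.Nonempty)
    (h : ∀ x ∈ A, ∀ y ∈ B, x + y ∈ C) : volume A + volume B ≤ volume C := by
  obtain ⟨p, hpA, hp⟩ := hA.exists_isGreatest hAn
  obtain ⟨q, hqB, hq⟩ := hB.exists_isLeast hBn
  have h1 : volume A ≤ volume (C ∩ Set.Iic (p + q)) := by
    rw [← measure_preimage_add_right volume q (C ∩ Set.Iic (p + q))]
    refine measure_mono fun x hx => ⟨h x hx q hqB, ?_⟩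
    have := hp hx
    simp only [Set.mem_Iic]; linarith
  have h2 : volume B ≤ volume (C \ Set.Iic (p + q)) := by
    rw [← measure_preimage_add volume p (C \ Set.Iic (p + q))]
    have hB' : volume B = volume (B \ {q}) := (measure_sdiff_null (by simp)).symm
    rw [hB']
    refine measure_mono fun x hx => ⟨h p hpA x hx.1, ?_⟩
    have h3 := hq hx.1
    have h4 : q ≠ x := fun h => hx.2 h.symm
    have := lt_of_le_of_ne h3 h4
    simp only [Set.mem_Iic, not_le]; linarith
  rw [← measure_inter_add_sdiff C (measurableSet_Iic (a := p + q))]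
  exact add_le_add h1 h2

/-- One-dimensional Brunn-Minkowski for measurable sets. -/
lemma bm_meas {A B C : Set ℝ} (hA : MeasurableSet A) (hB : MeasurableSet B)
    (hAn : A.Nonempty) (hBn : B.Nonempty)
    (h : ∀ x ∈ A, ∀ y ∈ B, x + y ∈ C) : volume A + volume B ≤ volume C := by
  obtain ⟨a, ha⟩ := hAn
  obtain ⟨b, hb⟩ := hBn
  rw [hA.measure_eq_iSup_isCompact, hB.measure_eq_iSup_isCompact]
  refine ENNReal.biSup_add_biSup_le' (p := fun K => K ⊆ A) (q := fun K => K ⊆ B)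
    ⟨∅, Set.empty_subset _⟩ ⟨∅, Set.empty_subset _⟩ fun K hK L hL => ?_
  have aux : ∀ {S T : Set ℝ} {s : ℝ}, s ∈ S → T ⊆ S → ∃ T' ⊆ S, IsCompact T' ∧ T'.Nonempty ∧
      (⨆ _ : IsCompact T, volume T) ≤ volume T' := by
    intro S T s hs hT
    by_cases hc : IsCompact T
    · refine ⟨insert s T, Set.insert_subset hs hT, hc.insert s, ⟨s, Set.mem_insert _ _⟩, ?_⟩
      exact iSup_le fun _ => measure_mono (Set.subset_insert _ _)
    · exact ⟨{s}, by simpa using hs, isCompact_singleton, ⟨s, rfl⟩, iSup_le fun h => absurd h hc⟩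
  obtain ⟨K', hKsub, hKc, hKn, hKle⟩ := aux ha hK
  obtain ⟨L', hLsub, hLc, hLn, hLle⟩ := aux hb hL
  exact (add_le_add hKle hLle).trans
    (bm_compact hKc hLc hKn hLn fun x hx y hy => h x (hKsub hx) y (hLsub hy))

/-- One-dimensional Prekopa-Leindler, normalised real form. -/
lemma pl_normalised {u v w : ℝ → ℝ} (hu : Measurable u) (hv : Measurable v) (hw : Measurable w)
    (hu0 : ∀ x, 0 ≤ u x) (hv0 : ∀ x, 0 ≤ v x) (hw0 : ∀ x, 0 ≤ w x)
    (hu1 : ∀ x, u x ≤ 1) (hv1 : ∀ x, v x ≤ 1)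
    (hus : ∀ t < 1, ∃ x, t < u x) (hvs : ∀ t < 1, ∃ x, t < v x)
    (h : ∀ x y, u x * v y ≤ w ((1 / 2 : ℝ) • (x + y)) ^ 2) :
    (∫⁻ x, ENNReal.ofReal (u x)) + (∫⁻ x, ENNReal.ofReal (v x))
      ≤ 2 * ∫⁻ x, ENNReal.ofReal (w x) := by
  rw [lintegral_eq_lintegral_meas_lt volume (ae_of_all _ hu0) hu.aemeasurable,
    lintegral_eq_lintegral_meas_lt volume (ae_of_all _ hv0) hv.aemeasurable,
    lintegral_eq_lintegral_meas_lt volume (ae_of_all _ hw0) hw.aemeasurable,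
    ← lintegral_const_mul' _ _ (by simp), ← lintegral_add_left]
  · refine setLIntegral_mono' measurableSet_Ioi fun t ht => ?_
    rcases lt_or_ge t 1 with ht1 | ht1
    · have hC : volume ((fun z : ℝ => (1 / 2 : ℝ) * z) ⁻¹' {a | t < w a})
          = 2 * volume {a | t < w a} := by
        rw [Real.volume_preimage_mul_left (by norm_num)]; norm_num
      rw [← hC]
      refine bm_meas (measurableSet_lt measurable_const hu) (measurableSet_lt measurable_const hv)
        (hus t ht1) (hvs t ht1) fun x hx y hy => ?_
      simp only [Set.mem_ofPred_eq, Set.mem_preimage, Set.mem_Ioi] at *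
      have h1 := h x y
      simp only [smul_eq_mul] at h1
      have h2 : t * t < u x * v y := mul_lt_mul'' hx hy ht.le ht.le
      refine lt_of_pow_lt_pow_left₀ 2 (hw0 _) (by nlinarith)
    · have e1 : {a | t < u a} = ∅ := by
        ext x; simpa using (hu1 x).trans ht1
      have e2 : {a | t < v a} = ∅ := by
        ext x; simpa using (hv1 x).trans ht1
      simp [e1, e2]
  · exact Antitone.measurable fun s t hst => measure_mono fun x hx => lt_of_le_of_lt hst hx

lemma ennreal_four_mul_le (x y : ENNReal) : 4 * (x * y) ≤ (x + y) ^ 2 := by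
  by_cases hx : x = ⊤
  · simp [hx]
  by_cases hy : y = ⊤
  · simp [hy]
  lift x to NNReal using hx
  lift y to NNReal using hy
  norm_cast
  rw [← NNReal.coe_le_coe]; push_cast
  nlinarith [sq_nonneg ((x : ℝ) - y)]

/-- One-dimensional Prekopa-Leindler for bounded real functions. -/
lemma pl_bounded {f g h : ℝ → ℝ} (hf : Measurable f) (hg : Measurable g) (hh : Measurable h)
    (hf0 : ∀ x, 0 ≤ f x) (hg0 : ∀ x, 0 ≤ g x) (hh0 : ∀ x, 0 ≤ h x) (M : ℝ)
    (hfM : ∀ x, f x ≤ M) (hgM : ∀ x, g x ≤ M)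
    (H : ∀ x y, f x * g y ≤ h ((1 / 2 : ℝ) • (x + y)) ^ 2) :
    (∫⁻ x, ENNReal.ofReal (f x)) * (∫⁻ x, ENNReal.ofReal (g x))
      ≤ (∫⁻ x, ENNReal.ofReal (h x)) ^ 2 := by
  have bf : BddAbove (Set.range f) := ⟨M, by rintro _ ⟨x, rfl⟩; exact hfM x⟩
  have bg : BddAbove (Set.range g) := ⟨M, by rintro _ ⟨x, rfl⟩; exact hgM x⟩
  set a := ⨆ x, f x with ha
  set b := ⨆ x, g x with hb
  have hfa : ∀ x, f x ≤ a := le_ciSup bf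
  have hgb : ∀ x, g x ≤ b := le_ciSup bg
  rcases (le_trans (hf0 0) (hfa 0)).eq_or_lt with ha0 | ha0
  · have : ∀ x, ENNReal.ofReal (f x) = 0 := fun x => by
      rw [ENNReal.ofReal_eq_zero, ha0]; exact hfa x
    simp [this]
  rcases (le_trans (hg0 0) (hgb 0)).eq_or_lt with hb0 | hb0
  · have : ∀ x, ENNReal.ofReal (g x) = 0 := fun x => by
      rw [ENNReal.ofReal_eq_zero, hb0]; exact hgb x
    simp [this]
  have hs : 0 < √(a * b) := Real.sqrt_pos.2 (mul_pos ha0 hb0)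
  have hss : √(a * b) ^ 2 = a * b := Real.sq_sqrt (mul_pos ha0 hb0).le
  have key := pl_normalised (u := fun x => f x / a) (v := fun x => g x / b)
    (w := fun x => h x / √(a * b)) (by fun_prop) (by fun_prop) (by fun_prop)
    (fun x => div_nonneg (hf0 x) ha0.le) (fun x => div_nonneg (hg0 x) hb0.le)
    (fun x => div_nonneg (hh0 x) hs.le)
    (fun x => (div_le_one ha0).2 (hfa x)) (fun x => (div_le_one hb0).2 (hgb x))
    (fun t ht => by
      have : t * a < ⨆ x, f x := by rw [← ha]; nlinarith
      obtain ⟨x, hx⟩ := exists_lt_of_lt_ciSup this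
      exact ⟨x, (lt_div_iff₀ ha0).2 hx⟩)
    (fun t ht => by
      have : t * b < ⨆ x, g x := by rw [← hb]; nlinarith
      obtain ⟨x, hx⟩ := exists_lt_of_lt_ciSup this
      exact ⟨x, (lt_div_iff₀ hb0).2 hx⟩)
    (fun x y => by
      rw [div_pow, hss, div_mul_div_comm]
      exact div_le_div_of_nonneg_right (H x y) (mul_pos ha0 hb0).le)
  have scale : ∀ (c : ℝ) (_ : 0 < c) (k : ℝ → ℝ), ∫⁻ x, ENNReal.ofReal (k x)
      = ENNReal.ofReal c * ∫⁻ x, ENNReal.ofReal (k x / c) := fun c hc k => by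
    rw [← lintegral_const_mul' _ _ (by simp)]
    refine lintegral_congr fun x => ?_
    rw [← ENNReal.ofReal_mul hc.le, mul_div_cancel₀ _ hc.ne']
  rw [scale a ha0 f, scale b hb0 g, scale _ hs h, mul_pow, ← ENNReal.ofReal_pow hs.le, hss,
    mul_mul_mul_comm, ← ENNReal.ofReal_mul ha0.le]
  gcongr
  have h4 := (ennreal_four_mul_le _ _).trans (pow_le_pow_left' key 2)
  rw [mul_pow] at h4
  have : (2 : ENNReal) ^ 2 = 4 := by norm_num
  rw [this] at h4
  exact (ENNReal.mul_le_mul_iff_right (by norm_num) (by norm_num)).1 h4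

/-- The (midpoint) Prekopa-Leindler property of a measure space. -/
def PLProp (E : Type*) [AddCommGroup E] [Module ℝ E] [MeasureSpace E] : Prop :=
  ∀ f g h : E → ENNReal, Measurable f → Measurable g → Measurable h →
    (∀ x y, f x * g y ≤ h ((1 / 2 : ℝ) • (x + y)) ^ 2) →
    (∫⁻ x, f x) * (∫⁻ x, g x) ≤ (∫⁻ x, h x) ^ 2

lemma plProp_real : PLProp ℝ := by
  intro f g h hf hg hh H
  have bdd : ∀ M : ℕ, (∫⁻ x, min (f x) M) * (∫⁻ x, min (g x) M) ≤ (∫⁻ x, h x) ^ 2 := fun M => by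
    have key := pl_bounded (f := fun x => (min (f x) M).toReal) (g := fun x => (min (g x) M).toReal)
      (h := fun x => (min (h x) M).toReal) (by fun_prop) (by fun_prop) (by fun_prop)
      (fun _ => ENNReal.toReal_nonneg) (fun _ => ENNReal.toReal_nonneg)
      (fun _ => ENNReal.toReal_nonneg) M
      (fun x => by
        have := ENNReal.toReal_mono (by simp) (min_le_right (f x) (M : ENNReal))
        simpa using this)
      (fun x => by
        have := ENNReal.toReal_mono (by simp) (min_le_right (g x) (M : ENNReal))
        simpa using this)
      (fun x y => by
        rw [← ENNReal.toReal_mul, ← ENNReal.toReal_pow]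
        refine ENNReal.toReal_mono (by simp) ?_
        rcases le_total (h ((1 / 2 : ℝ) • (x + y))) M with hM | hM
        · rw [min_eq_left hM]
          exact (mul_le_mul' (min_le_left _ _) (min_le_left _ _)).trans (H x y)
        · rw [min_eq_right hM, sq]
          exact mul_le_mul' (min_le_right _ _) (min_le_right _ _))
    have e : ∀ k : ℝ → ENNReal, ∀ x, ENNReal.ofReal (min (k x) M).toReal = min (k x) M :=
      fun k x => ENNReal.ofReal_toReal (by simp)
    simp only [e] at key
    exact key.trans (pow_le_pow_left' (lintegral_mono fun x => min_le_left _ _) 2)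
  have sup : ∀ k : ℝ → ENNReal, Measurable k →
      ∫⁻ x, k x = ⨆ M : ℕ, ∫⁻ x, min (k x) M := fun k hk => by
    rw [← lintegral_iSup (f := fun (M : ℕ) x => min (k x) (M : ENNReal)) (fun M => by fun_prop)
      (fun M N hMN x => min_le_min le_rfl (by exact_mod_cast hMN))]
    refine lintegral_congr fun x => ?_
    rw [← inf_iSup_eq (k x) (fun M : ℕ => (M : ENNReal)), ENNReal.iSup_natCast, inf_top_eq]
  rw [sup f hf, sup g hg]
  simp only [ENNReal.iSup_mul, ENNReal.mul_iSup]
  refine iSup_le fun M => iSup_le fun N => ?_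
  refine le_trans ?_ (bdd (max M N))
  gcongr <;> simp

lemma PLProp.prod {E F : Type*} [AddCommGroup E] [Module ℝ E] [MeasureSpace E]
    [AddCommGroup F] [Module ℝ F] [MeasureSpace F] [SFinite (volume : Measure F)]
    (hE : PLProp E) (hF : PLProp F) : PLProp (E × F) := by
  intro f g h hf hg hh H
  have t : ∀ k : E × F → ENNReal, Measurable k → ∫⁻ z, k z = ∫⁻ x, ∫⁻ y, k (x, y) :=
    fun k hk => lintegral_prod _ hk.aemeasurable
  rw [t f hf, t g hg, t h hh]
  refine hE _ _ _ hf.lintegral_prod_right' hg.lintegral_prod_right' hh.lintegral_prod_right' ?_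
  intro x x'
  refine hF _ _ _ (by fun_prop) (by fun_prop) (by fun_prop) fun y y' => ?_
  exact H (x, y) (x', y')

lemma PLProp.transfer {E F : Type*} [AddCommGroup E] [Module ℝ E] [MeasureSpace E]
    [AddCommGroup F] [Module ℝ F] [MeasureSpace F] (hE : PLProp E) (e : E →ₗ[ℝ] F)
    (he : MeasurePreserving e volume volume) : PLProp F := by
  intro f g h hf hg hh H
  rw [← he.lintegral_comp hf, ← he.lintegral_comp hg, ← he.lintegral_comp hh]
  refine hE _ _ _ (hf.comp he.measurable) (hg.comp he.measurable) (hh.comp he.measurable) ?_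
  intro x y
  simpa using H (e x) (e y)

lemma plProp_pi : ∀ n : ℕ, PLProp (Fin n → ℝ)
  | 0 => by
    intro f g h hf hg hh H
    rw [lintegral_unique, lintegral_unique, lintegral_unique]
    have := H default default
    have e : ((1 / 2 : ℝ) • (default + default) : Fin 0 → ℝ) = default := Subsingleton.elim _ _
    rw [e] at this
    have hv : (volume : Measure (Fin 0 → ℝ)) Set.univ = 1 := by
      rw [volume_pi, Measure.pi_univ]; simp
    rw [hv, mul_one, mul_one, mul_one]
    convert this
  | n + 1 => by
    have := plProp_real.prod (plProp_pi n)
    refine this.transfer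
      { toFun := (MeasurableEquiv.piFinSuccAbove (fun _ : Fin (n + 1) => ℝ) 0).symm
        map_add' := fun x y => ?_
        map_smul' := fun c x => ?_ }
      (volume_preserving_piFinSuccAbove (fun _ : Fin (n + 1) => ℝ) 0).symm
    · ext i; refine Fin.cases ?_ (fun j => ?_) i <;> simp [MeasurableEquiv.piFinSuccAbove]
    · ext i; refine Fin.cases ?_ (fun j => ?_) i <;> simp [MeasurableEquiv.piFinSuccAbove]

lemma plProp_euclidean (n : ℕ) : PLProp (EuclideanSpace ℝ (Fin n)) :=
  (plProp_pi n).transfer (WithLp.linearEquiv 2 ℝ (Fin n → ℝ)).symm.toLinearMap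
    (PiLp.volume_preserving_toLp (Fin n))

lemma lintegral_inv_smul {n : ℕ} (φ : EuclideanSpace ℝ (Fin n) → ENNReal) (hφ : Measurable φ)
    {c : ℝ} (hc : 0 < c) : ∫⁻ x, φ (c⁻¹ • x) = ENNReal.ofReal (c ^ n) * ∫⁻ x, φ x := by
  have h := Measure.map_addHaar_smul (volume : Measure (EuclideanSpace ℝ (Fin n)))
    (inv_ne_zero hc.ne')
  rw [← lintegral_map hφ (by fun_prop), h, lintegral_smul_measure]
  simp [abs_of_pos hc]

/-- Prekopa-Leindler applied to Gaussian weights on a convex set. -/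
lemma pl_gauss {n : ℕ} {K : Set (EuclideanSpace ℝ (Fin n))} (hK : Convex ℝ K)
    (hKm : MeasurableSet K) {c d : ℝ} (hc : 0 < c) (hd : 0 < d) (hcd : c + d = 2) :
    ENNReal.ofReal ((c * d) ^ n) * ((∫⁻ x in K, ENNReal.ofReal (exp (-c * ‖x‖ ^ 2 / 2))) *
      (∫⁻ x in K, ENNReal.ofReal (exp (-d * ‖x‖ ^ 2 / 2))))
      ≤ (∫⁻ x in K, ENNReal.ofReal (exp (-‖x‖ ^ 2 / 2))) ^ 2 := by
  let φ : ℝ → EuclideanSpace ℝ (Fin n) → ENNReal := fun c =>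
    K.indicator fun x => ENNReal.ofReal (exp (-c * ‖x‖ ^ 2 / 2))
  have hφ : ∀ c, Measurable (φ c) := fun c => Measurable.indicator (by fun_prop) hKm
  have hφI : ∀ c, ∫⁻ x in K, ENNReal.ofReal (exp (-c * ‖x‖ ^ 2 / 2)) = ∫⁻ x, φ c x :=
    fun c => (lintegral_indicator hKm _).symm
  have h1 := hφI 1
  simp only [neg_mul, one_mul] at h1
  rw [h1, hφI c, hφI d, mul_pow, ENNReal.ofReal_mul (by positivity), mul_mul_mul_comm,
    ← lintegral_inv_smul _ (hφ c) hc, ← lintegral_inv_smul _ (hφ d) hd]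
  refine plProp_euclidean n _ _ _ ((hφ c).comp (by fun_prop)) ((hφ d).comp (by fun_prop)) (hφ 1) ?_
  intro x y
  obtain ⟨x, rfl⟩ : ∃ x', x = c • x' := ⟨c⁻¹ • x, by rw [smul_inv_smul₀ hc.ne']⟩
  obtain ⟨y, rfl⟩ : ∃ y', y = d • y' := ⟨d⁻¹ • y, by rw [smul_inv_smul₀ hd.ne']⟩
  rw [inv_smul_smul₀ hc.ne', inv_smul_smul₀ hd.ne']
  by_cases hx : x ∈ K
  swap
  · simp [φ, hx]
  by_cases hy : y ∈ K
  swap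
  · simp [φ, hy]
  have hz : (1 / 2 : ℝ) • (c • x + d • y) ∈ K := by
    rw [smul_add, smul_smul, smul_smul]
    exact hK hx hy (by positivity) (by positivity) (by linarith)
  simp only [φ, Set.indicator_of_mem hx, Set.indicator_of_mem hy, Set.indicator_of_mem hz]
  rw [← ENNReal.ofReal_mul (exp_pos _).le, ← ENNReal.ofReal_pow (exp_pos _).le, ← exp_add,
    ← exp_nat_mul]
  refine ENNReal.ofReal_le_ofReal (exp_le_exp.2 ?_)
  have hn : ‖(1 / 2 : ℝ) • (c • x + d • y)‖ ≤ (c * ‖x‖ + d * ‖y‖) / 2 := by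
    rw [norm_smul]
    have := norm_add_le (c • x) (d • y)
    rw [norm_smul, norm_smul, Real.norm_of_nonneg hc.le, Real.norm_of_nonneg hd.le] at this
    norm_num
    linarith
  have hn2 : ‖(1 / 2 : ℝ) • (c • x + d • y)‖ ^ 2 ≤ ((c * ‖x‖ + d * ‖y‖) / 2) ^ 2 :=
    pow_le_pow_left₀ (norm_nonneg _) hn 2
  have h3 : ((c * ‖x‖ + d * ‖y‖) / 2) ^ 2 ≤ (c * ‖x‖ ^ 2 + d * ‖y‖ ^ 2) / 2 := by
    have : d = 2 - c := by linarith
    subst this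
    nlinarith [mul_nonneg (mul_pos hc hd).le (sq_nonneg (‖x‖ - ‖y‖))]
  push_cast
  linarith

lemma truncGaussian_isProb {n : ℕ} {K : Set (EuclideanSpace ℝ (Fin n))}
    (hpos : 0 < (_root_.stdGaussian n K).toReal) : IsProbabilityMeasure (truncGaussian n K) := by
  have h := ENNReal.toReal_pos_iff.1 hpos
  refine ⟨?_⟩
  simp only [truncGaussian, Measure.smul_apply, smul_eq_mul, Measure.restrict_apply_univ]
  exact ENNReal.inv_mul_cancel h.1.ne' h.2.ne

lemma lintegral_exp_truncGaussian {n : ℕ} {K : Set (EuclideanSpace ℝ (Fin n))}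
    (hKm : MeasurableSet K) (ε : ℝ) :
    ∫⁻ x, ENNReal.ofReal (exp (ε * (‖x‖ ^ 2 / 2))) ∂(truncGaussian n K)
      = (_root_.stdGaussian n K)⁻¹ * ENNReal.ofReal ((2 * π) ^ (-(n : ℝ) / 2)) *
        ∫⁻ x in K, ENNReal.ofReal (exp (-(1 - ε) * ‖x‖ ^ 2 / 2)) := by
  rw [truncGaussian, lintegral_smul_measure, smul_eq_mul, mul_assoc]
  congr 1
  rw [_root_.stdGaussian, restrict_withDensity hKm, lintegral_withDensity_eq_lintegral_mul _ (by fun_prop) (by fun_prop),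
    ← lintegral_const_mul' _ _ (by simp)]
  refine lintegral_congr fun x => ?_
  simp only [Pi.mul_apply]
  rw [← ENNReal.ofReal_mul (by positivity), ← ENNReal.ofReal_mul (by positivity), mul_assoc,
    ← exp_add]
  congr 3
  ring

lemma mgf_prod_le {n : ℕ} {K : Set (EuclideanSpace ℝ (Fin n))} (hK : Convex ℝ K)
    (hKm : MeasurableSet K) (hpos : 0 < (_root_.stdGaussian n K).toReal)
    {ε : ℝ} (h0 : 0 < ε) (h1 : ε < 1) :
    ENNReal.ofReal ((1 - ε ^ 2) ^ n) *
      ((∫⁻ x, ENNReal.ofReal (exp (ε * (‖x‖ ^ 2 / 2))) ∂(truncGaussian n K)) *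
      (∫⁻ x, ENNReal.ofReal (exp (-ε * (‖x‖ ^ 2 / 2))) ∂(truncGaussian n K))) ≤ 1 := by
  have hp := truncGaussian_isProb hpos
  have e0 := lintegral_exp_truncGaussian hKm 0
  simp only [zero_mul, exp_zero, ENNReal.ofReal_one, lintegral_one, measure_univ, sub_zero,
    neg_mul, one_mul] at e0
  rw [lintegral_exp_truncGaussian hKm, lintegral_exp_truncGaussian hKm]
  have key := pl_gauss hK hKm (c := 1 - ε) (d := 1 - -ε) (by linarith) (by linarith) (by ring)
  have e : (1 - ε) * (1 - -ε) = 1 - ε ^ 2 := by ring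
  rw [e] at key
  have := mul_le_mul_right key (((_root_.stdGaussian n K)⁻¹ * ENNReal.ofReal ((2 * π) ^ (-(n : ℝ) / 2))) ^ 2)
  rw [← mul_pow, ← e0, one_pow] at this
  refine le_trans (le_of_eq ?_) this
  ring

lemma two_add_sq_le (x : ℝ) : 2 + x ^ 2 ≤ exp x + exp (-x) := by
  wlog hx : 0 ≤ x generalizing x
  · have := this (-x) (by linarith)
    rw [neg_neg, neg_sq] at this; linarith
  have h1 : x / 2 ≤ sinh (x / 2) := Real.self_le_sinh_iff.2 (by linarith)
  have h2 := Real.cosh_two_mul (x / 2)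
  have h3 := Real.cosh_sq (x / 2)
  have h4 := Real.cosh_eq x
  rw [mul_div_cancel₀ _ two_ne_zero] at h2
  nlinarith

lemma variance_le_of_mgf {Ω : Type*} [MeasurableSpace Ω] {μ : Measure Ω} [IsProbabilityMeasure μ]
    {Y : Ω → ℝ} (hY : Measurable Y) (n : ℕ)
    (h : ∀ ε : ℝ, 0 < ε → ε < 1 → ENNReal.ofReal ((1 - ε ^ 2) ^ n) *
      ((∫⁻ x, ENNReal.ofReal (exp (ε * Y x)) ∂μ) *
      (∫⁻ x, ENNReal.ofReal (exp (-ε * Y x)) ∂μ)) ≤ 1) :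
    MemLp Y 2 μ ∧ variance Y μ ≤ n := by
  have hne : ∀ ε : ℝ, ∫⁻ x, ENNReal.ofReal (exp (ε * Y x)) ∂μ ≠ 0 := fun ε => by
    rw [Ne, lintegral_eq_zero_iff (by fun_prop)]
    intro h0
    have : ∀ᵐ x ∂μ, False := by
      filter_upwards [h0] with x hx
      simp only [Pi.zero_apply, ENNReal.ofReal_eq_zero] at hx
      exact absurd (exp_pos (ε * Y x)) (not_lt.2 hx)
    simp only [Filter.eventually_false_iff_eq_bot, ae_eq_bot] at this
    exact IsProbabilityMeasure.ne_zero μ this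
  have hint : ∀ ε : ℝ, 0 < ε → ε < 1 → Integrable (fun x => exp (ε * Y x)) μ ∧
      Integrable (fun x => exp (-ε * Y x)) μ := fun ε h0 h1 => by
    have hp : (0 : ℝ) < (1 - ε ^ 2) ^ n := pow_pos (by nlinarith) n
    have h2 := h ε h0 h1
    have h3 : (∫⁻ x, ENNReal.ofReal (exp (ε * Y x)) ∂μ) *
      (∫⁻ x, ENNReal.ofReal (exp (-ε * Y x)) ∂μ) ≠ ⊤ := fun ht => by
      rw [ht, ENNReal.mul_top (by simpa using hp)] at h2
      simp at h2
    have i : ∀ ε : ℝ, ∫⁻ x, ENNReal.ofReal (exp (ε * Y x)) ∂μ ≠ ⊤ →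
        Integrable (fun x => exp (ε * Y x)) μ := fun ε ht => by
      refine ⟨by fun_prop, ?_⟩
      rw [hasFiniteIntegral_iff_ofReal (ae_of_all _ fun x => (exp_pos _).le)]
      exact ht.lt_top
    exact ⟨i ε fun ht => h3 (by rw [ht, ENNReal.top_mul (hne _)]),
      i (-ε) fun ht => h3 (by rw [ht, ENNReal.mul_top (hne _)])⟩
  have hmem : MemLp Y 2 μ := by
    refine memLp_of_mem_interior_integrableExpSet (p := 2) ?_
    rw [mem_interior]
    refine ⟨Set.Ioo (-1) 1, fun t ht => ?_, isOpen_Ioo, by norm_num, by norm_num⟩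
    rcases lt_trichotomy t 0 with h0 | h0 | h0
    · have := (hint (-t) (by linarith) (by linarith [ht.1])).2
      rw [neg_neg] at this
      exact this
    · subst h0
      simp [integrableExpSet]
    · exact (hint t h0 ht.2).1
  refine ⟨hmem, ?_⟩
  have hY1 : Integrable Y μ := hmem.integrable one_le_two
  have hY2 : Integrable (fun x => Y x ^ 2) μ := hmem.integrable_sq
  set V := variance Y μ with hV
  have hVeq : V = ∫ x, Y x ^ 2 ∂μ - (∫ x, Y x ∂μ) ^ 2 := variance_eq_sub hmem
  have hV0 : 0 ≤ V := variance_nonneg _ _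
  have hreal : ∀ ε : ℝ, 0 < ε → ε < 1 → (1 - ε ^ 2) ^ n * (1 + ε ^ 2 * V) ≤ 1 := fun ε h0 h1 => by
    obtain ⟨i1, i2⟩ := hint ε h0 h1
    have hp : (0 : ℝ) < (1 - ε ^ 2) ^ n := pow_pos (by nlinarith) n
    have h2 := h ε h0 h1
    rw [← ofReal_integral_eq_lintegral_ofReal i1 (ae_of_all _ fun x => (exp_pos _).le),
      ← ofReal_integral_eq_lintegral_ofReal i2 (ae_of_all _ fun x => (exp_pos _).le),
      ← ENNReal.ofReal_mul (integral_nonneg fun x => (exp_pos _).le),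
      ← ENNReal.ofReal_mul hp.le, ENNReal.ofReal_le_one] at h2
    refine le_trans (mul_le_mul_of_nonneg_left ?_ hp.le) h2
    set A := ∫ x, exp (ε * Y x) ∂μ
    set B := ∫ x, exp (-ε * Y x) ∂μ
    have e1 : ∫ z : Ω × Ω, exp (ε * Y z.1) * exp (-ε * Y z.2) ∂(μ.prod μ) = A * B :=
      integral_prod_mul (fun x => exp (ε * Y x)) (fun x => exp (-ε * Y x))
    have e2 : ∫ z : Ω × Ω, exp (-ε * Y z.1) * exp (ε * Y z.2) ∂(μ.prod μ) = B * A :=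
      integral_prod_mul (fun x => exp (-ε * Y x)) (fun x => exp (ε * Y x))
    have j1 : Integrable (fun z : Ω × Ω => exp (ε * Y z.1) * exp (-ε * Y z.2)) (μ.prod μ) :=
      i1.mul_prod i2
    have j2 : Integrable (fun z : Ω × Ω => exp (-ε * Y z.1) * exp (ε * Y z.2)) (μ.prod μ) :=
      i2.mul_prod i1
    have k0 : Integrable (fun z : Ω × Ω => Y z.1 * Y z.2) (μ.prod μ) := hY1.mul_prod hY1
    have k1 : Integrable (fun z : Ω × Ω => Y z.1 ^ 2) (μ.prod μ) := hY2.comp_fst μ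
    have k2 : Integrable (fun z : Ω × Ω => Y z.2 ^ 2) (μ.prod μ) := hY2.comp_snd μ
    have f0 : ∫ z : Ω × Ω, Y z.1 * Y z.2 ∂(μ.prod μ) = (∫ x, Y x ∂μ) * ∫ x, Y x ∂μ :=
      integral_prod_mul Y Y
    have f1 : ∫ z : Ω × Ω, Y z.1 ^ 2 ∂(μ.prod μ) = ∫ x, Y x ^ 2 ∂μ := by
      rw [integral_fun_fst (fun x => Y x ^ 2)]; simp
    have f2 : ∫ z : Ω × Ω, Y z.2 ^ 2 ∂(μ.prod μ) = ∫ x, Y x ^ 2 ∂μ := by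
      rw [integral_fun_snd (fun x => Y x ^ 2)]; simp
    have k3 : Integrable (fun z : Ω × Ω => Y z.1 ^ 2 + Y z.2 ^ 2) (μ.prod μ) := k1.add k2
    have k4 : Integrable (fun z : Ω × Ω => Y z.1 ^ 2 + Y z.2 ^ 2 - 2 * (Y z.1 * Y z.2))
        (μ.prod μ) := k3.sub (k0.const_mul 2)
    have mono : ∫ z : Ω × Ω, (2 + ε ^ 2 * (Y z.1 ^ 2 + Y z.2 ^ 2 - 2 * (Y z.1 * Y z.2)))
        ∂(μ.prod μ) ≤ ∫ z : Ω × Ω, (exp (ε * Y z.1) * exp (-ε * Y z.2) +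
          exp (-ε * Y z.1) * exp (ε * Y z.2)) ∂(μ.prod μ) := by
      refine integral_mono ((integrable_const _).add
        (k4.const_mul _)) (j1.add j2) fun z => ?_
      have := two_add_sq_le (ε * (Y z.1 - Y z.2))
      have r1 : exp (ε * Y z.1) * exp (-ε * Y z.2) = exp (ε * (Y z.1 - Y z.2)) := by
        rw [← exp_add]; congr 1; ring
      have r2 : exp (-ε * Y z.1) * exp (ε * Y z.2) = exp (-(ε * (Y z.1 - Y z.2))) := by
        rw [← exp_add]; congr 1; ring
      simp only
      rw [r1, r2]
      linarith
    rw [integral_add j1 j2, e1, e2, integral_add (integrable_const _)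
        (k4.const_mul _), integral_const_mul,
      integral_sub k3 (k0.const_mul 2), integral_add k1 k2, integral_const_mul,
      f0, f1, f2] at mono
    simp only [integral_const, probReal_univ, one_smul] at mono
    nlinarith
  by_contra hcon
  push Not at hcon
  have hn0 : (0 : ℝ) ≤ n := Nat.cast_nonneg n
  set W := 2 * (n * V + V + 1) with hW
  have hnV : 0 ≤ n * V := mul_nonneg hn0 hV0
  have hW0 : 0 < W := by positivity
  set t := (V - n) / W with ht
  have ht0 : 0 < t := div_pos (by linarith) hW0
  have ht1 : t < 1 := (div_lt_one hW0).2 (by linarith)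
  have htW : t * W = V - n := div_mul_cancel₀ _ hW0.ne'
  have h1 := hreal (√t) (Real.sqrt_pos.2 ht0) (by rw [Real.sqrt_lt' one_pos]; simpa using ht1)
  rw [Real.sq_sqrt ht0.le] at h1
  have h2 : 1 - n * t ≤ (1 - t) ^ n := by
    have := one_add_mul_le_pow (a := -t) (by linarith) n
    rw [← sub_eq_add_neg] at this
    linarith
  have h3 : (1 - n * t) * (1 + t * V) ≤ 1 :=
    (mul_le_mul_of_nonneg_right h2 (by positivity)).trans h1
  have h4 : t * (V - n - n * V * t) ≤ 0 := by nlinarith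
  have h5 : V - n - n * V * t ≤ 0 := by
    by_contra h6
    push Not at h6
    exact absurd (mul_pos ht0 h6) (not_lt.2 h4)
  have h7 : 0 ≤ t * V := by positivity
  nlinarith

lemma truncGaussian_variance {n : ℕ} {K : Set (EuclideanSpace ℝ (Fin n))} (hK : Convex ℝ K)
    (hKm : MeasurableSet K) (hpos : 0 < (_root_.stdGaussian n K).toReal) :
    MemLp (fun x => ‖x‖ ^ 2) 2 (truncGaussian n K) ∧
      variance (fun x => ‖x‖ ^ 2) (truncGaussian n K) ≤ 4 * n := by
  have hp := truncGaussian_isProb hpos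
  obtain ⟨h1, h2⟩ := variance_le_of_mgf (μ := truncGaussian n K)
    (Y := fun x => ‖x‖ ^ 2 / 2) (by fun_prop) n fun ε h0 h1 => mgf_prod_le hK hKm hpos h0 h1
  have e : (fun x : EuclideanSpace ℝ (Fin n) => ‖x‖ ^ 2) = fun x => 2 * (‖x‖ ^ 2 / 2) := by
    ext x; ring
  rw [e]
  refine ⟨h1.const_mul 2, ?_⟩
  rw [variance_const_mul]
  linarith

lemma integral_bind_nonneg {Ω E : Type*} [MeasurableSpace Ω] [MeasurableSpace E]
    (π' : Measure Ω) (κ : Kernel Ω E) {k : E → ℝ} (hk : Measurable k) (hk0 : ∀ x, 0 ≤ k x)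
    (hi : ∀ ω, Integrable k (κ ω)) :
    Measurable (fun ω => ∫ x, k x ∂(κ ω)) ∧
    ∫ x, k x ∂(π'.bind κ) = ∫ ω, ∫ x, k x ∂(κ ω) ∂π' ∧
    (Integrable k (π'.bind κ) → Integrable (fun ω => ∫ x, k x ∂(κ ω)) π') := by
  have hl : ∀ ω, ∫⁻ x, ENNReal.ofReal (k x) ∂(κ ω) = ENNReal.ofReal (∫ x, k x ∂(κ ω)) :=
    fun ω => (ofReal_integral_eq_lintegral_ofReal (hi ω) (ae_of_all _ hk0)).symm
  have hb : ∫⁻ x, ENNReal.ofReal (k x) ∂(π'.bind κ)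
      = ∫⁻ ω, ENNReal.ofReal (∫ x, k x ∂(κ ω)) ∂π' := by
    rw [Measure.lintegral_bind κ.measurable.aemeasurable (by fun_prop)]
    exact lintegral_congr hl
  have hn : ∀ ω, 0 ≤ ∫ x, k x ∂(κ ω) := fun ω => integral_nonneg hk0
  have hm : Measurable (fun ω => ∫ x, k x ∂(κ ω)) := by
    have : Measurable fun ω => (∫⁻ x, ENNReal.ofReal (k x) ∂(κ ω)).toReal :=
      (Measurable.lintegral_kernel (by fun_prop)).ennreal_toReal
    convert this using 2 with ω
    rw [hl, ENNReal.toReal_ofReal (hn ω)]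
  refine ⟨hm, ?_, fun hI => ⟨hm.aestronglyMeasurable, ?_⟩⟩
  · rw [integral_eq_lintegral_of_nonneg_ae (ae_of_all _ hk0) hk.aestronglyMeasurable,
      integral_eq_lintegral_of_nonneg_ae (ae_of_all _ hn) hm.aestronglyMeasurable, hb]
  · rw [hasFiniteIntegral_iff_ofReal (ae_of_all _ hn), ← hb]
    exact (hasFiniteIntegral_iff_ofReal (ae_of_all _ hk0)).1 hI.2

/-- mean and variance of `‖x‖²` under a mixture of Gaussians truncated to
symmetric convex sets, in terms of the component means `a(ω)`. -/
theorem mixture_sq_norm_mean_and_variance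
    {Ω : Type*} [MeasurableSpace Ω] (π' : Measure Ω) [IsProbabilityMeasure π']
    (n : ℕ) (K : Ω → Set (EuclideanSpace ℝ (Fin n)))
    (hKconv : ∀ ω, Convex ℝ (K ω)) (hKsymm : ∀ ω, ∀ x ∈ K ω, -x ∈ K ω)
    (hKmeas : ∀ ω, MeasurableSet (K ω))
    (hKpos : ∀ ω, 0 < (stdGaussian n (K ω)).toReal)
    (κ : ProbabilityTheory.Kernel Ω (EuclideanSpace ℝ (Fin n))) [IsMarkovKernel κ]
    (hκ : ∀ ω, κ ω = truncGaussian n (K ω))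
    (D : Measure (EuclideanSpace ℝ (Fin n))) (hD : D = π'.bind (fun ω => κ ω))
    (a : Ω → ℝ) (ha : ∀ ω, a ω = ∫ x, ‖x‖ ^ 2 ∂(truncGaussian n (K ω))) :
    (∫ x, ‖x‖ ^ 2 ∂D = ∫ ω, a ω ∂π') ∧
    variance (fun x => ‖x‖ ^ 2) D ≤ 4 * n + variance a π' := by
  subst hD
  have hT : ∀ ω, MemLp (fun x => ‖x‖ ^ 2) 2 (κ ω) ∧
      variance (fun x => ‖x‖ ^ 2) (κ ω) ≤ 4 * n := fun ω => by
    rw [hκ ω]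
    exact truncGaussian_variance (hKconv ω) (hKmeas ω) (hKpos ω)
  have ha' : a = fun ω => ∫ x, ‖x‖ ^ 2 ∂(κ ω) := by
    ext ω; rw [ha, hκ]
  obtain ⟨m1, e1, -⟩ := integral_bind_nonneg π' κ
    (k := fun x : EuclideanSpace ℝ (Fin n) => ‖x‖ ^ 2) (by fun_prop)
    (fun x => by positivity) (fun ω => (hT ω).1.integrable one_le_two)
  obtain ⟨m2, e2, i2⟩ := integral_bind_nonneg π' κ
    (k := fun x : EuclideanSpace ℝ (Fin n) => (‖x‖ ^ 2) ^ 2) (by fun_prop)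
    (fun x => by positivity) (fun ω => (hT ω).1.integrable_sq)
  rw [← ha'] at m1
  have e1' : ∫ x, ‖x‖ ^ 2 ∂(π'.bind κ) = ∫ ω, a ω ∂π' := by rw [e1, ha']
  refine ⟨e1', ?_⟩
  have hva : 0 ≤ variance a π' := variance_nonneg _ _
  by_cases hM : MemLp (fun x : EuclideanSpace ℝ (Fin n) => ‖x‖ ^ 2) 2 (π'.bind κ)
  swap
  · rw [variance_of_not_memLp (by fun_prop) hM]
    positivity
  have hprob : IsProbabilityMeasure (π'.bind κ) := by infer_instance
  have hb := i2 hM.integrable_sq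
  have hvar : ∀ ω, variance (fun x => ‖x‖ ^ 2) (κ ω) = ∫ x, (‖x‖ ^ 2) ^ 2 ∂(κ ω) - a ω ^ 2 :=
    fun ω => by rw [variance_eq_sub (hT ω).1, ha']; rfl
  have hle : ∀ ω, a ω ^ 2 ≤ ∫ x, (‖x‖ ^ 2) ^ 2 ∂(κ ω) := fun ω => by
    have h1 := hvar ω
    have h2 : 0 ≤ variance (fun x => ‖x‖ ^ 2) (κ ω) := variance_nonneg _ _
    linarith
  have ha2 : Integrable (fun ω => a ω ^ 2) π' :=
    hb.mono' (by fun_prop) (ae_of_all _ fun ω => by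
      rw [Real.norm_of_nonneg (sq_nonneg _)]; exact hle ω)
  have haM : MemLp a 2 π' := (memLp_two_iff_integrable_sq m1.aestronglyMeasurable).2 ha2
  rw [variance_eq_sub hM, variance_eq_sub haM]
  have h1 : ∫ x, (‖x‖ ^ 2) ^ 2 ∂(π'.bind κ) ≤ 4 * n + ∫ ω, a ω ^ 2 ∂π' := by
    rw [e2]
    calc ∫ ω, ∫ x, (‖x‖ ^ 2) ^ 2 ∂(κ ω) ∂π' ≤ ∫ ω, (4 * (n : ℝ) + a ω ^ 2) ∂π' := by
          refine integral_mono hb ((integrable_const _).add ha2) fun ω => ?_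
          have h1 := hvar ω
          have h2 := (hT ω).2
          simp only
          linarith
      _ = 4 * n + ∫ ω, a ω ^ 2 ∂π' := by
          rw [integral_add (integrable_const _) ha2]; simp
  simp only [Pi.pow_apply]
  rw [e1']
  linarith
end

section
/- There exist absolute constants c, C > 0 such that the following holds. Let (Ω, 𝒜, π) be a probability space and let ω ↦ K_ω assign to each ω ∈ Ω a symmetric convex set K_ω ⊆ ℝⁿ with vol(K_ω) > 0, such that ω ↦ N(0,I_n)|_{K_ω} is a Markov kernel from Ω to ℝⁿ, and let D = ∫_Ω N(0,I_n)|_{K_ω} dπ(ω) be the mixture measure. Suppose the total variation distance between D and γ_n is at least ε for some ε ∈ (0,1). Then for every integer T ≥ C·n/ε², if x⁽¹⁾, …, x⁽ᵀ⁾ are i.i.d. draws from D, then P[(1/T)·∑_{i=1}^T ‖x⁽ⁱ⁾‖² ≥ n − cε/2] ≤ 1/10. -/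
open MeasureTheory ProbabilityTheory Real

/-- The total variation distance between two measures: the supremum over measurable sets
of the absolute difference of their masses. -/
noncomputable def tvDist {E : Type*} [MeasurableSpace E] (μ ν : Measure E) : ℝ :=
  ⨆ A : {A : Set E // MeasurableSet A}, |(μ A.1).toReal - (ν A.1).toReal|


section Part1

open scoped Pointwise

abbrev EE (n : ℕ) := EuclideanSpace ℝ (Fin n)

noncomputable def gdens (n : ℕ) (x : EE n) : ℝ :=
  (2 * π) ^ (-(n : ℝ) / 2) * Real.exp (-‖x‖ ^ 2 / 2)

lemma gdens_nonneg (n : ℕ) (x : EE n) : 0 ≤ gdens n x := by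
  unfold gdens; positivity

lemma gdens_measurable (n : ℕ) : Measurable (gdens n) := by
  unfold gdens; fun_prop

lemma integral_stdG {n : ℕ} {F : Type*} [NormedAddCommGroup F] [NormedSpace ℝ F]
    (f : EE n → F) :
    ∫ x, f x ∂(_root_.stdGaussian n) = ∫ x, gdens n x • f x := by
  unfold _root_.stdGaussian
  rw [integral_withDensity_eq_integral_toReal_smul]
  · refine integral_congr_ae (Filter.Eventually.of_forall fun x => ?_)
    change (ENNReal.ofReal (gdens n x)).toReal • f x = _
    rw [ENNReal.toReal_ofReal (gdens_nonneg n x)]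
  · exact (gdens_measurable n).ennreal_ofReal
  · exact Filter.Eventually.of_forall fun x => ENNReal.ofReal_lt_top

lemma setIntegral_stdG {n : ℕ} (f : EE n → ℝ) {K : Set (EE n)} (hK : MeasurableSet K) :
    ∫ x in K, f x ∂(_root_.stdGaussian n) = ∫ x in K, gdens n x * f x := by
  rw [← integral_indicator hK, integral_stdG, ← integral_indicator hK]
  congr 1
  ext x
  by_cases h : x ∈ K <;> simp [h]

lemma integrable_gdens (n : ℕ) : Integrable (gdens n) := by
  have := (GaussianFourier.integrable_cexp_neg_mul_sq_norm_add (V := EE n) (b := 1/2)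
    (by norm_num) 0 0).norm
  simp only [Complex.norm_exp] at this
  refine (this.const_mul ((2 * π) ^ (-(n : ℝ) / 2))).congr (Filter.Eventually.of_forall fun x => ?_)
  simp only [gdens]
  congr 2
  norm_num [← Complex.ofReal_pow]
  ring

instance (n : ℕ) : IsFiniteMeasure (_root_.stdGaussian n) := by
  unfold _root_.stdGaussian
  exact isFiniteMeasure_withDensity_ofReal (integrable_gdens n).2

lemma stdG_eq (n : ℕ) : _root_.stdGaussian n = ProbabilityTheory.stdGaussian (EE n) := by
  apply Measure.ext_of_charFun
  ext t
  rw [charFun_stdGaussian, charFun_apply, integral_stdG]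
  have h := GaussianFourier.integral_cexp_neg_mul_sq_norm_add (V := EE n) (b := 1/2)
    (by norm_num) Complex.I t
  have h2 : ∀ x : EE n, gdens n x • Complex.exp ((inner ℝ x t : ℝ) * Complex.I)
      = (((2 * π) ^ (-(n : ℝ) / 2) : ℝ) : ℂ) *
        Complex.exp (-(1/2) * ‖x‖ ^ 2 + Complex.I * (inner ℝ t x : ℝ)) := by
    intro x
    rw [Complex.exp_add, gdens, real_inner_comm, Complex.real_smul]
    push_cast
    rw [mul_assoc]
    congr 2
    · congr 1; ring
    · congr 1; ring
  simp_rw [h2]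
  rw [integral_const_mul, h, ← mul_assoc]
  have h3 : (((2 * π) ^ (-(n : ℝ) / 2) : ℝ) : ℂ) *
     ((π : ℂ) / (1/2)) ^ ((Module.finrank ℝ (EE n) : ℂ) / 2) = 1 := by
    have : ((π : ℂ) / (1/2)) ^ ((Module.finrank ℝ (EE n) : ℂ) / 2)
      = (((2 * π) ^ ((n : ℝ) / 2) : ℝ) : ℂ) := by
      rw [Complex.ofReal_cpow (by positivity)]
      congr 1
      · push_cast; ring
      · simp
    rw [this, ← Complex.ofReal_mul, ← Real.rpow_add (by positivity)]
    simp [neg_div]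
  rw [h3, one_mul]
  congr 1
  simp
  ring

instance (n : ℕ) : IsProbabilityMeasure (_root_.stdGaussian n) := by
  rw [stdG_eq]; infer_instance

lemma integrable_norm_pow (n k : ℕ) :
    Integrable (fun x : EE n => ‖x‖ ^ k) (_root_.stdGaussian n) := by
  rw [stdG_eq]
  exact (IsGaussian.memLp_id (ProbabilityTheory.stdGaussian (EE n)) k (by simp)).integrable_norm_pow'

lemma rot_preserving (n : ℕ) (θ : ℝ) :
    MeasurePreserving (fun p : EE n × EE n => (cos θ • p.1 + sin θ • p.2,
      - sin θ • p.1 + cos θ • p.2))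
      ((_root_.stdGaussian n).prod (_root_.stdGaussian n))
      ((_root_.stdGaussian n).prod (_root_.stdGaussian n)) := by
  refine ⟨by fun_prop, ?_⟩
  rw [stdG_eq]
  have := IsGaussian.map_rotation_eq_self (μ := ProbabilityTheory.stdGaussian (EE n))
    (by simp) θ
  convert this using 2
  ext p <;> simp [ContinuousLinearMap.rotation]

lemma scale_integral {n : ℕ} (k : ℕ) {K : Set (EE n)} (hK : MeasurableSet K) {R : ℝ} (hR : 0 < R) :
    ∫ x in R • K, ‖x‖ ^ (2*k) ∂(_root_.stdGaussian n) =
      R ^ (n + 2*k) * ∫ x in K, ‖x‖ ^ (2*k) * Real.exp ((1 - R^2)/2 * ‖x‖^2) ∂(_root_.stdGaussian n) := by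
  have hRK : MeasurableSet (R • K) := hK.const_smul_of_ne_zero hR.ne'
  rw [setIntegral_stdG _ hRK, setIntegral_stdG _ hK]
  have := Measure.setIntegral_comp_smul_of_pos volume (fun x => gdens n x * ‖x‖^(2*k)) K hR
  rw [smul_eq_mul, finrank_euclideanSpace_fin, eq_inv_mul_iff_mul_eq₀ (by positivity)] at this
  rw [← this, pow_add, mul_assoc, ← integral_const_mul (R ^ (2*k))]
  congr 1
  refine integral_congr_ae (Filter.Eventually.of_forall fun x => ?_)
  simp only [gdens, norm_smul, Real.norm_of_nonneg hR.le, mul_pow]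
  have : Real.exp (-(R^2 * ‖x‖^2)/2) = Real.exp (-‖x‖^2/2) * Real.exp ((1 - R^2)/2 * ‖x‖^2) := by
    rw [← Real.exp_add]; congr 1; ring
  rw [this]; ring

lemma integrable_stdG_iff {n : ℕ} (f : EE n → ℝ) :
    Integrable f (_root_.stdGaussian n) ↔ Integrable (fun x => gdens n x * f x) := by
  change Integrable f (volume.withDensity fun x => ENNReal.ofReal (gdens n x)) ↔ _
  rw [integrable_withDensity_iff_integrable_smul' (gdens_measurable n).ennreal_ofReal
    (Filter.Eventually.of_forall fun x => ENNReal.ofReal_lt_top)]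
  refine integrable_congr (Filter.Eventually.of_forall fun x => ?_)
  change (ENNReal.ofReal (gdens n x)).toReal • f x = _
  rw [ENNReal.toReal_ofReal (gdens_nonneg n x), smul_eq_mul]

lemma integrable_scale (n k : ℕ) {R : ℝ} (hR : 0 < R) :
    Integrable (fun x : EE n => ‖x‖ ^ (2*k) * Real.exp ((1 - R^2)/2 * ‖x‖^2))
      (_root_.stdGaussian n) := by
  rw [integrable_stdG_iff]
  have h := (integrable_stdG_iff _).1 (integrable_norm_pow n (2*k))
  have h2 := (h.comp_smul hR.ne').const_mul ((R^(2*k))⁻¹)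
  refine h2.congr (Filter.Eventually.of_forall fun x => ?_)
  simp only [gdens, norm_smul, Real.norm_of_nonneg hR.le, mul_pow]
  have : Real.exp (-(R^2 * ‖x‖^2)/2) = Real.exp (-‖x‖^2/2) * Real.exp ((1 - R^2)/2 * ‖x‖^2) := by
    rw [← Real.exp_add]; congr 1; ring
  rw [this]; field_simp

lemma exp_ineq {m s q : ℝ} (hm : 0 ≤ m) (hs : 0 ≤ s) (hms : m * s ≤ 1) (hq : 0 ≤ q) :
    1 - (1 - m * s) * Real.exp ((1 - (1-s)^2)/2 * q) ≤ s * (m - q) + s^2 * ((m+1) * q) := by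
  have h1 := Real.add_one_le_exp ((1 - (1-s)^2)/2 * q)
  have h2 := mul_le_mul_of_nonneg_left h1 (sub_nonneg.2 hms)
  have h3 : 0 ≤ m * s^3 * q := by positivity
  have h4 : 0 ≤ s^2 * q := by positivity
  nlinarith

lemma scale_ineq {n : ℕ} (k : ℕ) {K : Set (EE n)} (hK : MeasurableSet K) {s : ℝ} (hs : 0 ≤ s)
    (hs1 : s < 1) (hms : ((n + 2*k : ℕ) : ℝ) * s ≤ 1) :
    ∫ x in K, ‖x‖ ^ (2*k) ∂(_root_.stdGaussian n) -
      ∫ x in (1 - s) • K, ‖x‖ ^ (2*k) ∂(_root_.stdGaussian n) ≤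
    s * (∫ x in K, ‖x‖ ^ (2*k) * (((n + 2*k : ℕ) : ℝ) - ‖x‖^2) ∂(_root_.stdGaussian n)) +
    s^2 * ((((n + 2*k : ℕ) : ℝ) + 1) * ∫ x in K, ‖x‖ ^ (2*k + 2) ∂(_root_.stdGaussian n)) := by
  have hIntg : IntegrableOn (fun x => ‖x‖ ^ (2*k) * Real.exp ((1 - (1-s)^2)/2 * ‖x‖^2)) K
    (_root_.stdGaussian n) := (integrable_scale n k (by linarith)).integrableOn
  rw [scale_integral k hK (by linarith)]
  set m : ℝ := ((n + 2*k : ℕ) : ℝ) with hm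
  have hm0 : 0 ≤ m := by positivity
  have hb : 1 - m * s ≤ (1 - s) ^ (n + 2*k) := by
    have := one_add_mul_le_pow (a := -s) (by linarith) (n + 2*k)
    rw [← hm] at this
    calc 1 - m * s = 1 + m * (-s) := by ring
      _ ≤ _ := this
  have hi := fun j => (integrable_norm_pow n j).integrableOn (s := K)
  have hi2 : IntegrableOn (fun x : EE n => ‖x‖ ^ (2*k) * (m - ‖x‖^2)) K (_root_.stdGaussian n) := by
    refine (((hi (2*k)).mul_const m).sub (hi (2*k+2))).congr (Filter.Eventually.of_forall fun x => ?_)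
    simp only [Pi.sub_apply]; ring
  have h0 : 0 ≤ ∫ x in K, ‖x‖ ^ (2*k) * Real.exp ((1 - (1-s)^2)/2 * ‖x‖^2) ∂(_root_.stdGaussian n) :=
    integral_nonneg fun x => by positivity
  have h1 := mul_le_mul_of_nonneg_right hb h0
  calc _ ≤ ∫ x in K, ‖x‖ ^ (2*k) ∂(_root_.stdGaussian n) - (1 - m * s) *
        ∫ x in K, ‖x‖ ^ (2*k) * Real.exp ((1 - (1-s)^2)/2 * ‖x‖^2) ∂(_root_.stdGaussian n) := by linarith
    _ = ∫ x in K, (‖x‖ ^ (2*k) - (1 - m * s) *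
        (‖x‖ ^ (2*k) * Real.exp ((1 - (1-s)^2)/2 * ‖x‖^2))) ∂(_root_.stdGaussian n) := by
      rw [integral_sub (hi _) (hIntg.const_mul _), integral_const_mul]
    _ ≤ ∫ x in K, (s * (‖x‖ ^ (2*k) * (m - ‖x‖^2)) + s^2 * ((m+1) * ‖x‖ ^ (2*k + 2))) ∂(_root_.stdGaussian n) := by
      refine integral_mono ((hi _).sub (hIntg.const_mul _))
        ((hi2.const_mul _).add (((hi _).const_mul _).const_mul _)) fun x => ?_
      simp only
      have := mul_le_mul_of_nonneg_left (exp_ineq hm0 hs hms (sq_nonneg ‖x‖))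
        (show 0 ≤ ‖x‖^(2*k) by positivity)
      calc _ = _ := by ring
        _ ≤ _ := this
        _ = _ := by ring
    _ = _ := by
      rw [integral_add (hi2.const_mul _) (((hi _).const_mul _).const_mul _), integral_const_mul,
        integral_const_mul, integral_const_mul]

end Part1

section Part2

open scoped Pointwise

lemma deriv_nonneg {n : ℕ} (k : ℕ) {K : Set (EE n)} (hK : MeasurableSet K)
    (hstar : ∀ t : ℝ, 0 < t → t ≤ 1 → t • K ⊆ K) :
    0 ≤ ∫ x in K, ‖x‖ ^ (2*k) * (((n + 2*k : ℕ) : ℝ) - ‖x‖^2) ∂(_root_.stdGaussian n) := by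
  set I := ∫ x in K, ‖x‖ ^ (2*k) * (((n + 2*k : ℕ) : ℝ) - ‖x‖^2) ∂(_root_.stdGaussian n)
  set A := (((n + 2*k : ℕ) : ℝ) + 1) * ∫ x in K, ‖x‖ ^ (2*k + 2) ∂(_root_.stdGaussian n) with hA
  have hA0 : 0 ≤ A := mul_nonneg (by positivity) (integral_nonneg fun x => by positivity)
  have key : ∀ s : ℝ, 0 < s → s < 1 → ((n + 2*k : ℕ) : ℝ) * s ≤ 1 → 0 ≤ I + s * A := by
    intro s hs hs1 hms
    have h := scale_ineq k hK hs.le hs1 hms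
    have h2 : ∫ x in (1 - s) • K, ‖x‖ ^ (2*k) ∂(_root_.stdGaussian n) ≤
        ∫ x in K, ‖x‖ ^ (2*k) ∂(_root_.stdGaussian n) :=
      setIntegral_mono_set (integrable_norm_pow n (2*k)).integrableOn
        (Filter.Eventually.of_forall fun x => by positivity)
        (LE.le.eventuallyLE (hstar _ (by linarith) (by linarith)))
    have h3 : 0 ≤ s * (I + s * A) := by
      have : s * (I + s * A) = s * I + s^2 * A := by ring
      rw [this]
      exact le_trans (sub_nonneg.2 h2) h
    exact nonneg_of_mul_nonneg_right h3 hs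
  have ht : Filter.Tendsto (fun s : ℝ => I + s * A) (nhdsWithin 0 (Set.Ioi 0)) (nhds I) := by
    have : Continuous (fun s : ℝ => I + s * A) := by fun_prop
    have h := this.tendsto 0
    simp only [zero_mul, add_zero] at h
    exact h.mono_left nhdsWithin_le_nhds
  refine ge_of_tendsto ht ?_
  set m : ℝ := ((n + 2*k : ℕ) : ℝ) with hm
  have hm0 : 0 ≤ m := by positivity
  have hpos : (0:ℝ) < 1 / (m + 1) := by positivity
  filter_upwards [Ioo_mem_nhdsGT hpos] with s hs
  have h2 : s * (m + 1) < 1 := by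
    have := hs.2
    rwa [lt_div_iff₀ (by positivity)] at this
  exact key s hs.1 (by nlinarith [hs.1]) (by nlinarith [hs.1])

variable {n : ℕ}

/-- The open unit ball of the seminorm. -/
def pK (p : Seminorm ℝ (EE n)) : Set (EE n) := {x | p x < 1}

/-- The influence of the unit ball. -/
noncomputable def pI (p : Seminorm ℝ (EE n)) : ℝ :=
  ∫ x in pK p, ((n : ℝ) - ‖x‖^2) ∂(_root_.stdGaussian n)

lemma pK_meas {p : Seminorm ℝ (EE n)} (hp : Continuous p) : MeasurableSet (pK p) :=
  (isOpen_lt hp continuous_const).measurableSet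

lemma smul_pK (p : Seminorm ℝ (EE n)) {t : ℝ} (ht : 0 < t) : t • pK p = {x | p x < t} := by
  ext x
  rw [Set.mem_smul_set_iff_inv_smul_mem₀ ht.ne']
  simp only [pK, Set.mem_ofPred_eq, map_smul_eq_mul, norm_inv, Real.norm_of_nonneg ht.le]
  rw [inv_mul_lt_iff₀ ht, mul_one]

lemma pK_star (p : Seminorm ℝ (EE n)) (t : ℝ) (ht : 0 < t) (ht1 : t ≤ 1) : t • pK p ⊆ pK p := by
  rw [smul_pK p ht]
  intro x hx
  exact lt_of_lt_of_le hx ht1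

lemma pI_nonneg {p : Seminorm ℝ (EE n)} (hp : Continuous p) : 0 ≤ pI p := by
  have := deriv_nonneg 0 (pK_meas hp) (pK_star p)
  simpa [pI] using this

lemma integral_sq_le {p : Seminorm ℝ (EE n)} (hp : Continuous p) :
    ∫ x in pK p, ‖x‖^2 ∂(_root_.stdGaussian n) ≤ n * (_root_.stdGaussian n).real (pK p) := by
  have := pI_nonneg hp
  rw [pI, integral_sub (integrable_const _) (integrable_norm_pow n 2).integrableOn] at this
  simp at this
  linarith

lemma shell_le {p : Seminorm ℝ (EE n)} (hp : Continuous p) {s : ℝ} (hs : 0 ≤ s) :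
    (_root_.stdGaussian n).real {x | p x < 1 ∧ 1 - s ≤ p x} ≤
      s * pI p + s^2 * (((n:ℝ)+1)^2 * (_root_.stdGaussian n).real (pK p)) := by
  have hI := pI_nonneg hp
  by_cases h : ((n:ℝ)+1) * s < 1
  · have hs1 : s < 1 := by
      have : 0 ≤ (n:ℝ) * s := by positivity
      linarith
    have h1 := scale_ineq 0 (pK_meas hp) hs hs1 (by push_cast; nlinarith)
    simp only [mul_zero, pow_zero, integral_const, add_zero, one_mul, zero_add] at h1
    simp only [MeasurableSet.univ, measureReal_restrict_apply, Set.univ_inter, smul_eq_mul, mul_one] at h1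
    have hsub := pK_star p (1 - s) (by linarith) (by linarith)
    have hm : MeasurableSet ((1 - s) • pK p) := by
      rw [smul_pK p (by linarith)]
      exact (isOpen_lt hp continuous_const).measurableSet
    rw [← measureReal_sdiff hsub hm] at h1
    have hset : {x | p x < 1 ∧ 1 - s ≤ p x} = pK p \ ((1 - s) • pK p) := by
      rw [smul_pK p (by linarith)]
      ext x
      simp [pK]
    rw [hset]
    refine h1.trans ?_
    have h2 := integral_sq_le hp
    have h3 : (0:ℝ) ≤ (_root_.stdGaussian n).real (pK p) := measureReal_nonneg
    have h4 : ((n:ℝ) + 1) * ∫ x in pK p, ‖x‖^2 ∂(_root_.stdGaussian n) ≤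
       ((n:ℝ)+1)^2 * (_root_.stdGaussian n).real (pK p) := by nlinarith
    have h5 := mul_le_mul_of_nonneg_left h4 (sq_nonneg s)
    unfold pI
    linarith
  · push Not at h
    have h3 : (0:ℝ) ≤ (_root_.stdGaussian n).real (pK p) := measureReal_nonneg
    have h1 : (_root_.stdGaussian n).real {x | p x < 1 ∧ 1 - s ≤ p x} ≤
      (_root_.stdGaussian n).real (pK p) := measureReal_mono (fun x hx => hx.1)
    have h2 : 1 ≤ (((n:ℝ)+1) * s)^2 := one_le_pow₀ h
    have h4 : 0 ≤ s * pI p := by positivity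
    nlinarith [mul_le_mul_of_nonneg_right h2 h3]

end Part2

section Part3

variable {n : ℕ}

/-- Probability that a rotation by `θ` leaves the unit ball. -/
noncomputable def pQ (p : Seminorm ℝ (EE n)) (θ : ℝ) : ℝ :=
  ((_root_.stdGaussian n).prod (_root_.stdGaussian n)).real
    {z | p z.1 < 1 ∧ 1 ≤ p (cos θ • z.1 + sin θ • z.2)}

lemma pQ_add {p : Seminorm ℝ (EE n)} (hp : Continuous p) (α β : ℝ) :
    pQ p (α + β) ≤ pQ p α + pQ p β := by
  have hmeas : MeasurableSet {z : EE n × EE n | p z.1 < 1 ∧ 1 ≤ p (cos β • z.1 + sin β • z.2)} :=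
    ((isOpen_lt (hp.comp continuous_fst) continuous_const).measurableSet).inter
      (isClosed_le continuous_const (hp.comp (by fun_prop))).measurableSet
  have h := (rot_preserving n α).measureReal_preimage hmeas.nullMeasurableSet
  unfold pQ
  rw [← h]
  refine le_trans (measureReal_mono ?_) (measureReal_union_le _ _)
  rintro ⟨x, y⟩ ⟨h1, h2⟩
  by_cases h3 : 1 ≤ p (cos α • x + sin α • y)
  · exact Or.inl ⟨h1, h3⟩
  · refine Or.inr ⟨not_le.1 h3, ?_⟩
    simp only at h2 ⊢
    convert h2 using 2
    rw [cos_add, sin_add]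
    module

lemma pQ_nsmul {p : Seminorm ℝ (EE n)} (hp : Continuous p) (δ : ℝ) (N : ℕ) :
    pQ p ((N + 1 : ℕ) * δ) ≤ (N + 1 : ℕ) * pQ p δ := by
  induction N with
  | zero => simp
  | succ k ih =>
    have := pQ_add hp ((k + 1 : ℕ) * δ) δ
    have e : ((k + 1 + 1 : ℕ) : ℝ) * δ = (k + 1 : ℕ) * δ + δ := by push_cast; ring
    rw [e]
    push_cast at *
    linarith

lemma p_bound {p : Seminorm ℝ (EE n)} (hp : Continuous p) :
    ∃ C : ℝ, 0 < C ∧ ∀ x, p x ≤ C * ‖x‖ := p.bound_of_continuous_normedSpace hp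

lemma integrable_p {p : Seminorm ℝ (EE n)} (hp : Continuous p) :
    Integrable (fun x => p x) (_root_.stdGaussian n) := by
  obtain ⟨C, hC, h⟩ := p_bound hp
  refine Integrable.mono' ((integrable_norm_pow n 1).const_mul C) hp.aestronglyMeasurable
    (Filter.Eventually.of_forall fun x => ?_)
  rw [Real.norm_of_nonneg (apply_nonneg p x), pow_one]
  exact h x

lemma integrable_p_sq {p : Seminorm ℝ (EE n)} (hp : Continuous p) :
    Integrable (fun x => p x ^ 2) (_root_.stdGaussian n) := by
  obtain ⟨C, hC, h⟩ := p_bound hp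
  refine Integrable.mono' ((integrable_norm_pow n 2).const_mul (C^2))
    (hp.pow 2).aestronglyMeasurable
    (Filter.Eventually.of_forall fun x => ?_)
  rw [Real.norm_of_nonneg (by positivity), ← mul_pow]
  exact pow_le_pow_left₀ (apply_nonneg p x) (h x) 2

/-- Expected seminorm. -/
noncomputable def pE (p : Seminorm ℝ (EE n)) : ℝ := ∫ x, p x ∂(_root_.stdGaussian n)

lemma pQ_small {p : Seminorm ℝ (EE n)} (hp : Continuous p) {δ : ℝ} (hδ : 0 ≤ δ) :
    pQ p δ ≤ δ * pE p * pI p + δ^2 * ((((n:ℝ)+1)^2 * (_root_.stdGaussian n).real (pK p)) *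
      ∫ x, p x ^ 2 ∂(_root_.stdGaussian n)) := by
  set A := (((n:ℝ)+1)^2 * (_root_.stdGaussian n).real (pK p)) with hA
  have hA0 : 0 ≤ A := by positivity
  have hI := pI_nonneg hp
  have hmeas : MeasurableSet {z : EE n × EE n | p z.1 < 1 ∧ 1 ≤ p (cos δ • z.1 + sin δ • z.2)} :=
    ((isOpen_lt (hp.comp continuous_fst) continuous_const).measurableSet).inter
      (isClosed_le continuous_const (hp.comp (by fun_prop))).measurableSet
  have hIntg : Integrable (fun y => (δ * p y) * pI p + (δ * p y)^2 * A) (_root_.stdGaussian n) := by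
    refine (((integrable_p hp).const_mul δ).mul_const _).add ?_
    simp_rw [mul_pow]
    exact ((integrable_p_sq hp).const_mul _).mul_const _
  have hnn : ∀ y, 0 ≤ (δ * p y) * pI p + (δ * p y)^2 * A := fun y => by positivity
  have hval : ∫ y, ((δ * p y) * pI p + (δ * p y)^2 * A) ∂(_root_.stdGaussian n) =
      δ * pE p * pI p + δ^2 * (A * ∫ x, p x ^ 2 ∂(_root_.stdGaussian n)) := by
    simp_rw [mul_pow]
    rw [integral_add (((integrable_p hp).const_mul δ).mul_const _)
      (((integrable_p_sq hp).const_mul _).mul_const _), integral_mul_const, integral_const_mul,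
      integral_mul_const, integral_const_mul, pE]
    ring
  rw [← hval]
  unfold pQ
  rw [measureReal_def]
  refine ENNReal.toReal_le_of_le_ofReal (integral_nonneg hnn) ?_
  rw [Measure.prod_apply_symm hmeas, ofReal_integral_eq_lintegral_ofReal hIntg
    (Filter.Eventually.of_forall hnn)]
  refine lintegral_mono fun y => ?_
  rw [← ofReal_measureReal]
  refine ENNReal.ofReal_le_ofReal ?_
  refine le_trans (measureReal_mono ?_) (shell_le hp (by positivity))
  rintro x ⟨h1, h2⟩
  refine ⟨h1, ?_⟩
  simp only at h1 h2
  have h3 := map_add_le_add p (cos δ • x) (sin δ • y)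
  rw [map_smul_eq_mul, map_smul_eq_mul, Real.norm_eq_abs, Real.norm_eq_abs] at h3
  have h4 : |cos δ| * p x ≤ p x := mul_le_of_le_one_left (apply_nonneg p x) (abs_cos_le_one δ)
  have h5 : |sin δ| ≤ δ := (abs_sin_le_abs).trans (abs_of_nonneg hδ).le
  have h6 := mul_le_mul_of_nonneg_right h5 (apply_nonneg p y)
  linarith

lemma pQ_le {p : Seminorm ℝ (EE n)} (hp : Continuous p) {θ : ℝ} (hθ : 0 ≤ θ) :
    pQ p θ ≤ θ * pE p * pI p := by
  set B := (((n:ℝ)+1)^2 * (_root_.stdGaussian n).real (pK p)) *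
      ∫ x, p x ^ 2 ∂(_root_.stdGaussian n)
  have key : ∀ N : ℕ, pQ p θ ≤ θ * pE p * pI p + θ^2 * B * (1 / ((N:ℝ) + 1)) := by
    intro N
    have h1 := pQ_nsmul hp (θ / (N + 1 : ℕ)) N
    have h2 := pQ_small hp (δ := θ / (N + 1 : ℕ)) (by positivity)
    have hN : (0:ℝ) < (N + 1 : ℕ) := by positivity
    rw [mul_div_cancel₀ _ hN.ne'] at h1
    have h3 := mul_le_mul_of_nonneg_left h2 hN.le
    refine h1.trans (h3.trans (le_of_eq ?_))
    change _ * (_ + _ * B) = _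
    push_cast
    field_simp
  have ht : Filter.Tendsto (fun N : ℕ => θ * pE p * pI p + θ^2 * B * (1 / ((N:ℝ) + 1)))
      Filter.atTop (nhds (θ * pE p * pI p + θ^2 * B * 0)) :=
    (tendsto_one_div_add_atTop_nhds_zero_nat.const_mul _).const_add _
  rw [mul_zero, add_zero] at ht
  exact ge_of_tendsto' ht key

lemma pE_le {p : Seminorm ℝ (EE n)} (hp : Continuous p) {a : ℝ} (ha : 0 ≤ a)
    (hq : (_root_.stdGaussian n).real {x | a < p x} ≤ 1/4) : pE p ≤ 7 * a := by
  set γ := _root_.stdGaussian n with hγ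
  have hE0 : 0 ≤ pE p := integral_nonneg fun x => apply_nonneg p x
  set f : EE n → ℝ := Set.indicator {x | p x ≤ a} 1 with hf
  set h : EE n → ℝ := Set.indicator {x | a < p x} 1 with hh
  have mf : MeasurableSet {x | p x ≤ a} := (isClosed_le hp continuous_const).measurableSet
  have mh : MeasurableSet {x | a < p x} := (isOpen_lt continuous_const hp).measurableSet
  have if' : Integrable f γ := (integrable_const (1:ℝ)).indicator mf
  have ih' : Integrable h γ := (integrable_const (1:ℝ)).indicator mh
  have vh : ∫ x, h x ∂γ = γ.real {x | a < p x} := by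
    rw [hh, integral_indicator_one mh]
  have vf : ∫ x, f x ∂γ = 1 - γ.real {x | a < p x} := by
    rw [hf, integral_indicator_one mf, ← probReal_compl_eq_one_sub mh]
    congr 1; ext x; simp
  set q := γ.real {x | a < p x}
  have iprod : Integrable (fun z : EE n × EE n => p z.1 * f z.2) (γ.prod γ) :=
    (integrable_p hp).mul_prod if'
  have iprod2 : Integrable (fun z : EE n × EE n => p z.1 * h z.2) (γ.prod γ) :=
    (integrable_p hp).mul_prod ih'
  have e1 : ∫ z, p z.1 * f z.2 ∂(γ.prod γ) = pE p * (1 - q) := by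
    rw [integral_prod_mul (fun x => p x) f, vf, pE]
  have e2 : ∫ z, p z.1 * h z.2 ∂(γ.prod γ) = pE p * q := by
    rw [integral_prod_mul (fun x => p x) h, vh, pE]
  have hrot := rot_preserving n (π/4)
  have irot := hrot.integrable_comp_of_integrable iprod
  have e3 : ∫ z, ((fun z : EE n × EE n => p z.1 * f z.2) ∘ (fun w : EE n × EE n =>
      (cos (π/4) • w.1 + sin (π/4) • w.2, - sin (π/4) • w.1 + cos (π/4) • w.2))) z ∂(γ.prod γ)
      = pE p * (1 - q) := by
    rw [← e1]
    conv_rhs => rw [← hrot.map_eq]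
    rw [integral_map hrot.measurable.aemeasurable]
    · rfl
    · rw [hrot.map_eq]; exact iprod.aestronglyMeasurable
  have i2 : Integrable (fun z : EE n × EE n => a + p z.1 * h z.2) (γ.prod γ) :=
    (integrable_const a).add iprod2
  have i3 : Integrable (fun z : EE n × EE n => 3/2 * (a + p z.1 * h z.2) + a) (γ.prod γ) :=
    (i2.const_mul (3/2)).add (integrable_const a)
  have hmono := integral_mono irot i3 (by
    rintro ⟨x, y⟩
    simp only [Function.comp, cos_pi_div_four, sin_pi_div_four]
    set u := (√2/2) • x + (√2/2) • y with hu
    set v := -(√2/2) • x + (√2/2) • y with hv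
    have s2 : √2 * √2 = 2 := Real.mul_self_sqrt (by norm_num)
    have s3 : √2 ≤ 3/2 := by
      rw [Real.sqrt_le_left (by norm_num)]; norm_num
    have hx : u = √2 • x + v := by
      rw [hu, hv]; module
    have hy : u = √2 • y - v := by
      rw [hu, hv]; module
    have nx := apply_nonneg p x
    have ny := apply_nonneg p y
    have bx : p u ≤ 3/2 * p x + p v := by
      rw [hx]
      refine (map_add_le_add p _ _).trans ?_
      rw [map_smul_eq_mul, Real.norm_of_nonneg (Real.sqrt_nonneg _)]
      gcongr
    have by' : p u ≤ 3/2 * p y + p v := by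
      rw [hy]
      refine (map_sub_le_add p _ _).trans ?_
      rw [map_smul_eq_mul, Real.norm_of_nonneg (Real.sqrt_nonneg _)]
      gcongr
    by_cases hva : p v ≤ a
    · have : f v = 1 := by simp [hf, hva]
      rw [this, mul_one]
      by_cases hya : a < p y
      · have : h y = 1 := by simp [hh, hya]
        rw [this]; linarith
      · have : h y = 0 := by simp [hh, hya]
        rw [this]; linarith
    · have : f v = 0 := by simp [hf, hva]
      rw [this]
      have : 0 ≤ h y := Set.indicator_nonneg (fun _ _ => zero_le_one) y
      have := mul_nonneg nx this
      simp only [mul_zero]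
      linarith)
  rw [e3, integral_add (i2.const_mul (3/2)) (integrable_const _),
    integral_const_mul, integral_add (integrable_const _) iprod2, e2] at hmono
  simp at hmono
  nlinarith

lemma pI_ge {p : Seminorm ℝ (EE n)} (hp : Continuous p) :
    (_root_.stdGaussian n).real (pK p) * (1 - (_root_.stdGaussian n).real (pK p)) ≤ 128 * pI p := by
  have hI := pI_nonneg hp
  have hE0 : 0 ≤ pE p := integral_nonneg fun x => apply_nonneg p x
  have hg0 : 0 ≤ (_root_.stdGaussian n).real (pK p) := measureReal_nonneg
  have hpi := Real.pi_lt_four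
  have hpi0 := Real.pi_pos
  have hmK := pK_meas hp
  by_cases hE : pE p ≤ 16
  · have h1 := pQ_le hp (θ := π/2) (by positivity)
    have h2 : pQ p (π/2) = (_root_.stdGaussian n).real (pK p) *
        (1 - (_root_.stdGaussian n).real (pK p)) := by
      rw [← probReal_compl_eq_one_sub hmK, ← measureReal_prod_prod]
      unfold pQ
      congr 1
      ext z
      simp [pK]
    rw [← h2]
    refine h1.trans ?_
    have : π/2 * pE p ≤ 2 * 16 := by
      apply mul_le_mul _ hE hE0 (by norm_num)
      linarith
    nlinarith
  · push Not at hE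
    have hEpos : 0 < pE p := by linarith
    have ht1 : 16 / pE p ≤ 1 := by rw [div_le_one hEpos]; linarith
    have ht0 : 0 < 16 / pE p := by positivity
    set θ := Real.arcsin (16 / pE p) with hθ
    have hsin : sin θ = 16 / pE p := Real.sin_arcsin (by linarith) ht1
    have hθ0 : 0 ≤ θ := Real.arcsin_nonneg.2 ht0.le
    have hθ2 : θ ≤ π/2 := Real.arcsin_le_pi_div_two _
    have hθle : θ * pE p ≤ 32 := by
      have := Real.mul_le_sin hθ0 hθ2
      rw [hsin, le_div_iff₀ hEpos] at this
      have h3 : 2 / π * θ * pE p * π ≤ 16 * π := mul_le_mul_of_nonneg_right this hpi0.le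
      have h4 : 2 / π * θ * pE p * π = 2 * (θ * pE p) := by field_simp
      nlinarith
    have h1 := pQ_le hp hθ0
    have hq : 1/4 ≤ (_root_.stdGaussian n).real {x | pE p / 8 < p x} := by
      by_contra hcon
      have := pE_le hp (a := pE p / 8) (by positivity) (not_le.1 hcon).le
      linarith
    have h2 : (_root_.stdGaussian n).real (pK p) *
        (_root_.stdGaussian n).real {x | pE p / 8 < p x} ≤ pQ p θ := by
      rw [← measureReal_prod_prod]
      refine measureReal_mono ?_
      rintro ⟨x, y⟩ ⟨hx, hy⟩
      refine ⟨hx, ?_⟩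
      simp only [pK, Set.mem_ofPred_eq] at hx hy ⊢
      have h3 : p (sin θ • y) ≤ p (cos θ • x + sin θ • y) + p (cos θ • x) := by
        have := map_sub_le_add p (cos θ • x + sin θ • y) (cos θ • x)
        simpa using this
      rw [map_smul_eq_mul, map_smul_eq_mul, Real.norm_eq_abs, Real.norm_eq_abs,
        abs_of_nonneg (hsin ▸ ht0.le), hsin] at h3
      have h4 : |cos θ| * p x ≤ p x := mul_le_of_le_one_left (apply_nonneg p x) (abs_cos_le_one θ)
      have h5 : 16 / pE p * (pE p / 8) ≤ 16 / pE p * p y :=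
        mul_le_mul_of_nonneg_left hy.le ht0.le
      have h6 : 16 / pE p * (pE p / 8) = 2 := by field_simp; norm_num
      rw [hsin]
      linarith
    have h3 := mul_le_mul_of_nonneg_left hq hg0
    have h4 := mul_le_mul_of_nonneg_right hθle hI
    nlinarith

end Part3

section Part4

open scoped Pointwise Topology

variable {n : ℕ}

lemma exists_seminorm {K : Set (EE n)} (hc : Convex ℝ K) (hsym : ∀ x ∈ K, -x ∈ K)
    (hpos : 0 < (_root_.stdGaussian n K).toReal) :
    ∃ p : Seminorm ℝ (EE n), Continuous p ∧ K =ᵐ[_root_.stdGaussian n] pK p := by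
  have hac : _root_.stdGaussian n ≪ volume := withDensity_absolutelyContinuous _ _
  have hvol : volume K ≠ 0 := by
    intro h
    have := hac h
    rw [this] at hpos
    simp at hpos
  have hIntg : (interior K).Nonempty := by
    rw [hc.interior_nonempty_iff_affineSpan_eq_top]
    by_contra hne
    exact hvol (measure_mono_null (subset_affineSpan ℝ K)
      (Measure.addHaar_affineSubspace volume _ hne))
  have h0 : K ∈ 𝓝 (0 : EE n) := by
    rw [← mem_interior_iff_mem_nhds]
    obtain ⟨x, hx⟩ := hIntg
    have hneg : -x ∈ K := hsym x (interior_subset hx)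
    have := hc.combo_interior_self_mem_interior hx hneg (a := 1/2) (b := 1/2)
      (by norm_num) (by norm_num) (by norm_num)
    simpa using this
  refine ⟨Seminorm.of (gauge K) (gauge_add_le hc (absorbent_nhds_zero h0)) ?_,
    continuous_gauge hc h0, ?_⟩
  · intro a x
    rcases le_total 0 a with ha | ha
    · rw [gauge_smul_of_nonneg ha, Real.norm_of_nonneg ha, smul_eq_mul]
    · rw [← gauge_neg hsym, ← neg_smul, gauge_smul_of_nonneg (by linarith),
        Real.norm_of_nonpos ha, smul_eq_mul]
  · have : pK (Seminorm.of (gauge K) (gauge_add_le hc (absorbent_nhds_zero h0)) (by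
        intro a x
        rcases le_total 0 a with ha | ha
        · rw [gauge_smul_of_nonneg ha, Real.norm_of_nonneg ha, smul_eq_mul]
        · rw [← gauge_neg hsym, ← neg_smul, gauge_smul_of_nonneg (by linarith),
            Real.norm_of_nonpos ha, smul_eq_mul])) = interior K :=
      setOfPred_gauge_lt_one_eq_interior hc h0
    rw [this]
    exact (interior_ae_eq_of_null_frontier (hac (hc.addHaar_frontier volume))).symm

lemma trunc_facts {K : Set (EE n)} (hc : Convex ℝ K) (hsym : ∀ x ∈ K, -x ∈ K)
    (hpos : 0 < (_root_.stdGaussian n K).toReal) :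
    (∀ k : ℕ, Integrable (fun x => ‖x‖^k) (truncGaussian n K)) ∧
    (∫ x, ‖x‖^4 ∂(truncGaussian n K) ≤ (n + 2) * ∫ x, ‖x‖^2 ∂(truncGaussian n K)) ∧
    (∀ A, MeasurableSet A → ∫ x, ‖x‖^2 ∂(truncGaussian n K) +
      |(truncGaussian n K).real A - (_root_.stdGaussian n).real A| / 128 ≤ n) := by
  obtain ⟨p, hp, hKp⟩ := exists_seminorm hc hsym hpos
  have htr : truncGaussian n K = (_root_.stdGaussian n (pK p))⁻¹ •
      (_root_.stdGaussian n).restrict (pK p) := by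
    unfold truncGaussian
    rw [measure_congr hKp, Measure.restrict_congr_set hKp]
  rw [measure_congr hKp] at hpos
  rw [htr]
  set γ := _root_.stdGaussian n with hγ
  set g := γ.real (pK p) with hg
  have hg0 : 0 < g := hpos
  have hg1 : g ≤ 1 := measureReal_le_one
  have hne : γ (pK p) ≠ 0 := by
    intro h
    rw [h] at hpos; simp at hpos
  have hmul : ∀ f : EE n → ℝ, ∫ x, f x ∂((γ (pK p))⁻¹ • γ.restrict (pK p)) =
      g⁻¹ * ∫ x in pK p, f x ∂γ := by
    intro f
    rw [integral_smul_measure, ENNReal.toReal_inv, smul_eq_mul]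
    rfl
  refine ⟨fun k => ?_, ?_, fun A hA => ?_⟩
  · exact ((integrable_norm_pow n k).restrict).smul_measure (ENNReal.inv_ne_top.2 hne)
  · rw [hmul, hmul]
    have h := deriv_nonneg 1 (pK_meas hp) (pK_star p)
    have h2 : ∫ x in pK p, ‖x‖ ^ (2*1) * (((n + 2*1 : ℕ) : ℝ) - ‖x‖^2) ∂γ =
        (n + 2) * ∫ x in pK p, ‖x‖^2 ∂γ - ∫ x in pK p, ‖x‖^4 ∂γ := by
      rw [← integral_const_mul, ← integral_sub
        ((integrable_norm_pow n 2).restrict.const_mul _) (integrable_norm_pow n 4).restrict]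
      congr 1
      ext x
      push_cast
      ring
    rw [h2] at h
    have : 0 < g⁻¹ := by positivity
    nlinarith
  · rw [hmul]
    have hI := pI_ge hp
    have hIeq : pI p = n * g - ∫ x in pK p, ‖x‖^2 ∂γ := by
      unfold pI
      rw [integral_sub (integrable_const _) (integrable_norm_pow n 2).restrict]
      simp [mul_comm, hg, hγ]
    have hA1 : ((γ (pK p))⁻¹ • γ.restrict (pK p)).real A = g⁻¹ * γ.real (A ∩ pK p) := by
      rw [measureReal_ennreal_smul_apply, measureReal_restrict_apply hA, ENNReal.toReal_inv]
      rfl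
    rw [hA1]
    have a1 : γ.real (A ∩ pK p) ≤ γ.real A := measureReal_mono Set.inter_subset_left
    have a2 : γ.real (A ∩ pK p) ≤ g := measureReal_mono Set.inter_subset_right
    have a3 : γ.real A ≤ γ.real (A ∩ pK p) + (1 - g) := by
      rw [hg, ← probReal_compl_eq_one_sub (pK_meas hp)]
      refine le_trans (measureReal_mono ?_) (measureReal_union_le _ _)
      intro x hx
      by_cases h : x ∈ pK p
      · exact Or.inl ⟨hx, h⟩
      · exact Or.inr h
    have a0 : 0 ≤ γ.real (A ∩ pK p) := measureReal_nonneg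
    set b := γ.real (A ∩ pK p)
    have hb1 : b ≤ g⁻¹ * b := by
      have : 1 ≤ g⁻¹ := (one_le_inv₀ hg0).2 hg1
      nlinarith
    have hb2 : g⁻¹ * b - b ≤ 1 - g := by
      have e : g⁻¹ * b - b = g⁻¹ * b * (1 - g) := by field_simp
      have h1 : g⁻¹ * b ≤ 1 := by
        rw [inv_mul_le_iff₀ hg0]; linarith
      rw [e]
      nlinarith
    have habs : |g⁻¹ * b - γ.real A| ≤ 1 - g := by
      rw [abs_le]; constructor <;> linarith
    have h5 : g⁻¹ * ∫ x in pK p, ‖x‖^2 ∂γ = n - g⁻¹ * pI p := by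
      rw [hIeq]; field_simp; ring
    have h6 : 1 - g ≤ 128 * (g⁻¹ * pI p) := by
      have := mul_le_mul_of_nonneg_left hI (inv_nonneg.2 hg0.le)
      change g⁻¹ * (g * (1 - g)) ≤ _ at this
      rw [inv_mul_cancel_left₀ hg0.ne'] at this
      linarith
    rw [h5]
    linarith

lemma bind_integral {Ω : Type*} [MeasurableSpace Ω] {π' : Measure Ω} [IsProbabilityMeasure π']
    (κ : ProbabilityTheory.Kernel Ω (EE n)) [IsMarkovKernel κ] {f : EE n → ℝ}
    (hf : Measurable f) (hf0 : ∀ x, 0 ≤ f x) (hi : ∀ ω, Integrable f (κ ω)) {B : ℝ}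
    (hB : ∀ ω, ∫ x, f x ∂(κ ω) ≤ B) :
    Integrable f (π'.bind (fun ω => κ ω)) ∧ Integrable (fun ω => ∫ x, f x ∂(κ ω)) π' ∧
    ∫ x, f x ∂(π'.bind (fun ω => κ ω)) = ∫ ω, ∫ x, f x ∂(κ ω) ∂π' := by
  have hm : StronglyMeasurable (fun ω => ∫ x, f x ∂(κ ω)) :=
    hf.stronglyMeasurable.integral_kernel
  have hnn : ∀ ω, 0 ≤ ∫ x, f x ∂(κ ω) := fun ω => integral_nonneg hf0
  have hI : Integrable (fun ω => ∫ x, f x ∂(κ ω)) π' := by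
    refine Integrable.mono' (integrable_const B) hm.aestronglyMeasurable
      (Filter.Eventually.of_forall fun ω => ?_)
    rw [Real.norm_of_nonneg (hnn ω)]
    exact hB ω
  have hl : ∫⁻ x, ENNReal.ofReal (f x) ∂(π'.bind (fun ω => κ ω)) =
      ENNReal.ofReal (∫ ω, ∫ x, f x ∂(κ ω) ∂π') := by
    rw [Measure.lintegral_bind κ.measurable.aemeasurable hf.ennreal_ofReal.aemeasurable,
      ofReal_integral_eq_lintegral_ofReal hI (Filter.Eventually.of_forall hnn)]
    refine lintegral_congr fun ω => ?_
    rw [ofReal_integral_eq_lintegral_ofReal (hi ω) (Filter.Eventually.of_forall hf0)]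
  refine ⟨?_, hI, ?_⟩
  · refine ⟨hf.aestronglyMeasurable, ?_⟩
    rw [hasFiniteIntegral_iff_ofReal (Filter.Eventually.of_forall hf0), hl]
    exact ENNReal.ofReal_lt_top
  · rw [integral_eq_lintegral_of_nonneg_ae (Filter.Eventually.of_forall hf0)
      hf.aestronglyMeasurable, hl, ENNReal.toReal_ofReal (integral_nonneg hnn)]

lemma bind_real {Ω : Type*} [MeasurableSpace Ω] {π' : Measure Ω} [IsProbabilityMeasure π']
    (κ : ProbabilityTheory.Kernel Ω (EE n)) [IsMarkovKernel κ] {A : Set (EE n)}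
    (hA : MeasurableSet A) :
    Integrable (fun ω => (κ ω).real A) π' ∧
    (π'.bind (fun ω => κ ω)).real A = ∫ ω, (κ ω).real A ∂π' := by
  have h := bind_integral (π' := π') κ (f := Set.indicator A 1)
    (measurable_one.indicator hA) (fun x => Set.indicator_nonneg (fun _ _ => zero_le_one) x)
    (fun ω => (integrable_const (1:ℝ)).indicator hA) (B := 1) (by
      intro ω
      rw [integral_indicator_one hA]
      exact measureReal_le_one)
  simp only [integral_indicator_one hA] at h
  exact ⟨h.2.1, h.2.2⟩

lemma chebyshev_pi {D : Measure (EE n)} [IsProbabilityMeasure D] {f : EE n → ℝ}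
    (hf : MemLp f 2 D) {T : ℕ} (hT : 0 < T) {t : ℝ} (ht : 0 < t) :
    (Measure.pi fun _ : Fin T => D)
      {x | (∫ y, f y ∂D) + t ≤ (1 / T : ℝ) * ∑ i, f (x i)} ≤
      ENNReal.ofReal (Var[f; D] / (T * t^2)) := by
  have hT' : (0:ℝ) < T := by exact_mod_cast hT
  have hL : ∀ i : Fin T, MemLp (fun x : Fin T → EE n => f (x i)) 2 (Measure.pi fun _ : Fin T => D) :=
    fun i => hf.comp_measurePreserving (measurePreserving_eval (fun _ : Fin T => D) i)
  have hS : MemLp (∑ i, fun x : Fin T → EE n => f (x i)) 2 (Measure.pi fun _ : Fin T => D) :=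
    memLp_finsetSum' _ fun i _ => hL i
  have hv := variance_sum_pi (μ := fun _ : Fin T => D) (X := fun _ => f) (fun _ => hf)
  have hmean : ∫ x, (∑ i, fun x : Fin T → EE n => f (x i)) x ∂(Measure.pi fun _ : Fin T => D) =
      T * ∫ y, f y ∂D := by
    simp only [Finset.sum_apply]
    rw [integral_finsetSum _ fun i _ => (hL i).integrable (by norm_num)]
    have : ∀ i : Fin T, ∫ x, f (x i) ∂(Measure.pi fun _ : Fin T => D) = ∫ y, f y ∂D := by
      intro i
      have hmp := measurePreserving_eval (fun _ : Fin T => D) i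
      conv_rhs => rw [← hmp.map_eq]
      rw [integral_map hmp.measurable.aemeasurable]
      rw [hmp.map_eq]; exact hf.1
    simp [this]
  have hch := meas_ge_le_variance_div_sq hS (c := T * t) (by positivity)
  rw [hv, hmean] at hch
  refine le_trans (measure_mono ?_) (hch.trans (ENNReal.ofReal_le_ofReal (le_of_eq ?_)))
  · intro x hx
    simp only [Set.mem_ofPred_eq, Finset.sum_apply] at hx ⊢
    refine le_trans ?_ (le_abs_self _)
    have := mul_le_mul_of_nonneg_left hx hT'.le
    have e : (T:ℝ) * (1 / T * ∑ i, f (x i)) = ∑ i, f (x i) := by field_simp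
    rw [e] at this
    linarith
  · simp
    field_simp

end Part4

/-- the distinguisher statistic for mixtures of symmetric convex truncations.
If the mixture `D` is at total variation distance at least `ε` from the standard Gaussian,
then the average squared norm of `T ≥ C·n/ε²` i.i.d. samples from `D` falls below
`n - c·ε/2` with probability at least `9/10`. -/
theorem symm_convex_mixture_distinguisher_correct :
    ∃ c C : ℝ, 0 < c ∧ 0 < C ∧
      ∀ {Ω : Type} [MeasurableSpace Ω] (π' : Measure Ω) [IsProbabilityMeasure π']
        (n : ℕ) (K : Ω → Set (EuclideanSpace ℝ (Fin n))),
        (∀ ω, Convex ℝ (K ω)) → (∀ ω, ∀ x ∈ K ω, -x ∈ K ω) →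
        (∀ ω, MeasurableSet (K ω)) →
        (∀ ω, 0 < (stdGaussian n (K ω)).toReal) →
        ∀ (κ : ProbabilityTheory.Kernel Ω (EuclideanSpace ℝ (Fin n))) [IsMarkovKernel κ],
        (∀ ω, κ ω = truncGaussian n (K ω)) →
        ∀ (D : Measure (EuclideanSpace ℝ (Fin n))), D = π'.bind (fun ω => κ ω) →
        ∀ ε : ℝ, 0 < ε → ε < 1 → ε ≤ tvDist D (stdGaussian n) →
        ∀ T : ℕ, C * n / ε ^ 2 ≤ T →
        (Measure.pi fun _ : Fin T => D)
            {x | (n : ℝ) - c * ε / 2 ≤ (1 / T : ℝ) * ∑ i, ‖x i‖ ^ 2} ≤ 1 / 10 := by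
  refine ⟨1/256, 120 * 256^2, by norm_num, by norm_num, ?_⟩
  intro Ω _ π' _ n K hconv hsym _ hpos κ _ hκ D hD ε hε hε1 htv T hT
  have hfacts := fun ω => trunc_facts (hconv ω) (hsym ω) (hpos ω)
  simp only [← hκ] at hfacts
  have hprob : IsProbabilityMeasure D := by
    subst hD
    infer_instance
  have hm2 : ∀ ω, ∫ x, ‖x‖^2 ∂(κ ω) ≤ n := by
    intro ω
    have := (hfacts ω).2.2 ∅ MeasurableSet.empty
    have h0 := abs_nonneg ((κ ω).real ∅ - (_root_.stdGaussian n).real ∅)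
    linarith
  have hm4 : ∀ ω, ∫ x, ‖x‖^4 ∂(κ ω) ≤ (n+2) * n := by
    intro ω
    refine (hfacts ω).2.1.trans ?_
    exact mul_le_mul_of_nonneg_left (hm2 ω) (by positivity)
  obtain ⟨hi2, hj2, he2⟩ := bind_integral (π' := π') κ (f := fun x : EE n => ‖x‖^2) (by fun_prop)
    (fun x => by positivity) (fun ω => (hfacts ω).1 2) hm2
  obtain ⟨hi4, hj4, he4⟩ := bind_integral (π' := π') κ (f := fun x : EE n => ‖x‖^4) (by fun_prop)
    (fun x => by positivity) (fun ω => (hfacts ω).1 4) hm4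
  rw [← hD] at hi2 he2 hi4 he4
  have hfour : ∫ x, ‖x‖^4 ∂D ≤ (n+2) * ∫ x, ‖x‖^2 ∂D := by
    rw [he4, he2, ← integral_const_mul]
    exact integral_mono hj4 (hj2.const_mul _) fun ω => (hfacts ω).2.1
  have hmean : ∫ x, ‖x‖^2 ∂D ≤ n - ε / 256 := by
    have : Nonempty {A : Set (EE n) // MeasurableSet A} := ⟨⟨∅, MeasurableSet.empty⟩⟩
    obtain ⟨⟨A, hA⟩, hAε⟩ := exists_lt_of_lt_ciSup (lt_of_lt_of_le (half_lt_self hε) htv)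
    obtain ⟨hjA, heA⟩ := bind_real (π' := π') κ hA
    rw [← hD] at heA
    change ε / 2 < |D.real A - (_root_.stdGaussian n).real A| at hAε
    have e1 : D.real A - (_root_.stdGaussian n).real A =
        ∫ ω, ((κ ω).real A - (_root_.stdGaussian n).real A) ∂π' := by
      rw [integral_sub hjA (integrable_const _), heA]
      simp
    have e2 : |D.real A - (_root_.stdGaussian n).real A| ≤
        ∫ ω, 128 * (n - ∫ x, ‖x‖^2 ∂(κ ω)) ∂π' := by
      rw [e1]
      refine (abs_integral_le_integral_abs).trans ?_
      refine integral_mono (hjA.sub (integrable_const _)).abs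
        (((integrable_const _).sub hj2).const_mul _) fun ω => ?_
      have := (hfacts ω).2.2 A hA
      dsimp only
      linarith
    rw [integral_const_mul, integral_sub (integrable_const _) hj2, ← he2] at e2
    simp at e2
    linarith
  set m := ∫ x, ‖x‖^2 ∂D with hm
  have hm0 : 0 ≤ m := integral_nonneg fun x => by positivity
  have hL : MemLp (fun x : EE n => ‖x‖^2) 2 D := by
    rw [memLp_two_iff_integrable_sq hi2.1]
    refine hi4.congr (Filter.Eventually.of_forall fun x => ?_)
    dsimp only
    ring
  have hvar : Var[fun x : EE n => ‖x‖^2; D] ≤ n * (2 + (n - m)) := by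
    rw [variance_eq_sub hL]
    have : ∫ x, ((fun x : EE n => ‖x‖^2)^2) x ∂D = ∫ x, ‖x‖^4 ∂D := by
      refine integral_congr_ae (Filter.Eventually.of_forall fun x => ?_)
      simp only [Pi.pow_apply]
      ring
    rw [this, ← hm]
    have h1 : m ≤ n := by linarith
    nlinarith
  have hn : (0:ℝ) < n := by linarith
  have hTpos : (0:ℝ) < T := lt_of_lt_of_le (by positivity) hT
  have hT0 : 0 < T := by exact_mod_cast hTpos
  have hμ : 0 < (n - m) / 2 := by linarith
  refine le_trans (measure_mono ?_) ((chebyshev_pi hL hT0 hμ).trans ?_)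
  · intro x hx
    simp only [Set.mem_ofPred_eq] at hx ⊢
    rw [← hm]
    linarith
  · have h10 : (1 / 10 : ENNReal) = ENNReal.ofReal (1/10) := by
      rw [ENNReal.ofReal_div_of_pos (by norm_num)]
      simp
    rw [h10]
    refine ENNReal.ofReal_le_ofReal ?_
    rw [div_le_iff₀ (by positivity)]
    refine hvar.trans ?_
    rw [div_le_iff₀ (by positivity)] at hT
    obtain ⟨u, hu⟩ : ∃ u, u = (n:ℝ) - m := ⟨_, rfl⟩
    rw [← hu]
    have hu1 : ε / 256 ≤ u := by linarith
    have hδ : 0 < ε / 256 := by positivity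
    have hT2 : 120 * n ≤ T * (ε/256)^2 := by nlinarith
    -- with d = ε/256 ≤ 1 we have (2 + u) d² ≤ 3 u²
    have h3 : (2 + u) * (ε/256)^2 ≤ 3 * u^2 := by
      have hd1 : ε / 256 ≤ 1 := by linarith
      have a1 : (ε/256)^2 ≤ u^2 := by gcongr
      have a2 : u * (ε/256)^2 ≤ u * (u * 1) := by
        rw [sq]
        have hu0 : 0 ≤ u := hδ.le.trans hu1
        gcongr
      nlinarith
    have hδ2 : 0 < (ε/256)^2 := by positivity
    have h4 : n * (2 + u) * (ε/256)^2 ≤ (1/10 * (T * (u/2)^2)) * (ε/256)^2 := by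
      have b1 : n * ((2 + u) * (ε/256)^2) ≤ n * (3 * u^2) := by gcongr
      have b2 : (120 * n) * u^2 ≤ (T * (ε/256)^2) * u^2 := by gcongr
      nlinarith
    exact le_of_mul_le_mul_right h4 hδ2
end

section
/- Let f : ℝ → ℝ≥0 be a log-concave function, integrable against the one-dimensional standard Gaussian measure γ₁ together with x·f(x) and x²·f(x), and suppose E_{x∼γ₁}[x·f(x)] = μ·E_{x∼γ₁}[f(x)] for some μ ∈ ℝ. Then E_{x∼γ₁}[x²·f(x)] ≤ (1 + μ²)·E_{x∼γ₁}[f(x)]. Furthermore, if f(x) = 0 for all x > ε (for some ε ∈ ℝ), then E_{x∼γ₁}[x²·f(x)] ≤ (1 + μ² − (1/(2π))·exp(−(ε−μ)²))·E_{x∼γ₁}[f(x)]. -/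
open MeasureTheory ProbabilityTheory Real

namespace VBL
open Set Filter Topology

/-- unnormalized Gaussian -/
noncomputable def g (y : ℝ) : ℝ := Real.exp (-(1/2) * y ^ 2)

lemma g_pos (y : ℝ) : 0 < g y := Real.exp_pos _

lemma g_le_one (y : ℝ) : g y ≤ 1 := by
  unfold g; rw [Real.exp_le_one_iff]; nlinarith [sq_nonneg y]

lemma g_cont : Continuous g := by unfold g; fun_prop

lemma g_deriv (y : ℝ) : HasDerivAt g (-y * g y) y := by
  have h : HasDerivAt (fun y : ℝ => -(1/2) * y ^ 2) (-y) y := by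
    exact ((hasDerivAt_pow 2 y).const_mul (-(1/2) : ℝ)).congr_deriv (by norm_num; ring)
  exact h.exp.congr_deriv (by unfold g; ring)

lemma g_int : Integrable g := integrable_exp_neg_mul_sq (by norm_num)

lemma g_int1 : Integrable (fun y => y * g y) := by
  have := integrable_rpow_mul_exp_neg_mul_sq (b := 1/2) (by norm_num) (s := 1) (by norm_num)
  simpa [g] using this

lemma g_int2 : Integrable (fun y => y ^ 2 * g y) := by
  have := integrable_rpow_mul_exp_neg_mul_sq (b := 1/2) (by norm_num) (s := 2) (by norm_num)
  simpa [g] using this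

lemma g_tot : ∫ y, g y = √(2 * π) := by
  have := integral_gaussian (1/2)
  unfold g; rw [this]; congr 1; ring

lemma tend_aux (c : ℝ) : Tendsto (fun y => -(y - c) * g y) (cocompact ℝ) (𝓝 0) := by
  have h1 := tendsto_rpow_abs_mul_exp_neg_mul_sq_cocompact (a := 1/2) (by norm_num) 1
  have h0 := tendsto_rpow_abs_mul_exp_neg_mul_sq_cocompact (a := 1/2) (by norm_num) 0
  have h := h1.add (h0.const_mul |c|)
  simp only [mul_zero, add_zero] at h
  refine squeeze_zero_norm (fun y => ?_) h
  simp only [Real.rpow_one, Real.rpow_zero, one_mul]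
  rw [norm_mul, norm_neg, Real.norm_eq_abs, Real.norm_eq_abs, abs_of_pos (g_pos y), ← add_mul]
  exact mul_le_mul_of_nonneg_right (abs_sub _ _) (g_pos y).le

lemma anti_deriv (c y : ℝ) :
    HasDerivAt (fun y => -(y - c) * g y) ((y ^ 2 - c * y - 1) * g y) y := by
  have h : HasDerivAt (fun y : ℝ => -(y - c)) (-1) y := ((hasDerivAt_id y).sub_const c).neg
  exact (h.mul (g_deriv y)).congr_deriv (by ring)

lemma q_int (c k : ℝ) : Integrable (fun y => (y ^ 2 - c * y - 1 + k) * g y) := by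
  have := (g_int2.sub (g_int1.const_mul c)).add (g_int.const_mul (k - 1))
  refine this.congr (Eventually.of_forall fun y => ?_)
  simp only [Pi.add_apply, Pi.sub_apply]; ring

lemma q_int' (c : ℝ) : Integrable (fun y => (y ^ 2 - c * y - 1) * g y) := by
  simpa using q_int c 0

lemma int_Iic (a c : ℝ) :
    ∫ y in Iic a, (y ^ 2 - c * y - 1) * g y = -(a - c) * g a := by
  have := integral_Iic_of_hasDerivAt_of_tendsto (f := fun y => -(y - c) * g y) (a := a)
    (m := 0) (anti_deriv c a).continuousAt.continuousWithinAt
    (fun y _ => anti_deriv c y) (q_int' c).integrableOn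
    ((tend_aux c).mono_left atBot_le_cocompact)
  simpa using this

lemma int_Ioi (a c : ℝ) :
    ∫ y in Ioi a, (y ^ 2 - c * y - 1) * g y = (a - c) * g a := by
  have := integral_Ioi_of_hasDerivAt_of_tendsto (f := fun y => -(y - c) * g y) (a := a)
    (m := 0) (anti_deriv c a).continuousAt.continuousWithinAt
    (fun y _ => anti_deriv c y) (q_int' c).integrableOn
    ((tend_aux c).mono_left atTop_le_cocompact)
  rw [this]; ring

lemma int_tot : ∫ y, (y ^ 2 - 1) * g y = 0 := by
  have h := intervalIntegral.integral_Iic_add_Ioi (b := 0) (q_int' 0).integrableOn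
    (q_int' 0).integrableOn
  rw [int_Iic, int_Ioi] at h
  simp only [zero_mul, sub_zero] at h
  rw [← h]; ring

/-- Gaussian cumulative function -/
noncomputable def G (x : ℝ) : ℝ := ∫ y in Iic x, g y

lemma G_nonneg (x : ℝ) : 0 ≤ G x := integral_nonneg (fun y => (g_pos y).le)

lemma G_le (x : ℝ) : G x ≤ 3 := by
  have h1 : G x ≤ ∫ y, g y :=
    setIntegral_le_integral g_int (Eventually.of_forall fun y => (g_pos y).le)
  rw [g_tot] at h1
  have : √(2 * π) ≤ 3 := by
    rw [Real.sqrt_le_left (by norm_num)]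
    nlinarith [Real.pi_lt_four]
  linarith

lemma G_deriv (x : ℝ) : HasDerivAt G (g x) x := by
  have h : G = fun u => G 0 + ∫ y in (0:ℝ)..u, g y := by
    ext u
    rw [← intervalIntegral.integral_Iic_sub_Iic g_int.integrableOn g_int.integrableOn]
    unfold G; ring
  rw [h]
  exact (intervalIntegral.integral_hasDerivAt_right g_int.intervalIntegrable
    (g_cont.stronglyMeasurableAtFilter _ _) g_cont.continuousAt).const_add _

lemma int_Iic_k (a c k : ℝ) :
    ∫ y in Iic a, (y ^ 2 - c * y - 1 + k) * g y = -(a - c) * g a + k * G a := by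
  rw [← int_Iic]
  unfold G
  rw [← integral_const_mul, ← integral_add (q_int' c).integrableOn (g_int.const_mul k).integrableOn]
  congr 1; ext y; ring

/-- key elementary bound -/
lemma key_bound (d x : ℝ) (hx : x ≤ d) :
    g d ^ 2 / (2 * π) * (1 + x * (G x / g x)) < 1 := by
  have hpi : 6 < 2 * π := by nlinarith [Real.pi_gt_three]
  have hg := g_pos x
  have hd := g_pos d
  have hd1 := g_le_one d
  have hx1 := g_le_one x
  have hG := G_nonneg x
  have hG3 := G_le x
  rw [div_mul_eq_mul_div, div_lt_one (by linarith)]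
  refine lt_of_le_of_lt ?_ (lt_trans (by norm_num : (4:ℝ) < 6) hpi)
  have hdd : g d ^ 2 ≤ 1 := by nlinarith
  have hq : 0 ≤ G x / g x := by positivity
  rcases le_total x 0 with h0 | h0
  · have : x * (G x / g x) ≤ 0 := mul_nonpos_of_nonpos_of_nonneg h0 hq
    nlinarith [mul_nonpos_of_nonneg_of_nonpos (sq_nonneg (g d)) this]
  · have hdx : g d ≤ g x := by
      unfold g; apply Real.exp_le_exp.2; nlinarith
    have hxg : x * g x ≤ 1 := by
      have h2 : x ≤ Real.exp (1/2 * x^2) := by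
        have := Real.add_one_le_exp (1/2 * x^2)
        nlinarith [sq_nonneg (x - 1)]
      have h3 : g x = (Real.exp (1/2 * x^2))⁻¹ := by
        rw [← Real.exp_neg]; unfold g; congr 1; ring
      rw [h3, ← div_eq_mul_inv, div_le_one (Real.exp_pos _)]; exact h2
    have h5 : g d ^ 2 * (x * (G x / g x)) ≤ g x ^ 2 * (x * (G x / g x)) := by
      apply mul_le_mul_of_nonneg_right _ (by positivity)
      exact pow_le_pow_left₀ hd.le hdx 2
    have h6 : g x ^ 2 * (x * (G x / g x)) = (x * g x) * G x := by field_simp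
    have h7 : (x * g x) * G x ≤ 1 * 3 := by
      apply mul_le_mul hxg hG3 hG (by norm_num)
    nlinarith

lemma key_anti (d x : ℝ) (hx : x ≤ d) :
    g d ^ 2 / (2 * π) * (G d / g d) ≤ d - x + g d ^ 2 / (2 * π) * (G x / g x) := by
  set k := g d ^ 2 / (2 * π) with hk
  have hder : ∀ y, HasDerivAt (fun y => d - y + k * (G y / g y))
      (-1 + k * (1 + y * (G y / g y))) y := by
    intro y
    have h1 : HasDerivAt (fun y : ℝ => d - y) (-1) y := (hasDerivAt_id y).const_sub d
    have h2 := ((G_deriv y).div (g_deriv y) (g_pos y).ne').const_mul k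
    refine (h1.add h2).congr_deriv ?_
    have := (g_pos y).ne'
    field_simp
    ring
  have ha : AntitoneOn (fun y => d - y + k * (G y / g y)) (Iic d) := by
    apply antitoneOn_of_deriv_nonpos (convex_Iic d)
    · exact fun y _ => (hder y).continuousAt.continuousWithinAt
    · exact fun y _ => (hder y).differentiableAt.differentiableWithinAt
    · intro y hy
      rw [(hder y).deriv]
      have := key_bound d y (interior_subset (s := Iic d) hy)
      linarith
  have := ha (mem_Iic.2 hx) (mem_Iic.2 le_rfl) hx
  simpa using this

lemma set_lemma (u Q : ℝ → ℝ) (S : Set ℝ) (hS : MeasurableSet S) (r : ℝ) (hr : 0 ≤ u r)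
    (hp : ∀ y ∈ S, Q y * (u y - u r) ≤ 0)
    (hi : Integrable (fun y => Q y * g y)) (hiu : Integrable (fun y => Q y * (u y * g y)))
    (hq : ∫ y in S, Q y * g y ≤ 0) : ∫ y in S, Q y * (u y * g y) ≤ 0 := by
  have h1 : ∫ y in S, Q y * (u y * g y) ≤ ∫ y in S, u r * (Q y * g y) := by
    apply setIntegral_mono_on hiu.integrableOn (hi.const_mul _).integrableOn hS
    intro y hy
    have := mul_nonpos_of_nonpos_of_nonneg (hp y hy) (g_pos y).le
    linarith
  rw [integral_const_mul] at h1
  exact h1.trans (mul_nonpos_of_nonneg_of_nonpos hr hq)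

lemma peak (u : ℝ → ℝ) (hu : ∀ y, 0 ≤ u y) (x0 c k : ℝ)
    (hmono : MonotoneOn u (Iio x0)) (hanti : AntitoneOn u (Ioi x0))
    (hQ : x0 ^ 2 - c * x0 - 1 + k < 0)
    (hiu : Integrable (fun y => (y ^ 2 - c * y - 1 + k) * (u y * g y)))
    (hL : ∫ y in Iic x0, (y ^ 2 - c * y - 1 + k) * g y ≤ 0)
    (S : Set ℝ) (hS : MeasurableSet S) (hSx : S ⊆ Ioi x0)
    (hS0 : ∀ y ∈ Ioi x0 \ S, u y = 0)
    (hR : ∫ y in S, (y ^ 2 - c * y - 1 + k) * g y ≤ 0) :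
    ∫ y, (y ^ 2 - c * y - 1 + k) * (u y * g y) ≤ 0 := by
  obtain ⟨s, hs0, hs⟩ : ∃ s : ℝ, 0 ≤ s ∧ s ^ 2 = c ^ 2 + 4 * (1 - k) := by
    refine ⟨√(c ^ 2 + 4 * (1 - k)), Real.sqrt_nonneg _, Real.sq_sqrt ?_⟩
    nlinarith [sq_nonneg (2 * x0 - c)]
  have hfac : ∀ y, y ^ 2 - c * y - 1 + k = (2 * y - c - s) * (2 * y - c + s) / 4 := by
    intro y; linear_combination hs / 4
  have habs : |2 * x0 - c| < s := by
    apply abs_lt_of_sq_lt_sq _ hs0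
    rw [hs]; linarith
  rw [abs_lt] at habs
  obtain ⟨ha1, ha2⟩ := habs
  rw [← intervalIntegral.integral_Iic_add_Ioi (b := x0) hiu.integrableOn hiu.integrableOn,
    setIntegral_eq_of_subset_of_forall_sdiff_eq_zero measurableSet_Ioi hSx
      (fun y hy => by rw [hS0 y hy]; ring), integral_Iic_eq_integral_Iio]
  rw [integral_Iic_eq_integral_Iio] at hL
  have e1 := set_lemma u (fun y => y ^ 2 - c * y - 1 + k) (Iio x0) measurableSet_Iio
    ((c - s) / 2) (hu _) (fun y hy => ?_) (q_int c k) hiu hL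
  · have e2 := set_lemma u (fun y => y ^ 2 - c * y - 1 + k) S hS
      ((c + s) / 2) (hu _) (fun y hy => ?_) (q_int c k) hiu hR
    · linarith
    · have hyx : x0 < y := hSx hy
      have hr : (c + s) / 2 ∈ Ioi x0 := by simp only [mem_Ioi]; linarith
      simp only [hfac]
      rcases le_total y ((c + s) / 2) with h | h
      · have := hanti hyx hr h
        apply mul_nonpos_of_nonpos_of_nonneg _ (by linarith)
        have := mul_nonpos_of_nonpos_of_nonneg (a := 2 * y - c - s) (b := 2 * y - c + s)
          (by linarith) (by linarith)
        linarith
      · have := hanti hr hyx h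
        apply mul_nonpos_of_nonneg_of_nonpos _ (by linarith)
        have := mul_nonneg (a := 2 * y - c - s) (b := 2 * y - c + s)
          (by linarith) (by linarith)
        linarith
  · have hyx : y < x0 := hy
    have hr : (c - s) / 2 ∈ Iio x0 := by simp only [mem_Iio]; linarith
    simp only [hfac]
    rcases le_total y ((c - s) / 2) with h | h
    · have := hmono hyx hr h
      apply mul_nonpos_of_nonneg_of_nonpos _ (by linarith)
      have := mul_nonneg_of_nonpos_of_nonpos (a := 2 * y - c - s) (b := 2 * y - c + s)
        (by linarith) (by linarith)
      linarith
    · have := hmono hr hyx h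
      apply mul_nonpos_of_nonpos_of_nonneg _ (by linarith)
      have := mul_nonpos_of_nonpos_of_nonneg (a := 2 * y - c - s) (b := 2 * y - c + s)
        (by linarith) (by linarith)
      linarith

lemma trichotomy (u : ℝ → ℝ) (hqc : ∀ x y z, x ≤ y → y ≤ z → min (u x) (u z) ≤ u y) :
    Monotone u ∨ Antitone u ∨ ∃ x0, MonotoneOn u (Iio x0) ∧ AntitoneOn u (Ioi x0) := by
  by_cases hm : Monotone u
  · exact Or.inl hm
  by_cases ha : Antitone u
  · exact Or.inr (Or.inl ha)
  refine Or.inr (Or.inr ?_)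
  have key : ∀ a b, a ≤ b → u a < u b → MonotoneOn u (Iic a) := by
    intro a b hab huab x hx y hy hxy
    simp only [mem_Iic] at hx hy
    by_contra! hlt
    have h1 := hqc x y b hxy (hy.trans hab)
    have h2 := hqc y a b hy hab
    rcases min_le_iff.1 h1 with h | h
    · linarith
    · rcases min_le_iff.1 h2 with h' | h' <;> linarith
  simp only [Monotone, not_forall, not_le] at hm
  simp only [Antitone, not_forall, not_le] at ha
  obtain ⟨p, q, hpq, hupq⟩ := hm
  obtain ⟨a, b, hab, huab⟩ := ha
  set S := {x | MonotoneOn u (Iic x)} with hSdef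
  have hne : S.Nonempty := ⟨a, key a b hab huab⟩
  have hbd : BddAbove S := by
    refine ⟨q, fun x hx => ?_⟩
    by_contra! h
    have := hx (mem_Iic.2 (hpq.trans h.le)) (mem_Iic.2 h.le) hpq
    linarith
  refine ⟨sSup S, ?_, ?_⟩
  · intro x hx y hy hxy
    obtain ⟨s, hs, hys⟩ := exists_lt_of_lt_csSup hne hy
    exact hs (mem_Iic.2 (hxy.trans hys.le)) (mem_Iic.2 hys.le) hxy
  · intro x hx y hy hxy
    by_contra! h
    have := le_csSup hbd (key x y hxy h)
    exact absurd this (not_le.2 hx)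

/-- monotone or antitone with zero mean: constant almost everywhere -/
lemma const_case (u : ℝ → ℝ) (h : Monotone u ∨ Antitone u)
    (hi1 : Integrable (fun y => y * (u y * g y)))
    (h1 : ∫ y, y * (u y * g y) = 0) : ∀ᵐ y, u y = u 0 := by
  have hz : ∫ y, y * g y = 0 := by
    have := integral_neg_eq_self (fun y => y * g y) volume
    have h2 : ∀ y, (-y) * g (-y) = -(y * g y) := by intro y; unfold g; simp
    simp only [h2, integral_neg] at this
    linarith
  have hI : Integrable (fun y => y * (u y - u 0) * g y) := by
    have := hi1.sub (g_int1.const_mul (u 0))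
    refine this.congr (Eventually.of_forall fun y => ?_)
    simp only [Pi.sub_apply]; ring
  have hint : ∫ y, y * (u y - u 0) * g y = 0 := by
    have e : ∀ y, y * (u y - u 0) * g y = y * (u y * g y) - u 0 * (y * g y) := by intro y; ring
    simp only [e]
    rw [integral_sub hi1 (g_int1.const_mul (u 0)), integral_const_mul, h1, hz]; simp
  have hae : ∀ᵐ y, y * (u y - u 0) * g y = 0 := by
    rcases h with h | h
    · have := (integral_eq_zero_iff_of_nonneg (fun y => ?_) hI).1 hint
      · exact this
      · apply mul_nonneg _ (g_pos y).le
        rcases le_total 0 y with hy | hy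
        · exact mul_nonneg hy (sub_nonneg.2 (h hy))
        · exact mul_nonneg_of_nonpos_of_nonpos hy (sub_nonpos.2 (h hy))
    · have := (integral_eq_zero_iff_of_nonneg (fun y => ?_) hI.neg).1
        (by simp only [Pi.neg_apply]; rw [integral_neg, hint, neg_zero])
      · filter_upwards [this] with y hy
        simpa using hy
      · simp only [Pi.zero_apply, Pi.neg_apply]
        rw [← neg_mul]
        apply mul_nonneg _ (g_pos y).le
        rw [neg_nonneg]
        rcases le_total 0 y with hy | hy
        · exact mul_nonpos_of_nonneg_of_nonpos hy (sub_nonpos.2 (h hy))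
        · exact mul_nonpos_of_nonpos_of_nonneg hy (sub_nonneg.2 (h hy))
  have hne : ∀ᵐ y : ℝ, y ≠ 0 := by simp [ae_iff]
  filter_upwards [hae, hne] with y hy hy0
  have := (g_pos y).ne'
  simp only [mul_eq_zero, hy0, this, or_false, false_or] at hy
  linarith

lemma expand (u : ℝ → ℝ)
    (hi0 : Integrable (fun y => u y * g y))
    (hi1 : Integrable (fun y => y * (u y * g y)))
    (hi2 : Integrable (fun y => y ^ 2 * (u y * g y)))
    (h1 : ∫ y, y * (u y * g y) = 0) (c k : ℝ) :
    Integrable (fun y => (y ^ 2 - c * y - 1 + k) * (u y * g y)) ∧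
    ∫ y, (y ^ 2 - c * y - 1 + k) * (u y * g y) =
      (∫ y, y ^ 2 * (u y * g y)) - (1 - k) * ∫ y, u y * g y := by
  have e : (fun y => (y ^ 2 - c * y - 1 + k) * (u y * g y)) =
    fun y => (y ^ 2 * (u y * g y) - c * (y * (u y * g y))) - (1 - k) * (u y * g y) := by
    ext y; ring
  have hA : Integrable (fun y => y ^ 2 * (u y * g y) - c * (y * (u y * g y))) :=
    hi2.sub (hi1.const_mul c)
  rw [e]
  refine ⟨hA.sub (hi0.const_mul _), ?_⟩
  rw [integral_sub hA (hi0.const_mul _),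
    integral_sub hi2 (hi1.const_mul c), integral_const_mul, integral_const_mul, h1]
  ring

lemma core (u : ℝ → ℝ) (hu : ∀ y, 0 ≤ u y)
    (hqc : ∀ x y z, x ≤ y → y ≤ z → min (u x) (u z) ≤ u y)
    (hi0 : Integrable (fun y => u y * g y))
    (hi1 : Integrable (fun y => y * (u y * g y)))
    (hi2 : Integrable (fun y => y ^ 2 * (u y * g y)))
    (h1 : ∫ y, y * (u y * g y) = 0) :
    (∫ y, y ^ 2 * (u y * g y)) ≤ (∫ y, u y * g y) ∧
    ∀ d, (∀ y, d < y → u y = 0) →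
      (∫ y, y ^ 2 * (u y * g y)) ≤ (1 - g d ^ 2 / (2 * π)) * ∫ y, u y * g y := by
  have hex := expand u hi0 hi1 hi2 h1
  by_cases hcase : Monotone u ∨ Antitone u
  · have hc := const_case u hcase hi1 h1
    have e2 : (∫ y, y ^ 2 * (u y * g y)) = ∫ y, u y * g y := by
      have h3 := (hex 0 0).2
      have h4 : ∫ y, (y ^ 2 - 0 * y - 1 + 0) * (u y * g y) = ∫ y, u 0 * ((y ^ 2 - 1) * g y) := by
        apply integral_congr_ae
        filter_upwards [hc] with y hy
        rw [hy]; ring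
      rw [h4, integral_const_mul, int_tot] at h3
      linarith
    refine ⟨e2.le, fun d hd => ?_⟩
    have hu0 : u 0 = 0 := by
      by_contra hne
      have : volume (Ioi d) = 0 := by
        refine measure_mono_null ?_ (ae_iff.1 hc)
        intro y hy
        simp only [mem_ofPred_eq]
        rw [hd y hy]
        exact fun h => hne h.symm
      simp at this
    have e0 : ∫ y, u y * g y = 0 := by
      rw [integral_congr_ae (g := fun _ => (0:ℝ))]
      · simp
      · filter_upwards [hc] with y hy
        rw [hy, hu0]; simp
    rw [e2, e0]; simp
  · obtain ⟨x0, hmono, hanti⟩ : ∃ x0, MonotoneOn u (Iio x0) ∧ AntitoneOn u (Ioi x0) := by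
      rcases trichotomy u hqc with h | h | h
      · exact absurd (Or.inl h) hcase
      · exact absurd (Or.inr h) hcase
      · exact h
    constructor
    · obtain ⟨hI, hE⟩ := hex x0 0
      have := peak u hu x0 x0 0 hmono hanti (by nlinarith) hI
        (by rw [int_Iic_k]; simp) (Ioi x0) measurableSet_Ioi subset_rfl (by simp)
        (by simp only [add_zero]; rw [int_Ioi]; simp)
      linarith
    · intro d hd
      rcases lt_or_ge d x0 with hlt | hle
      · exfalso
        apply hcase
        refine Or.inr ?_
        have hz : ∀ y, y < x0 → u y = 0 := by
          intro y hy
          have h5 : max y ((d + x0) / 2) < x0 := max_lt hy (by linarith)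
          have h6 := hmono (mem_Iio.2 hy) (mem_Iio.2 h5) (le_max_left _ _)
          rw [hd _ (lt_of_lt_of_le (by linarith : d < (d + x0) / 2) (le_max_right _ _))] at h6
          exact le_antisymm h6 (hu y)
        have hz' : ∀ y, u y = 0 := fun y => by
          rcases lt_or_ge y x0 with h | h
          · exact hz y h
          · exact hd y (by linarith)
        intro x y _
        rw [hz' x, hz' y]
      · set k := g d ^ 2 / (2 * π) with hk
        have hgx := g_pos x0
        have hgd := g_pos d
        obtain ⟨hI, hE⟩ := hex (x0 - k * (G x0 / g x0)) k
        have hkey := key_anti d x0 hle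
        have hb := key_bound d x0 hle
        rw [← hk] at hkey hb
        have hL0 : ∫ y in Iic x0, (y ^ 2 - (x0 - k * (G x0 / g x0)) * y - 1 + k) * g y = 0 := by
          rw [int_Iic_k]; field_simp; ring
        have := peak u hu x0 _ k hmono hanti (by nlinarith) hI hL0.le
          (Ioc x0 d) measurableSet_Ioc (fun y hy => hy.1)
          (fun y hy => hd y (by
            by_contra! h
            exact hy.2 ⟨hy.1, h⟩)) ?_
        · linarith
        · rw [← intervalIntegral.integral_of_le hle, ← intervalIntegral.integral_Iic_sub_Iic
            (q_int _ _).integrableOn (q_int _ _).integrableOn, hL0, int_Iic_k]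
          have h7 := mul_le_mul_of_nonneg_right hkey hgd.le
          have h8 : k * (G d / g d) * g d = k * G d := by field_simp
          rw [h8] at h7
          linarith

end VBL

/-- Vempala's quantitative one-dimensional Brascamp–Lieb inequality for a
log-concave weight `f` against the standard Gaussian, with center of mass `m`; together
with the sharper bound when `f` is supported on `(-∞, ε]`. -/
theorem vempala_brascamp_lieb_shifted
    (f : ℝ → ℝ) (hf0 : ∀ x, 0 ≤ f x)
    (hlc : ∀ x y lam : ℝ, 0 ≤ lam → lam ≤ 1 →
      f x ^ lam * f y ^ (1 - lam) ≤ f (lam * x + (1 - lam) * y))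
    (hint : Integrable f (gaussianReal 0 1))
    (hint1 : Integrable (fun x => x * f x) (gaussianReal 0 1))
    (hint2 : Integrable (fun x => x ^ 2 * f x) (gaussianReal 0 1))
    (m : ℝ)
    (hm : ∫ x, x * f x ∂(gaussianReal 0 1) = m * ∫ x, f x ∂(gaussianReal 0 1)) :
    (∫ x, x ^ 2 * f x ∂(gaussianReal 0 1)
        ≤ (1 + m ^ 2) * ∫ x, f x ∂(gaussianReal 0 1)) ∧
    (∀ ε : ℝ, (∀ x, ε < x → f x = 0) →
      ∫ x, x ^ 2 * f x ∂(gaussianReal 0 1)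
        ≤ (1 + m ^ 2 - (1 / (2 * π)) * Real.exp (-(ε - m) ^ 2))
            * ∫ x, f x ∂(gaussianReal 0 1)) := by
  obtain ⟨u, hudef⟩ : ∃ u : ℝ → ℝ, u = fun y => f (y + m) * Real.exp (-m * y) := ⟨_, rfl⟩
  obtain ⟨C, hC⟩ : ∃ C : ℝ, C = √(2 * π) * Real.exp (m ^ 2 / 2) := ⟨_, rfl⟩
  have hCpos : 0 < C := by rw [hC]; positivity
  have hpt : ∀ y, u y * VBL.g y = C * (gaussianPDFReal 0 1 (y + m) * f (y + m)) := by
    intro y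
    rw [hudef, hC, gaussianPDFReal_def, VBL.g]
    have h2 : √(2 * π) ≠ 0 := by positivity
    simp only [NNReal.coe_one, mul_one, sub_zero]
    have h3 : Real.exp (-m * y) * Real.exp (-(1/2) * y ^ 2)
        = Real.exp (m ^ 2 / 2) * Real.exp (-(y + m) ^ 2 / 2) := by
      rw [← Real.exp_add, ← Real.exp_add]; congr 1; ring
    have h4 : √(2 * π) * (√(2 * π))⁻¹ = 1 := mul_inv_cancel₀ h2
    linear_combination f (y + m) * h3 -
      Real.exp (m ^ 2 / 2) * Real.exp (-(y + m) ^ 2 / 2) * f (y + m) * h4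
  have hu : ∀ y, 0 ≤ u y := fun y => by
    rw [hudef]; exact mul_nonneg (hf0 _) (Real.exp_pos _).le
  have hqc : ∀ x y z, x ≤ y → y ≤ z → min (u x) (u z) ≤ u y := by
    intro x y z hxy hyz
    rcases hxy.eq_or_lt with rfl | hxy
    · exact min_le_left _ _
    have hxz : 0 < z - x := by linarith
    obtain ⟨l, hl⟩ : ∃ l, l = (z - y) / (z - x) := ⟨_, rfl⟩
    have hl0 : 0 ≤ l := by rw [hl]; apply div_nonneg <;> linarith
    have hl1 : l ≤ 1 := by rw [hl, div_le_one hxz]; linarith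
    have hy : y = l * x + (1 - l) * z := by
      have : l * (z - x) = z - y := by rw [hl]; field_simp
      linarith
    have h1 := hlc (x + m) (z + m) l hl0 hl1
    have h2 : l * (x + m) + (1 - l) * (z + m) = y + m := by rw [hy]; ring
    rw [h2] at h1
    have h3 : u x ^ l * u z ^ (1 - l) ≤ u y := by
      rw [hudef]
      simp only
      rw [Real.mul_rpow (hf0 _) (Real.exp_pos _).le, Real.mul_rpow (hf0 _) (Real.exp_pos _).le,
        ← Real.exp_mul, ← Real.exp_mul]
      have h4 : Real.exp (-m * y) = Real.exp (-m * x * l) * Real.exp (-m * z * (1 - l)) := by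
        rw [← Real.exp_add]; congr 1; rw [hy]; ring
      rw [h4]
      have := mul_le_mul_of_nonneg_right h1
        (mul_pos (Real.exp_pos (-m * x * l)) (Real.exp_pos (-m * z * (1 - l)))).le
      linarith
    refine le_trans ?_ h3
    have hM : 0 ≤ min (u x) (u z) := le_min (hu x) (hu z)
    rcases hM.eq_or_lt with h0 | h0
    · rw [← h0]
      exact mul_nonneg (Real.rpow_nonneg (hu x) _) (Real.rpow_nonneg (hu z) _)
    · calc min (u x) (u z) = min (u x) (u z) ^ l * min (u x) (u z) ^ (1 - l) := by
            rw [← Real.rpow_add h0]; simp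
        _ ≤ _ := by
          apply mul_le_mul
          · exact Real.rpow_le_rpow hM (min_le_left _ _) hl0
          · exact Real.rpow_le_rpow hM (min_le_right _ _) (by linarith)
          · exact Real.rpow_nonneg hM _
          · exact Real.rpow_nonneg (hu x) _
  -- transfer to Lebesgue measure
  have hconv : ∀ F : ℝ → ℝ, Integrable F (gaussianReal 0 1) →
      Integrable (fun y => gaussianPDFReal 0 1 (y + m) * F (y + m)) := by
    intro F hF
    rw [gaussianReal_of_var_ne_zero 0 one_ne_zero,
      integrable_withDensity_iff_integrable_smul' (measurable_gaussianPDF 0 1)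
        (Filter.Eventually.of_forall fun x => by simp [gaussianPDF])] at hF
    simp only [toReal_gaussianPDF, smul_eq_mul] at hF
    exact hF.comp_add_right m
  have hintc : ∀ F : ℝ → ℝ, ∫ x, F x ∂(gaussianReal 0 1) =
      ∫ y, gaussianPDFReal 0 1 (y + m) * F (y + m) := by
    intro F
    rw [integral_gaussianReal_eq_integral_smul one_ne_zero]
    exact (integral_add_right_eq_self (fun x => gaussianPDFReal 0 1 x * F x) m).symm
  have j0 := (hconv _ hint).const_mul C
  have j1 := (hconv _ hint1).const_mul C
  have j2 := (hconv _ hint2).const_mul C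
  have hi0 : Integrable (fun y => u y * VBL.g y) := by
    refine j0.congr (Filter.Eventually.of_forall fun y => ?_)
    simp only [hpt]
  have hi1 : Integrable (fun y => y * (u y * VBL.g y)) := by
    refine (j1.sub (j0.const_mul m)).congr (Filter.Eventually.of_forall fun y => ?_)
    simp only [hpt, Pi.sub_apply]; ring
  have hi2 : Integrable (fun y => y ^ 2 * (u y * VBL.g y)) := by
    refine ((j2.sub (j1.const_mul (2 * m))).add (j0.const_mul (m ^ 2))).congr
      (Filter.Eventually.of_forall fun y => ?_)
    simp only [hpt, Pi.sub_apply, Pi.add_apply]; ring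
  have k0 : C * ∫ x, f x ∂(gaussianReal 0 1) = ∫ y, u y * VBL.g y := by
    rw [hintc, ← integral_const_mul]; simp only [hpt]
  have k1 : C * ∫ x, x * f x ∂(gaussianReal 0 1) =
      (∫ y, y * (u y * VBL.g y)) + m * ∫ y, u y * VBL.g y := by
    rw [hintc, ← integral_const_mul, ← integral_const_mul, ← integral_add hi1 (hi0.const_mul m)]
    congr 1; ext y; rw [hpt]; ring
  have k2 : C * ∫ x, x ^ 2 * f x ∂(gaussianReal 0 1) =
      (∫ y, y ^ 2 * (u y * VBL.g y)) + ((2 * m) * (∫ y, y * (u y * VBL.g y))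
        + m ^ 2 * ∫ y, u y * VBL.g y) := by
    have hB : Integrable (fun y => (2 * m) * (y * (u y * VBL.g y)) + m ^ 2 * (u y * VBL.g y)) :=
      (hi1.const_mul (2 * m)).add (hi0.const_mul (m ^ 2))
    rw [hintc, ← integral_const_mul, ← integral_const_mul, ← integral_const_mul,
      ← integral_add (hi1.const_mul (2 * m)) (hi0.const_mul (m ^ 2)), ← integral_add hi2 hB]
    congr 1; ext y; rw [hpt]; ring
  have h1 : ∫ y, y * (u y * VBL.g y) = 0 := by
    rw [hm] at k1
    linear_combination m * k0 - k1
  obtain ⟨c1, c2⟩ := VBL.core u hu hqc hi0 hi1 hi2 h1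
  rw [h1, ← k0] at k2
  rw [← k0] at c1
  refine ⟨?_, fun ε hε => ?_⟩
  · refine le_of_mul_le_mul_left ?_ hCpos
    rw [k2]; linarith
  · have c := c2 (ε - m) (fun y hy => by
      rw [hudef]; simp only; rw [hε (y + m) (by linarith), zero_mul])
    have hg : VBL.g (ε - m) ^ 2 = Real.exp (-(ε - m) ^ 2) := by
      rw [VBL.g, ← Real.exp_nat_mul]; congr 1; push_cast; ring
    rw [hg, ← k0] at c
    refine le_of_mul_le_mul_left ?_ hCpos
    rw [k2]
    refine (add_le_add_left c _).trans (le_of_eq ?_)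
    ring
end

section
/- There is an absolute constant c > 0 such that the following holds. Let K ⊆ ℝⁿ be a convex set that contains the origin-centered Euclidean ball of radius r for some r > 0 (so in particular vol(K) > 0). Then E_{x ∼ N(0,I_n)|K}[‖x‖²] ≤ n − c·r·(1 − vol(K)). -/
open MeasureTheory ProbabilityTheory Real

lemma tg_density_integrable (n : ℕ) :
    Integrable (fun x : EuclideanSpace ℝ (Fin n) =>
      (2 * π) ^ (-(n : ℝ) / 2) * Real.exp (-‖x‖ ^ 2 / 2)) := by
  have h := GaussianFourier.integrable_cexp_neg_mul_sq_norm_add (V := EuclideanSpace ℝ (Fin n))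
    (b := 1 / 2) (by norm_num) 0 0
  have h2 := h.re
  refine Integrable.const_mul (h2.congr (Filter.Eventually.of_forall fun x => ?_)) _
  simp only [zero_mul, add_zero]
  have : (-(1 / 2 : ℂ) * (‖x‖ : ℂ) ^ 2) = ((-‖x‖ ^ 2 / 2 : ℝ) : ℂ) := by push_cast; ring
  rw [this, ← Complex.ofReal_exp]
  exact Complex.ofReal_re _

lemma tg_density_integral (n : ℕ) :
    ∫ x : EuclideanSpace ℝ (Fin n), (2 * π) ^ (-(n : ℝ) / 2) * Real.exp (-‖x‖ ^ 2 / 2) = 1 := by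
  rw [integral_const_mul]
  have h := GaussianFourier.integral_rexp_neg_mul_sq_norm (V := EuclideanSpace ℝ (Fin n))
    (b := 1 / 2) (by norm_num)
  have h2 : ∀ x : EuclideanSpace ℝ (Fin n), -‖x‖ ^ 2 / 2 = -(1 / 2) * ‖x‖ ^ 2 := fun x => by ring
  simp_rw [h2, h]
  rw [finrank_euclideanSpace_fin, show π / (1 / 2) = 2 * π by ring, ← Real.rpow_add (by positivity)]
  rw [show -(n : ℝ) / 2 + n / 2 = 0 by ring, Real.rpow_zero]

instance tg_isProb (n : ℕ) : IsProbabilityMeasure (_root_.stdGaussian n) := by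
  constructor
  rw [_root_.stdGaussian, withDensity_apply _ MeasurableSet.univ, Measure.restrict_univ,
    ← ofReal_integral_eq_lintegral_ofReal (tg_density_integrable n)
      (Filter.Eventually.of_forall fun x => by positivity), tg_density_integral, ENNReal.ofReal_one]

lemma tg_integral_eq (n : ℕ) {F : Type*} [NormedAddCommGroup F] [NormedSpace ℝ F]
    (f : EuclideanSpace ℝ (Fin n) → F) (K : Set (EuclideanSpace ℝ (Fin n))) (hK : MeasurableSet K) :
    ∫ x in K, f x ∂(_root_.stdGaussian n) =
      ∫ x in K, ((2 * π) ^ (-(n : ℝ) / 2) * Real.exp (-‖x‖ ^ 2 / 2)) • f x := by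
  rw [_root_.stdGaussian, setIntegral_withDensity_eq_setIntegral_toReal_smul₀ _ _ _ hK]
  · refine setIntegral_congr_fun hK fun x _ => ?_
    rw [ENNReal.toReal_ofReal (by positivity)]
  · exact Measurable.aemeasurable (by fun_prop)
  · exact Filter.Eventually.of_forall fun x => ENNReal.ofReal_lt_top

lemma tg_eq (n : ℕ) :
    _root_.stdGaussian n = ProbabilityTheory.stdGaussian (EuclideanSpace ℝ (Fin n)) := by
  apply Measure.ext_of_charFun
  ext t
  rw [charFun_stdGaussian, charFun_apply, ← setIntegral_univ, tg_integral_eq _ _ _ MeasurableSet.univ,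
    setIntegral_univ]
  have h := GaussianFourier.integral_cexp_neg_mul_sq_norm_add (V := EuclideanSpace ℝ (Fin n))
    (b := 1 / 2) (by norm_num) Complex.I t
  have h2 : ∀ x : EuclideanSpace ℝ (Fin n),
     ((2 * π) ^ (-(n : ℝ) / 2) * Real.exp (-‖x‖ ^ 2 / 2)) • Complex.exp (inner ℝ x t * Complex.I)
     = ((2 * π) ^ (-(n : ℝ) / 2) : ℝ) * Complex.exp (-(1/2) * ‖x‖ ^ 2 + Complex.I * inner ℝ t x) := by
    intro x
    rw [Complex.exp_add, Complex.real_smul]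
    push_cast
    rw [real_inner_comm, mul_assoc]
    congr 2
    · congr 1; ring
    · congr 1; ring
  simp_rw [h2]
  rw [integral_const_mul, h, finrank_euclideanSpace_fin, ← mul_assoc]
  have h3 : (((2 * π) ^ (-(n : ℝ) / 2) : ℝ) : ℂ) * ((π : ℂ) / (1 / 2)) ^ ((n : ℂ) / 2) = 1 := by
    have : ((π : ℂ) / (1 / 2)) ^ ((n : ℂ) / 2) = (((2 * π) ^ ((n : ℝ) / 2) : ℝ) : ℂ) := by
      rw [Complex.ofReal_cpow (by positivity)]
      push_cast
      congr 1; ring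
    rw [this, ← Complex.ofReal_mul, ← Real.rpow_add (by positivity),
      show -(n : ℝ) / 2 + n / 2 = 0 by ring, Real.rpow_zero, Complex.ofReal_one]
  rw [h3, one_mul]
  congr 1
  rw [Complex.I_sq]; ring

lemma tg_ac (n : ℕ) : _root_.stdGaussian n ≪ volume := withDensity_absolutelyContinuous _ _

set_option linter.unusedSectionVars false

section poincare
variable {E : Type*} [NormedAddCommGroup E] [InnerProductSpace ℝ E] [FiniteDimensional ℝ E]
  [MeasurableSpace E] [BorelSpace E]

lemma tg_abs_dual_le (L : StrongDual ℝ E) :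
    ∫ y, |L y| ∂(ProbabilityTheory.stdGaussian E) ≤ ‖L‖ := by
  have hm : MemLp L 2 (ProbabilityTheory.stdGaussian E) :=
    IsGaussian.memLp_dual _ _ _ (by simp)
  have hv : ∫ y, (L y) ^ 2 ∂(ProbabilityTheory.stdGaussian E) = ‖L‖ ^ 2 := by
    rw [← variance_dual_stdGaussian L, variance_of_integral_eq_zero hm.1.aemeasurable
      (integral_strongDual_stdGaussian L)]
  rcases eq_or_ne L 0 with rfl | hL
  · simp
  have hs : 0 < ‖L‖ := norm_pos_iff.2 hL
  calc ∫ y, |L y| ∂(ProbabilityTheory.stdGaussian E)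
      ≤ ∫ y, ((2 * ‖L‖)⁻¹ * (L y) ^ 2 + ‖L‖ / 2) ∂(ProbabilityTheory.stdGaussian E) := by
        refine integral_mono (hm.integrable (by simp)).abs
          ((hm.integrable_sq.const_mul _).add (integrable_const _)) fun y => ?_
        have h1 : 0 ≤ (2 * ‖L‖)⁻¹ * (|L y| - ‖L‖) ^ 2 := by positivity
        have h2 : (2 * ‖L‖)⁻¹ * (|L y| - ‖L‖) ^ 2 = (2 * ‖L‖)⁻¹ * (L y) ^ 2 + ‖L‖ / 2 - |L y| := by
          rw [← sq_abs (L y)]; field_simp; ring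
        simp only
        linarith
    _ = ‖L‖ := by
        rw [integral_add (hm.integrable_sq.const_mul _) (integrable_const _), integral_const_mul, hv]
        simp
        field_simp; norm_num

lemma tg_rot_zero (p : E × E) : ContinuousLinearMap.rotation 0 p = p := by
  simp [ContinuousLinearMap.rotation_apply]

lemma tg_rot_add (a b : ℝ) (p : E × E) :
    ContinuousLinearMap.rotation (a + b) p
      = ContinuousLinearMap.rotation a (ContinuousLinearMap.rotation b p) := by
  simp only [ContinuousLinearMap.rotation_apply, Real.cos_add, Real.sin_add]
  ext <;> simp only [] <;> module

lemma tg_lip_step {f : E → ℝ} {C : NNReal} (hf : LipschitzWith C f) {h : ℝ} (hh : 0 ≤ h) (p : E × E) :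
    |f p.1 - f (ContinuousLinearMap.rotation h p).1| ≤ C * (h * (‖p.1‖ + ‖p.2‖)) := by
  have h1 := hf.dist_le_mul p.1 (ContinuousLinearMap.rotation h p).1
  rw [Real.dist_eq, dist_eq_norm] at h1
  refine h1.trans ?_
  gcongr
  have h2 : p.1 - (ContinuousLinearMap.rotation h p).1
      = (Real.cos 0 - Real.cos h) • p.1 - (Real.sin h - Real.sin 0) • p.2 := by
    simp only [ContinuousLinearMap.rotation_apply, Real.cos_zero, Real.sin_zero]; module
  rw [h2]
  refine (norm_sub_le _ _).trans ?_
  rw [norm_smul, norm_smul, mul_add]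
  have h3 : |Real.cos 0 - Real.cos h| ≤ h := by
    have := Real.abs_cos_sub_cos_le 0 h
    simpa [abs_of_nonneg hh] using this
  have h4 : |Real.sin h - Real.sin 0| ≤ h := by
    have := Real.abs_sin_sub_sin_le h 0
    simpa [abs_of_nonneg hh] using this
  simp only [Real.norm_eq_abs]
  gcongr

lemma tg_int_norm : Integrable (fun p : E × E => ‖p.1‖ + ‖p.2‖)
    ((ProbabilityTheory.stdGaussian E).prod (ProbabilityTheory.stdGaussian E)) := by
  have h : Integrable (fun x : E => ‖x‖) (ProbabilityTheory.stdGaussian E) :=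
    (IsGaussian.integrable_id (μ := ProbabilityTheory.stdGaussian E)).norm
  exact (h.comp_fst _).add (h.comp_snd _)

lemma tg_int_step {f : E → ℝ} {C : NNReal} (hf : LipschitzWith C f) {h : ℝ} (hh : 0 ≤ h) :
    Integrable (fun p : E × E => |f p.1 - f (ContinuousLinearMap.rotation h p).1|)
    ((ProbabilityTheory.stdGaussian E).prod (ProbabilityTheory.stdGaussian E)) := by
  refine Integrable.mono' ((tg_int_norm.const_mul h).const_mul (C : ℝ)) ?_
    (Filter.Eventually.of_forall fun p => ?_)
  · have := hf.continuous
    exact Continuous.aestronglyMeasurable (by fun_prop)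
  · rw [Real.norm_eq_abs, abs_abs]
    exact tg_lip_step hf hh p

lemma tg_steps {f : E → ℝ} {C : NNReal} (hf : LipschitzWith C f) {h : ℝ} (hh : 0 ≤ h) (N : ℕ) :
    ∫ p, |f p.1 - f (ContinuousLinearMap.rotation (N * h) p).1|
      ∂((ProbabilityTheory.stdGaussian E).prod (ProbabilityTheory.stdGaussian E))
    ≤ N * ∫ p, |f p.1 - f (ContinuousLinearMap.rotation h p).1|
      ∂((ProbabilityTheory.stdGaussian E).prod (ProbabilityTheory.stdGaussian E)) := by
  induction N with
  | zero => simp [tg_rot_zero]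
  | succ N ih =>
    have hmp : MeasurePreserving (ContinuousLinearMap.rotation (E := E) (N * h))
        ((ProbabilityTheory.stdGaussian E).prod (ProbabilityTheory.stdGaussian E))
        ((ProbabilityTheory.stdGaussian E).prod (ProbabilityTheory.stdGaussian E)) :=
      ⟨(ContinuousLinearMap.continuous _).measurable,
        IsGaussian.map_rotation_eq_self (by simp) _⟩
    have hi := tg_int_step hf hh
    have e : ∫ p, |f (ContinuousLinearMap.rotation (N * h) p).1 -
          f (ContinuousLinearMap.rotation h (ContinuousLinearMap.rotation (N * h) p)).1|
      ∂((ProbabilityTheory.stdGaussian E).prod (ProbabilityTheory.stdGaussian E))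
      = ∫ p, |f p.1 - f (ContinuousLinearMap.rotation h p).1|
      ∂((ProbabilityTheory.stdGaussian E).prod (ProbabilityTheory.stdGaussian E)) := by
      conv_rhs => rw [← hmp.map_eq]
      rw [integral_map hmp.measurable.aemeasurable]
      have := hf.continuous
      exact Continuous.aestronglyMeasurable (by fun_prop)
    have hi2 : Integrable (fun p : E × E => |f (ContinuousLinearMap.rotation (N * h) p).1 -
          f (ContinuousLinearMap.rotation h (ContinuousLinearMap.rotation (N * h) p)).1|)
        ((ProbabilityTheory.stdGaussian E).prod (ProbabilityTheory.stdGaussian E)) :=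
      hmp.integrable_comp_of_integrable hi
    push_cast
    rw [add_mul, add_mul, one_mul, one_mul, ← e]
    rw [← e] at ih
    refine le_trans ?_ (add_le_add_left ih _)
    rw [← integral_add (tg_int_step hf (by positivity)) hi2]
    refine integral_mono ?_ ((tg_int_step hf (by positivity)).add hi2) fun p => ?_
    · have := tg_int_step (h := N * h + h) hf (by positivity)
      exact this
    · beta_reduce
      rw [add_comm (N * h) h, tg_rot_add]
      exact abs_sub_le _ _ _

lemma tg_poincare {f : E → ℝ} {C : NNReal} (hf : LipschitzWith C f)
    (hac : ProbabilityTheory.stdGaussian E ≪ volume) :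
    ∫ p, |f p.1 - f p.2| ∂((ProbabilityTheory.stdGaussian E).prod (ProbabilityTheory.stdGaussian E))
    ≤ π / 2 * ∫ x, ‖fderiv ℝ f x‖ ∂(ProbabilityTheory.stdGaussian E) := by
  set γ := ProbabilityTheory.stdGaussian E with hγ
  have hfc := hf.continuous
  have hd : ∀ᵐ x ∂γ, DifferentiableAt ℝ f x := hac.ae_le hf.ae_differentiableAt
  have hd2 : ∀ᵐ p ∂(γ.prod γ), DifferentiableAt ℝ f p.1 :=
    Measure.quasiMeasurePreserving_fst.ae hd
  set hN : ℕ → ℝ := fun N => (π / 2) / ((N : ℝ) + 1) with hhN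
  have hNpos : ∀ N, 0 < hN N := fun N => by simp only [hhN]; positivity
  have hNmul : ∀ N, ((N + 1 : ℕ) : ℝ) * hN N = π / 2 := fun N => by
    simp only [hhN]; push_cast; field_simp
  have hNlim : Filter.Tendsto hN Filter.atTop (nhdsWithin 0 {0}ᶜ) := by
    refine tendsto_nhdsWithin_iff.2 ⟨?_, Filter.Eventually.of_forall fun N => (hNpos N).ne'⟩
    have := (tendsto_one_div_add_atTop_nhds_zero_nat (𝕜 := ℝ)).const_mul (π / 2)
    rw [mul_zero] at this
    refine this.congr fun N => ?_
    simp only [hhN]; ring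
  have hmeas : Measurable (fun p : E × E => |fderiv ℝ f p.1 p.2|) := by
    have h1 : Measurable (fun p : E × E => fderiv ℝ f p.1) := (measurable_fderiv ℝ f).comp measurable_fst
    have h2 : Measurable (fun q : (E →L[ℝ] ℝ) × E => q.1 q.2) :=
      (isBoundedBilinearMap_apply (𝕜 := ℝ) (E := E) (F := ℝ)).continuous.measurable
    exact (h2.comp (h1.prodMk measurable_snd)).abs
  have hdct : Filter.Tendsto (fun N : ℕ => ∫ p, ((N + 1 : ℕ) : ℝ) *
      |f p.1 - f (ContinuousLinearMap.rotation (hN N) p).1| ∂(γ.prod γ)) Filter.atTop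
      (nhds (∫ p, π / 2 * |fderiv ℝ f p.1 p.2| ∂(γ.prod γ))) := by
    refine tendsto_integral_of_dominated_convergence
      (fun p => (C : ℝ) * (π / 2 * (‖p.1‖ + ‖p.2‖))) (fun N => ?_)
      ((tg_int_norm.const_mul _).const_mul _) (fun N => ?_) ?_
    · exact Continuous.aestronglyMeasurable (by fun_prop)
    · refine Filter.Eventually.of_forall fun p => ?_
      rw [Real.norm_eq_abs, abs_mul, abs_abs, abs_of_nonneg (by positivity)]
      calc ((N + 1 : ℕ) : ℝ) * |f p.1 - f (ContinuousLinearMap.rotation (hN N) p).1|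
          ≤ ((N + 1 : ℕ) : ℝ) * (C * (hN N * (‖p.1‖ + ‖p.2‖))) := by
            gcongr; exact tg_lip_step hf (hNpos N).le p
        _ = C * ((((N + 1 : ℕ) : ℝ) * hN N) * (‖p.1‖ + ‖p.2‖)) := by ring
        _ = _ := by rw [hNmul]
    · filter_upwards [hd2] with p hp
      have hc : HasDerivAt (fun θ : ℝ => (ContinuousLinearMap.rotation θ p).1) p.2 0 := by
        have h1 := ((Real.hasDerivAt_cos 0).smul_const p.1).add
          ((Real.hasDerivAt_sin 0).smul_const p.2)
        simp only [Real.sin_zero, Real.cos_zero, neg_zero, zero_smul, one_smul, zero_add] at h1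
        exact h1
      have hp' : HasFDerivAt f (fderiv ℝ f p.1) (ContinuousLinearMap.rotation 0 p).1 := by
        rw [tg_rot_zero]; exact hp.hasFDerivAt
      have h2 : HasDerivAt (fun θ : ℝ => f (ContinuousLinearMap.rotation θ p).1)
          (fderiv ℝ f p.1 p.2) 0 := hp'.comp_hasDerivAt 0 hc
      have h3 := ((hasDerivAt_iff_tendsto_slope.1 h2).comp hNlim).abs.const_mul (π / 2)
      refine h3.congr fun N => ?_
      simp only [Function.comp, slope_def_field, tg_rot_zero, sub_zero]
      rw [abs_div, abs_of_pos (hNpos N), abs_sub_comm, ← hNmul N]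
      have := (hNpos N).ne'
      field_simp
  have hle : ∀ N : ℕ, ∫ p, |f p.1 - f p.2| ∂(γ.prod γ) ≤ ∫ p, ((N + 1 : ℕ) : ℝ) *
      |f p.1 - f (ContinuousLinearMap.rotation (hN N) p).1| ∂(γ.prod γ) := by
    intro N
    have := tg_steps hf (hNpos N).le (N + 1)
    rw [hNmul] at this
    rw [integral_const_mul]
    simpa [ContinuousLinearMap.rotation_apply] using this
  refine (ge_of_tendsto' hdct hle).trans ?_
  rw [integral_const_mul]
  gcongr
  have hb : ∀ x, ‖fderiv ℝ f x‖ ≤ C := fun x => norm_fderiv_le_of_lipschitz ℝ hf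
  have hint : Integrable (fun p : E × E => |fderiv ℝ f p.1 p.2|) (γ.prod γ) := by
    refine Integrable.mono' (tg_int_norm.const_mul (C : ℝ)) hmeas.aestronglyMeasurable
      (Filter.Eventually.of_forall fun p => ?_)
    rw [Real.norm_eq_abs, abs_abs, ← Real.norm_eq_abs]
    refine ((fderiv ℝ f p.1).le_opNorm p.2).trans ?_
    have := norm_nonneg p.1
    exact mul_le_mul (hb _) (by linarith) (norm_nonneg _) (by positivity)
  rw [integral_prod _ hint]
  refine integral_mono hint.integral_prod_left ?_ fun x => tg_abs_dual_le (fderiv ℝ f x)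
  refine Integrable.mono' (integrable_const (C : ℝ)) (measurable_fderiv ℝ f).norm.aestronglyMeasurable
    (Filter.Eventually.of_forall fun x => ?_)
  rw [norm_norm]; exact hb x

end poincare

section dilation
open scoped Pointwise
variable {n : ℕ}

/-- standard Gaussian density -/
noncomputable def tgRho (n : ℕ) (x : EuclideanSpace ℝ (Fin n)) : ℝ :=
  (2 * π) ^ (-(n : ℝ) / 2) * Real.exp (-‖x‖ ^ 2 / 2)

lemma tg_real_eq (K : Set (EuclideanSpace ℝ (Fin n))) (hK : MeasurableSet K) :
    (_root_.stdGaussian n).real K = ∫ x in K, tgRho n x := by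
  have := tg_integral_eq n (fun _ => (1 : ℝ)) K hK
  simpa [tgRho] using this

lemma tg_smul_eq (K : Set (EuclideanSpace ℝ (Fin n))) (hK : MeasurableSet K) {t : ℝ} (ht : 0 < t) :
    (_root_.stdGaussian n).real (t • K) =
      ∫ x in K, t ^ n * ((2 * π) ^ (-(n : ℝ) / 2) * Real.exp (-(t ^ 2 * ‖x‖ ^ 2) / 2)) := by
  rw [tg_real_eq _ (hK.const_smul₀ t), integral_const_mul]
  have h := Measure.setIntegral_comp_smul_of_pos volume (tgRho n) K ht
  rw [finrank_euclideanSpace_fin, smul_eq_mul, eq_inv_mul_iff_mul_eq₀ (by positivity)] at h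
  rw [← h]
  congr 1
  refine setIntegral_congr_fun hK fun x _ => ?_
  simp only [tgRho]
  rw [norm_smul, mul_pow, Real.norm_eq_abs, sq_abs]

lemma tg_hasDeriv (K : Set (EuclideanSpace ℝ (Fin n))) (hK : MeasurableSet K) :
    Integrable (fun x => (n - ‖x‖ ^ 2) * tgRho n x) (volume.restrict K) ∧ HasDerivAt
      (fun t : ℝ => ∫ x in K, t ^ n * ((2 * π) ^ (-(n : ℝ) / 2) * Real.exp (-(t ^ 2 * ‖x‖ ^ 2) / 2)))
      (∫ x in K, (n - ‖x‖ ^ 2) * tgRho n x) 1 := by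
  set c : ℝ := (2 * π) ^ (-(n : ℝ) / 2) with hc
  have hcpos : 0 < c := by positivity
  have key := hasDerivAt_integral_of_dominated_loc_of_deriv_le (𝕜 := ℝ) (x₀ := (1 : ℝ))
    (s := Set.Ioo (1 / 2) 2) (μ := volume.restrict K)
    (F := fun t x => t ^ n * (c * Real.exp (-(t ^ 2 * ‖x‖ ^ 2) / 2)))
    (F' := fun t x => (n * t ^ (n - 1)) * (c * Real.exp (-(t ^ 2 * ‖x‖ ^ 2) / 2)) +
      t ^ n * (c * (Real.exp (-(t ^ 2 * ‖x‖ ^ 2) / 2) * (-(2 * t * ‖x‖ ^ 2) / 2))))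
    (bound := fun x => (n * 2 ^ (n - 1) + 2 ^ n * (2 * 16)) * c * Real.exp (-(1 / 16) * ‖x‖ ^ 2))
    (Ioo_mem_nhds (by norm_num) (by norm_num))
    (Filter.Eventually.of_forall fun t => Continuous.aestronglyMeasurable (by fun_prop))
    ?_ (Continuous.aestronglyMeasurable (by fun_prop)) ?_ ?_ ?_
  · have e : (fun x : EuclideanSpace ℝ (Fin n) => (n * (1 : ℝ) ^ (n - 1)) * (c * Real.exp (-((1 : ℝ) ^ 2 * ‖x‖ ^ 2) / 2)) +
      (1 : ℝ) ^ n * (c * (Real.exp (-((1 : ℝ) ^ 2 * ‖x‖ ^ 2) / 2) * (-(2 * 1 * ‖x‖ ^ 2) / 2)))) =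
        fun x => (n - ‖x‖ ^ 2) * tgRho n x := by
      ext x; simp only [tgRho, one_pow, one_mul, ← hc]; ring
    beta_reduce at key
    rw [e] at key
    exact key
  · have := (tg_density_integrable n).restrict (s := K)
    simpa [← hc] using this
  · refine Filter.Eventually.of_forall fun x t ht => ?_
    have ht0 : 0 < t := by linarith [ht.1]
    have ht2 : t ≤ 2 := ht.2.le
    have hexp : Real.exp (-(t ^ 2 * ‖x‖ ^ 2) / 2) ≤ Real.exp (-(1 / 8) * ‖x‖ ^ 2) := by
      apply Real.exp_le_exp.2
      have : (1 / 4) ≤ t ^ 2 := by nlinarith [ht.1]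
      nlinarith [sq_nonneg ‖x‖]
    have h8 : Real.exp (-(1 / 8) * ‖x‖ ^ 2) * ‖x‖ ^ 2 ≤ 16 * Real.exp (-(1 / 16) * ‖x‖ ^ 2) := by
      have h1 : ‖x‖ ^ 2 / 16 ≤ Real.exp (‖x‖ ^ 2 / 16) := by
        linarith [Real.add_one_le_exp (‖x‖ ^ 2 / 16)]
      have h2 : Real.exp (-(1 / 16) * ‖x‖ ^ 2) =
          Real.exp (-(1 / 8) * ‖x‖ ^ 2) * Real.exp (‖x‖ ^ 2 / 16) := by
        rw [← Real.exp_add]; congr 1; ring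
      rw [h2]
      nlinarith [Real.exp_pos (-(1 / 8) * ‖x‖ ^ 2)]
    have h8' : Real.exp (-(1 / 8) * ‖x‖ ^ 2) ≤ Real.exp (-(1 / 16) * ‖x‖ ^ 2) := by
      apply Real.exp_le_exp.2
      nlinarith [sq_nonneg ‖x‖]
    refine (norm_add_le _ _).trans ?_
    have a1 : ‖(n * t ^ (n - 1)) * (c * Real.exp (-(t ^ 2 * ‖x‖ ^ 2) / 2))‖ ≤
        (n * 2 ^ (n - 1)) * (c * Real.exp (-(1 / 16) * ‖x‖ ^ 2)) := by
      rw [Real.norm_of_nonneg (by positivity)]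
      have h9 := hexp.trans h8'
      refine mul_le_mul (by gcongr) (mul_le_mul_of_nonneg_left h9 hcpos.le) (by positivity)
        (by positivity)
    have a2 : ‖t ^ n * (c * (Real.exp (-(t ^ 2 * ‖x‖ ^ 2) / 2) * (-(2 * t * ‖x‖ ^ 2) / 2)))‖ ≤
        2 ^ n * (c * (2 * (16 * Real.exp (-(1 / 16) * ‖x‖ ^ 2)))) := by
      have : t ^ n * (c * (Real.exp (-(t ^ 2 * ‖x‖ ^ 2) / 2) * (-(2 * t * ‖x‖ ^ 2) / 2))) =
        -(t ^ n * (c * (t * (Real.exp (-(t ^ 2 * ‖x‖ ^ 2) / 2) * ‖x‖ ^ 2)))) := by ring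
      rw [this, norm_neg, Real.norm_of_nonneg (by positivity)]
      have h9 := (mul_le_mul_of_nonneg_right hexp (sq_nonneg ‖x‖)).trans h8
      refine mul_le_mul (by gcongr) (mul_le_mul_of_nonneg_left ?_ hcpos.le) (by positivity)
        (by positivity)
      exact mul_le_mul ht2 h9 (by positivity) (by positivity)
    linarith
  · have h := GaussianFourier.integrable_cexp_neg_mul_sq_norm_add (V := EuclideanSpace ℝ (Fin n))
      (b := 1 / 16) (by norm_num) 0 0
    have h2 := h.re
    refine Integrable.const_mul ((h2.congr (Filter.Eventually.of_forall fun x => ?_)).restrict) _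
    simp only [zero_mul, add_zero]
    have : (-(1 / 16 : ℂ) * (‖x‖ : ℂ) ^ 2) = ((-(1 / 16) * ‖x‖ ^ 2 : ℝ) : ℂ) := by push_cast; ring
    rw [this, ← Complex.ofReal_exp]
    exact Complex.ofReal_re _
  · refine Filter.Eventually.of_forall fun x t _ => ?_
    have h1 : HasDerivAt (fun t : ℝ => -(t ^ 2 * ‖x‖ ^ 2) / 2) (-(2 * t * ‖x‖ ^ 2) / 2) t := by
      have := (((hasDerivAt_pow 2 t).mul_const (‖x‖ ^ 2)).neg).div_const 2
      simpa using this
    exact (hasDerivAt_pow n t).mul (h1.exp.const_mul c)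

end dilation

section final
open scoped Pointwise
variable {n : ℕ}

lemma tg_main_ineq (K : Set (EuclideanSpace ℝ (Fin n))) {r : ℝ} (hr : 0 < r) (hc : Convex ℝ K)
    (hK : MeasurableSet K) (hb : Metric.closedBall 0 r ⊆ K) {ε : ℝ} (hε : 0 < ε) (hε1 : ε < 1) :
    (_root_.stdGaussian n).real K * (1 - (_root_.stdGaussian n).real ((1 + 2 * ε) • K)) * (ε * r) ≤
      π / 2 * ((_root_.stdGaussian n).real ((1 + 2 * ε) • K)
        - (_root_.stdGaussian n).real ((1 - ε) • K)) := by
  set γ := _root_.stdGaussian n with hγ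
  have h0 : (0 : EuclideanSpace ℝ (Fin n)) ∈ K := hb (by simp [hr.le])
  have hnh : K ∈ nhds (0 : EuclideanSpace ℝ (Fin n)) :=
    Filter.mem_of_superset (Metric.closedBall_mem_nhds _ hr) hb
  have habs : Absorbent ℝ K := absorbent_nhds_zero hnh
  have hgc := continuous_gauge hc hnh
  have hmono : ∀ a b : ℝ, 0 < a → a ≤ b → a • K ⊆ b • K := by
    rintro a b ha hab _ ⟨k, hk, rfl⟩
    have hb0 : 0 < b := ha.trans_le hab
    refine ⟨(a / b) • k, hc.smul_mem_of_zero_mem h0 hk ⟨by positivity, ?_⟩, ?_⟩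
    · exact (div_le_one hb0).2 hab
    · simp only [smul_smul]
      rw [mul_div_cancel₀ _ hb0.ne']
  have hmem : ∀ x : EuclideanSpace ℝ (Fin n), ∀ a b : ℝ, gauge K x ≤ a → a < b → x ∈ b • K := by
    intro x a b hx hab
    obtain ⟨t, ht0, htb, hxt⟩ := exists_lt_of_gauge_lt habs (hx.trans_lt hab)
    exact hmono t b ht0 htb.le hxt
  have hglip : ∀ x y, |gauge K x - gauge K y| ≤ r⁻¹ * dist x y := by
    intro x y
    have := (hc.lipschitzWith_gauge (r := ⟨r, hr.le⟩) hr
      (Metric.ball_subset_closedBall.trans hb)).dist_le_mul x y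
    rw [Real.dist_eq] at this
    exact this
  set f : EuclideanSpace ℝ (Fin n) → ℝ := fun x => max 0 (min 1 ((1 + ε - gauge K x) / ε)) with hf
  have hC0 : 0 ≤ (ε * r)⁻¹ := by positivity
  have hflip : LipschitzWith ⟨(ε * r)⁻¹, hC0⟩ f := by
    refine LipschitzWith.of_dist_le_mul fun x y => ?_
    rw [Real.dist_eq]
    simp only [hf]
    rw [max_comm 0, max_comm 0, min_comm 1, min_comm 1]
    refine (abs_max_sub_max_le_abs _ _ _).trans ((abs_min_sub_min_le_max _ _ _ _).trans ?_)
    rw [sub_self, abs_zero, max_eq_left (abs_nonneg _)]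
    have e : (1 + ε - gauge K x) / ε - (1 + ε - gauge K y) / ε = - ((gauge K x - gauge K y) / ε) := by
      ring
    rw [e, abs_neg, abs_div, abs_of_pos hε]
    change _ ≤ (ε * r)⁻¹ * dist x y
    calc |gauge K x - gauge K y| / ε ≤ (r⁻¹ * dist x y) / ε := by gcongr; exact hglip x y
      _ = (ε * r)⁻¹ * dist x y := by field_simp
  have hf1 : ∀ x, gauge K x ≤ 1 → f x = 1 := by
    intro x hx
    simp only [hf]
    have : 1 ≤ (1 + ε - gauge K x) / ε := by rw [le_div_iff₀ hε]; linarith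
    rw [min_eq_left this, max_eq_right zero_le_one]
  have hf0 : ∀ x, 1 + ε ≤ gauge K x → f x = 0 := by
    intro x hx
    simp only [hf]
    have : (1 + ε - gauge K x) / ε ≤ 0 := div_nonpos_of_nonpos_of_nonneg (by linarith) hε.le
    exact max_eq_left ((min_le_right _ _).trans this)
  set S : Set (EuclideanSpace ℝ (Fin n)) := {x | 1 ≤ gauge K x ∧ gauge K x ≤ 1 + ε} with hS
  have hSm : MeasurableSet S :=
    (measurableSet_le measurable_const hgc.measurable).inter
      (measurableSet_le hgc.measurable measurable_const)
  have hfd : ∀ x, ‖fderiv ℝ f x‖ ≤ S.indicator (fun _ => (ε * r)⁻¹) x := by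
    intro x
    by_cases hx : x ∈ S
    · rw [Set.indicator_of_mem hx]
      exact norm_fderiv_le_of_lipschitz ℝ hflip
    · rw [Set.indicator_of_notMem hx]
      have : ∃ c : ℝ, f =ᶠ[nhds x] fun _ => c := by
        rcases lt_or_ge (gauge K x) 1 with h | h
        · refine ⟨1, ?_⟩
          filter_upwards [hgc.continuousAt.eventually_lt_const h] with y hy
          exact hf1 y hy.le
        · have h' : 1 + ε < gauge K x := by
            by_contra h2
            exact hx ⟨h, not_lt.1 h2⟩
          refine ⟨0, ?_⟩
          filter_upwards [hgc.continuousAt.eventually_const_lt h'] with y hy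
          exact hf0 y hy.le
      obtain ⟨c, hc'⟩ := this
      rw [hc'.fderiv_eq]
      simp
  have hP := tg_poincare hflip (tg_eq n ▸ tg_ac n)
  rw [← tg_eq n, ← hγ] at hP
  have hup : ∫ x, ‖fderiv ℝ f x‖ ∂γ ≤ (ε * r)⁻¹ * (γ.real ((1 + 2 * ε) • K) - γ.real ((1 - ε) • K)) := by
    calc ∫ x, ‖fderiv ℝ f x‖ ∂γ ≤ ∫ x, S.indicator (fun _ => (ε * r)⁻¹) x ∂γ := by
          refine integral_mono_of_nonneg (Filter.Eventually.of_forall fun x => norm_nonneg _)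
            ((integrable_const _).indicator hSm) (Filter.Eventually.of_forall hfd)
      _ = (ε * r)⁻¹ * γ.real S := by
          rw [integral_indicator hSm, setIntegral_const, smul_eq_mul, mul_comm]
      _ ≤ _ := by
          gcongr
          rw [← measureReal_sdiff (hmono _ _ (by linarith) (by linarith)) (hK.const_smul₀ _)]
          refine measureReal_mono fun x hx => ⟨hmem x (1 + ε) _ hx.2 (by linarith), fun h => ?_⟩
          have := gauge_le_of_mem (by linarith) h
          linarith [hx.1]
  have hlow : γ.real K * (1 - γ.real ((1 + 2 * ε) • K)) ≤ ∫ p, |f p.1 - f p.2| ∂(γ.prod γ) := by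
    have hKe : MeasurableSet ((1 + 2 * ε) • K) := hK.const_smul₀ _
    rw [← probReal_compl_eq_one_sub hKe, ← measureReal_prod_prod]
    have hT := hK.prod hKe.compl
    rw [← integral_indicator_one hT]
    refine integral_mono_of_nonneg (Filter.Eventually.of_forall fun p => ?_) ?_
      (Filter.Eventually.of_forall fun p => ?_)
    · exact Set.indicator_nonneg (fun _ _ => zero_le_one) _
    · have hfc := hflip.continuous
      refine Integrable.mono' (integrable_const (1 : ℝ))
        (Continuous.aestronglyMeasurable (by fun_prop)) (Filter.Eventually.of_forall fun p => ?_)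
      have hr1 : ∀ x, 0 ≤ f x ∧ f x ≤ 1 := fun x =>
        ⟨le_max_left _ _, max_le zero_le_one (min_le_left _ _)⟩
      rw [Real.norm_eq_abs, abs_abs, abs_le]
      constructor <;> linarith [(hr1 p.1).1, (hr1 p.1).2, (hr1 p.2).1, (hr1 p.2).2]
    · by_cases hp : p ∈ K ×ˢ ((1 + 2 * ε) • K)ᶜ
      · rw [Set.indicator_of_mem hp]
        have h1 := hf1 p.1 (gauge_le_one_of_mem hp.1)
        have h2 := hf0 p.2 (by
          by_contra h
          exact hp.2 (hmem p.2 (1 + ε) _ (not_le.1 h).le (by linarith)))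
        simp [h1, h2]
      · rw [Set.indicator_of_notMem hp]
        exact abs_nonneg _
  have hfin := (hlow.trans hP).trans (mul_le_mul_of_nonneg_left hup (by positivity))
  have hpos : 0 < ε * r := by positivity
  calc _ ≤ (π / 2 * ((ε * r)⁻¹ * (γ.real ((1 + 2 * ε) • K) - γ.real ((1 - ε) • K)))) * (ε * r) := by
        gcongr
    _ = _ := by field_simp

lemma tg_limit (K : Set (EuclideanSpace ℝ (Fin n))) {r : ℝ} (hr : 0 < r) (hc : Convex ℝ K)
    (hK : MeasurableSet K) (hb : Metric.closedBall 0 r ⊆ K) :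
    (_root_.stdGaussian n).real K * (1 - (_root_.stdGaussian n).real K) * r ≤
      π / 2 * (3 * ∫ x in K, (n - ‖x‖ ^ 2) * tgRho n x) := by
  set γ := _root_.stdGaussian n with hγ
  obtain ⟨-, hder⟩ := tg_hasDeriv K hK
  set G : ℝ → ℝ := fun t : ℝ =>
    ∫ x in K, t ^ n * ((2 * π) ^ (-(n : ℝ) / 2) * Real.exp (-(t ^ 2 * ‖x‖ ^ 2) / 2)) with hG
  set D := ∫ x in K, (n - ‖x‖ ^ 2) * tgRho n x with hD
  have hGt : ∀ t : ℝ, 0 < t → γ.real (t • K) = G t := fun t ht => tg_smul_eq K hK ht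
  have hG1 : G 1 = γ.real K := by rw [← hGt 1 one_pos, one_smul]
  have e1 : HasDerivAt (fun ε : ℝ => 1 + 2 * ε) 2 0 := by
    simpa using ((hasDerivAt_id (0 : ℝ)).const_mul 2).const_add 1
  have e2 : HasDerivAt (fun ε : ℝ => 1 - ε) (-1) 0 := by
    simpa using (hasDerivAt_id (0 : ℝ)).const_sub 1
  have d1 : HasDerivAt (fun ε : ℝ => G (1 + 2 * ε)) (D * 2) 0 := by
    refine HasDerivAt.comp (h₂ := G) 0 ?_ e1
    simpa using hder
  have d2 : HasDerivAt (fun ε : ℝ => G (1 - ε)) (D * (-1)) 0 := by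
    refine HasDerivAt.comp (h₂ := G) 0 ?_ e2
    simpa using hder
  have d3 := (hasDerivAt_iff_tendsto_slope.1 (d1.sub d2)).mono_left
    (nhdsWithin_mono 0 (fun x (hx : x ∈ Set.Ioi (0 : ℝ)) => (ne_of_gt hx : x ≠ 0)))
  have hcont : Filter.Tendsto (fun ε : ℝ => G (1 + 2 * ε)) (nhdsWithin 0 (Set.Ioi 0))
      (nhds (γ.real K)) := by
    have := d1.continuousAt.tendsto
    simp only [mul_zero, add_zero, hG1] at this
    exact this.mono_left nhdsWithin_le_nhds
  have hl := ((hcont.const_sub 1).const_mul (γ.real K)).mul_const r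
  have hrr := d3.const_mul (π / 2)
  have : D * 2 - D * (-1) = 3 * D := by ring
  rw [this] at hrr
  refine le_of_tendsto_of_tendsto hl hrr ?_
  filter_upwards [Ioo_mem_nhdsGT (zero_lt_one : (0 : ℝ) < 1)] with ε hε
  have h := tg_main_ineq K hr hc hK hb hε.1 hε.2
  have hε0 := hε.1
  have hε1 := hε.2
  rw [← hγ, hGt _ (by linarith), hGt _ (by linarith)] at h
  rw [slope_def_field]
  simp only [Pi.sub_apply, mul_zero, add_zero, sub_zero, sub_self]
  rw [mul_div_assoc', le_div_iff₀ hε.1]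
  linarith

end final

/-- for a convex set `K ⊆ ℝⁿ` containing the origin-centered ball of radius
`r > 0`, the expected squared norm under `N(0,I_n)|K` is at most `n - c·r·(1 - vol K)`. -/
theorem truncated_gaussian_expected_sq_norm_le_of_inradius :
    ∃ c : ℝ, 0 < c ∧
      ∀ (n : ℕ) (K : Set (EuclideanSpace ℝ (Fin n))) (r : ℝ),
        0 < r → Convex ℝ K → MeasurableSet K → Metric.closedBall 0 r ⊆ K →
        ∫ x, ‖x‖ ^ 2 ∂(truncGaussian n K)
          ≤ n - c * r * (1 - (stdGaussian n K).toReal) := by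
  refine ⟨2 / (3 * π), by positivity, ?_⟩
  intro n K r hr hc hK hb
  have hlim := tg_limit K hr hc hK hb
  have hint := (tg_hasDeriv K hK).1
  change _ ≤ n - 2 / (3 * π) * r * (1 - (_root_.stdGaussian n).real K)
  set v := (_root_.stdGaussian n).real K with hv
  have hvpos : 0 < v := by
    rw [hv, tg_real_eq K hK]
    have hi : Integrable (tgRho n) := tg_density_integrable n
    rw [setIntegral_pos_iff_support_of_nonneg_ae
      (Filter.Eventually.of_forall fun x => by unfold tgRho; positivity) hi.integrableOn]
    have : Function.support (tgRho n) = Set.univ := by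
      ext x
      simp only [Function.mem_support, Set.mem_univ, iff_true]
      unfold tgRho; positivity
    rw [this, Set.univ_inter]
    exact (Metric.measure_closedBall_pos volume 0 hr).trans_le (measure_mono hb)
  have hrhoint : Integrable (fun x => (n : ℝ) * tgRho n x) (volume.restrict K) :=
    ((tg_density_integrable n).restrict).const_mul _
  have hI : ∫ x, ‖x‖ ^ 2 ∂(truncGaussian n K) = v⁻¹ * ∫ x in K, tgRho n x * ‖x‖ ^ 2 := by
    unfold truncGaussian
    rw [integral_smul_measure, tg_integral_eq n _ K hK, ENNReal.toReal_inv]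
    rfl
  have hsplit : ∫ x in K, (n - ‖x‖ ^ 2) * tgRho n x = n * v - ∫ x in K, tgRho n x * ‖x‖ ^ 2 := by
    rw [hv, tg_real_eq K hK, ← integral_const_mul, ← integral_sub hrhoint]
    · congr 1; ext x; ring
    · refine (hrhoint.sub hint).congr (Filter.Eventually.of_forall fun x => ?_)
      simp only [Pi.sub_apply]; ring
  rw [hI]
  rw [hsplit] at hlim
  set I := ∫ x in K, tgRho n x * ‖x‖ ^ 2
  have h1 : 2 / (3 * π) * (v * (1 - v) * r) ≤ n * v - I := by
    have := mul_le_mul_of_nonneg_left hlim (by positivity : 0 ≤ 2 / (3 * π))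
    refine this.trans (le_of_eq ?_)
    field_simp
  rw [inv_mul_le_iff₀ hvpos]
  linarith
end

section
/- Let n ≥ 2 and let K ⊆ ℝⁿ be a convex set with vol(K) > 0 such that K ⊆ {x ∈ ℝⁿ : x₁ ≤ 0.1}. Let μ = E_{x ∼ N(0,I_n)|K}[x] be the center of mass of N(0,I_n)|K, and suppose μ_i = 0 for all i ∈ {3, …, n} and ‖μ‖² < 0.06. Then E_{x ∼ N(0,I_n)|K}[‖x‖²] ≤ n − 0.05. -/
open MeasureTheory ProbabilityTheory Real

section GaussAux

variable {V : Type*} [NormedAddCommGroup V] [InnerProductSpace ℝ V] [FiniteDimensional ℝ V]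
  [MeasurableSpace V] [BorelSpace V]

lemma gauss_int0 {b : ℝ} (hb : 0 < b) : Integrable (fun v : V => Real.exp (-(b * ‖v‖ ^ 2))) := by
  have h := (GaussianFourier.integrable_cexp_neg_mul_sq_norm_add (V := V) (b := (b : ℂ))
    (by simpa using hb) 0 0).re
  refine h.congr (ae_of_all _ fun v => ?_)
  have : (-(b : ℂ) * (‖v‖ : ℂ) ^ 2 + 0 * ((inner ℝ (0 : V) v : ℝ) : ℂ))
      = ((-(b * ‖v‖ ^ 2) : ℝ) : ℂ) := by push_cast; ring
  simp only [this]
  exact Complex.exp_ofReal_re _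

lemma gauss_bound {b : ℝ} (hb : 0 < b) (r : ℝ) :
    r ^ 2 * Real.exp (-(b * r ^ 2)) ≤ (2 / b) * Real.exp (-(b / 2 * r ^ 2)) := by
  have h1 : b / 2 * r ^ 2 ≤ Real.exp (b / 2 * r ^ 2) := by
    have := Real.add_one_le_exp (b / 2 * r ^ 2); linarith
  have h2 : Real.exp (-(b * r ^ 2)) = Real.exp (-(b / 2 * r ^ 2)) * Real.exp (-(b / 2 * r ^ 2)) := by
    rw [← Real.exp_add]; congr 1; ring
  have h3 : Real.exp (b / 2 * r ^ 2) * Real.exp (-(b / 2 * r ^ 2)) = 1 := by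
    rw [← Real.exp_add]; simp
  have h4 := Real.exp_pos (-(b / 2 * r ^ 2))
  set e := Real.exp (-(b / 2 * r ^ 2))
  rw [h2]
  have h5 : b / 2 * r ^ 2 * e ≤ 1 := by rw [← h3]; gcongr
  have : r ^ 2 * e ≤ 2 / b := by
    rw [le_div_iff₀ hb]; linarith
  calc r ^ 2 * (e * e) = (r ^ 2 * e) * e := by ring
    _ ≤ _ := by gcongr

lemma gauss_int2 {b : ℝ} (hb : 0 < b) :
    Integrable (fun v : V => ‖v‖ ^ 2 * Real.exp (-(b * ‖v‖ ^ 2))) := by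
  refine ((gauss_int0 (V := V) (half_pos hb)).const_mul (2 / b)).mono' ?_ ?_
  · exact (by fun_prop : Continuous fun v : V => ‖v‖ ^ 2 * Real.exp (-(b * ‖v‖ ^ 2))).aestronglyMeasurable
  · refine ae_of_all _ fun v => ?_
    rw [Real.norm_of_nonneg (by positivity)]
    exact gauss_bound hb _

/-- Scaling inequality: for a bounded `g` nonincreasing along rays. -/
lemma star_ineq (g : V → ℝ) (hg : Measurable g) (h0 : ∀ v, 0 ≤ g v) (C : ℝ) (h1 : ∀ v, g v ≤ C)
    (hmono : ∀ v, ∀ t : ℝ, 0 < t → t ≤ 1 → g v ≤ g (t • v)) :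
    0 ≤ ∫ v, g v * (((Module.finrank ℝ V : ℝ) - 2 * ‖v‖ ^ 2) * Real.exp (-‖v‖ ^ 2)) := by
  set d := Module.finrank ℝ V
  have hgb : ∀ v, ‖g v‖ ≤ C := fun v => by rw [Real.norm_of_nonneg (h0 v)]; exact h1 v
  have i0 : Integrable (fun v : V => Real.exp (-‖v‖ ^ 2)) := by
    simpa using gauss_int0 (V := V) one_pos
  have i2 : Integrable (fun v : V => ‖v‖ ^ 2 * Real.exp (-‖v‖ ^ 2)) := by
    simpa using gauss_int2 (V := V) one_pos
  have j0 : Integrable (fun v : V => g v * Real.exp (-‖v‖ ^ 2)) :=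
    i0.bdd_mul hg.aestronglyMeasurable (ae_of_all _ hgb)
  have j2 : Integrable (fun v : V => g v * (‖v‖ ^ 2 * Real.exp (-‖v‖ ^ 2))) :=
    i2.bdd_mul hg.aestronglyMeasurable (ae_of_all _ hgb)
  have hder := hasDerivAt_integral_of_dominated_loc_of_deriv_le (μ := (volume : Measure V))
    (F := fun (t : ℝ) (v : V) => g v * Real.exp (-(t ^ 2 * ‖v‖ ^ 2)))
    (F' := fun (t : ℝ) (v : V) => g v * (Real.exp (-(t ^ 2 * ‖v‖ ^ 2)) * (-(2 * t * ‖v‖ ^ 2))))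
    (x₀ := (1 : ℝ)) (s := Set.Ioo (1 / 2) 2)
    (bound := fun v => C * (4 * (‖v‖ ^ 2 * Real.exp (-(1 / 4 * ‖v‖ ^ 2)))))
    (Ioo_mem_nhds (by norm_num) (by norm_num))
    (Filter.Eventually.of_forall fun t => (by fun_prop : Measurable _).aestronglyMeasurable)
    (by simpa using j0)
    ((by fun_prop : Measurable _).aestronglyMeasurable)
    (by
      refine ae_of_all _ fun v t ht => ?_
      rw [norm_mul]
      have hC : 0 ≤ C := (h0 v).trans (h1 v)
      refine mul_le_mul (hgb v) ?_ (norm_nonneg _) hC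
      have ht0 : 0 < t := by linarith [ht.1]
      rw [mul_neg, norm_neg, Real.norm_of_nonneg (by positivity)]
      have : Real.exp (-(t ^ 2 * ‖v‖ ^ 2)) ≤ Real.exp (-(1 / 4 * ‖v‖ ^ 2)) := by
        apply Real.exp_le_exp.2
        have : 1 / 4 ≤ t ^ 2 := by nlinarith [ht.1]
        have := mul_le_mul_of_nonneg_right this (sq_nonneg ‖v‖)
        linarith
      calc _ ≤ Real.exp (-(1 / 4 * ‖v‖ ^ 2)) * (2 * 2 * ‖v‖ ^ 2) := by
            gcongr; exact ht.2.le
        _ = _ := by ring)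
    (((gauss_int2 (by norm_num)).const_mul 4).const_mul C)
    (by
      refine ae_of_all _ fun v t ht => ?_
      have : HasDerivAt (fun t : ℝ => -(t ^ 2 * ‖v‖ ^ 2)) (-(2 * t * ‖v‖ ^ 2)) t := by
        have := ((hasDerivAt_pow 2 t).mul_const (‖v‖ ^ 2)).fun_neg
        simpa using this
      exact (this.exp).const_mul (g v))
  have hd := hder.2
  set I : ℝ → ℝ := fun t => ∫ v, g v * Real.exp (-(t ^ 2 * ‖v‖ ^ 2)) with hI
  have hF : HasDerivAt (fun t : ℝ => t ^ d * I t) _ 1 := (hasDerivAt_pow d (1 : ℝ)).mul hd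
  have hge : ∀ t : ℝ, 1 ≤ t → (1 : ℝ) ^ d * I 1 ≤ t ^ d * I t := by
    intro t ht
    have ht0 : 0 < t := by linarith
    have e1 := Measure.integral_comp_inv_smul (volume : Measure V)
      (fun v => g v * Real.exp (-(t ^ 2 * ‖v‖ ^ 2))) t
    rw [abs_of_nonneg (by positivity), smul_eq_mul] at e1
    change _ = t ^ d * I t at e1
    rw [← e1, one_pow, one_mul]
    have e2 : (fun v : V => g (t⁻¹ • v) * Real.exp (-(t ^ 2 * ‖t⁻¹ • v‖ ^ 2)))
        = fun v : V => g (t⁻¹ • v) * Real.exp (-‖v‖ ^ 2) := by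
      funext v
      rw [norm_smul, Real.norm_of_nonneg (by positivity)]
      congr 3
      field_simp
    rw [e2]
    have e3 : I 1 = ∫ v : V, g v * Real.exp (-‖v‖ ^ 2) := by simp [hI]
    rw [e3]
    refine integral_mono j0 ?_ fun v => ?_
    · exact i0.bdd_mul (hg.comp (measurable_const_smul _)).aestronglyMeasurable
        (ae_of_all _ fun v => hgb _)
    · exact mul_le_mul_of_nonneg_right
        (hmono v _ (by positivity) (inv_le_one_of_one_le₀ ht)) (Real.exp_pos _).le
  have hnn : 0 ≤ ((d : ℝ) * 1 ^ (d - 1)) * I 1 + 1 ^ d * ∫ v, g v * (Real.exp (-((1 : ℝ) ^ 2 * ‖v‖ ^ 2)) * (-(2 * 1 * ‖v‖ ^ 2))) := by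
    have hs := (hasDerivAt_iff_tendsto_slope.1 hF)
    have hs' := hs.mono_left (nhdsWithin_mono 1 (s := Set.Ioi 1) fun x hx => ne_of_gt hx)
    refine ge_of_tendsto hs' ?_
    filter_upwards [self_mem_nhdsWithin] with t ht
    rw [slope_def_field]
    have ht' : (1 : ℝ) < t := ht
    exact div_nonneg (sub_nonneg.2 (hge t ht'.le)) (by linarith)
  have e3 : I 1 = ∫ v : V, g v * Real.exp (-‖v‖ ^ 2) := by simp [hI]
  have e4 : ∫ v, g v * (((d : ℝ) - 2 * ‖v‖ ^ 2) * Real.exp (-‖v‖ ^ 2))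
      = d * (∫ v : V, g v * Real.exp (-‖v‖ ^ 2)) - 2 * ∫ v, g v * (‖v‖ ^ 2 * Real.exp (-‖v‖ ^ 2)) := by
    rw [← integral_const_mul, ← integral_const_mul, ← integral_sub (j0.const_mul _) (j2.const_mul _)]
    congr 1; funext v; ring
  have e5 : ∫ v, g v * (Real.exp (-((1 : ℝ) ^ 2 * ‖v‖ ^ 2)) * (-(2 * 1 * ‖v‖ ^ 2)))
      = - (2 * ∫ v, g v * (‖v‖ ^ 2 * Real.exp (-‖v‖ ^ 2))) := by
    rw [← integral_const_mul, ← integral_neg]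
    congr 1; funext v; ring_nf
  rw [e4]
  rw [e5, e3] at hnn
  simp only [one_pow, mul_one, one_mul] at hnn
  linarith

end GaussAux

/-- Gaussian mass of an interval grows when its centre moves towards the origin. -/
lemma interval_shift (a b t : ℝ) (hab : a ≤ b) (h0 : 0 ≤ t) (h1 : t ≤ 1) :
    ∫ s in a..b, Real.exp (-s ^ 2) ≤
      ∫ s in (a - (1 - t) * ((a + b) / 2))..(b - (1 - t) * ((a + b) / 2)), Real.exp (-s ^ 2) := by
  set δ := (1 - t) * ((a + b) / 2) with hδ
  have hi : ∀ p q : ℝ, IntervalIntegrable (fun s : ℝ => Real.exp (-s ^ 2)) volume p q :=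
    fun p q => (by fun_prop : Continuous fun s : ℝ => Real.exp (-s ^ 2)).intervalIntegrable p q
  have hi2 : ∀ p q : ℝ, IntervalIntegrable (fun s : ℝ => Real.exp (-(s + (b - a)) ^ 2)) volume p q :=
    fun p q => (by fun_prop : Continuous fun s : ℝ => Real.exp (-(s + (b - a)) ^ 2)).intervalIntegrable p q
  have e1 := intervalIntegral.integral_add_adjacent_intervals (hi (a - δ) a) (hi a b)
  have e2 := intervalIntegral.integral_add_adjacent_intervals (hi (a - δ) (b - δ)) (hi (b - δ) b)
  have e3 : ∫ s in (b - δ)..b, Real.exp (-s ^ 2) = ∫ s in (a - δ)..a, Real.exp (-(s + (b - a)) ^ 2) := by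
    rw [intervalIntegral.integral_comp_add_right (fun s => Real.exp (-s ^ 2)) (b - a)]
    congr 1 <;> ring
  have e4 : ∫ s in (a - δ)..a, Real.exp (-(s + (b - a)) ^ 2) ≤ ∫ s in (a - δ)..a, Real.exp (-s ^ 2) := by
    rcases le_total 0 (a + b) with hm | hm
    · have hd0 : 0 ≤ δ := by rw [hδ]; apply mul_nonneg <;> linarith
      have hdm : δ ≤ (a + b) / 2 := by rw [hδ]; nlinarith
      refine intervalIntegral.integral_mono_on (by linarith) (hi2 _ _) (hi _ _) fun s hs => ?_
      apply Real.exp_le_exp.2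
      nlinarith [hs.1, hs.2, mul_nonneg (sub_nonneg.2 hab) (by linarith [hs.1] : 0 ≤ 2 * s + (b - a))]
    · have hd0 : δ ≤ 0 := by rw [hδ]; apply mul_nonpos_of_nonneg_of_nonpos <;> linarith
      have hdm : (a + b) / 2 ≤ δ := by rw [hδ]; nlinarith
      rw [intervalIntegral.integral_symm a, intervalIntegral.integral_symm a]
      apply neg_le_neg
      refine intervalIntegral.integral_mono_on (by linarith) (hi _ _) (hi2 _ _) fun s hs => ?_
      apply Real.exp_le_exp.2
      nlinarith [hs.1, hs.2, mul_nonneg (sub_nonneg.2 hab) (by linarith [hs.2] : 0 ≤ -(2 * s + (b - a)))]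
  linarith

/-- Prepend a coordinate. -/
noncomputable def consE (m : ℕ) (p : ℝ × EuclideanSpace ℝ (Fin m)) : EuclideanSpace ℝ (Fin (m + 1)) :=
  WithLp.toLp 2 (Fin.cons p.1 p.2.ofLp : Fin (m + 1) → ℝ)

lemma consE_zero (m : ℕ) (p : ℝ × EuclideanSpace ℝ (Fin m)) : consE m p 0 = p.1 := rfl

lemma consE_norm (m : ℕ) (p : ℝ × EuclideanSpace ℝ (Fin m)) :
    ‖consE m p‖ ^ 2 = p.1 ^ 2 + ‖p.2‖ ^ 2 := by
  rw [EuclideanSpace.real_norm_sq_eq, EuclideanSpace.real_norm_sq_eq, Fin.sum_univ_succ]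
  rfl

lemma consE_lin (m : ℕ) (p q : ℝ × EuclideanSpace ℝ (Fin m)) (a b : ℝ) :
    a • consE m p + b • consE m q = consE m (a • p + b • q) := by
  ext i
  refine Fin.cases ?_ (fun j => ?_) i <;> simp [consE]

lemma consE_mp (m : ℕ) : MeasurePreserving (consE m) ∧ MeasurableEmbedding (consE m) := by
  let e1 : ℝ × EuclideanSpace ℝ (Fin m) ≃ᵐ ℝ × (Fin m → ℝ) :=
    (MeasurableEquiv.refl ℝ).prodCongr (MeasurableEquiv.toLp 2 (Fin m → ℝ)).symm
  let e2 := (MeasurableEquiv.piFinSuccAbove (fun _ : Fin (m + 1) => ℝ) 0).symm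
  let e3 := MeasurableEquiv.toLp 2 (Fin (m + 1) → ℝ)
  have h1 : MeasurePreserving e1 :=
    (MeasurePreserving.id volume).prod (EuclideanSpace.volume_preserving_symm_measurableEquiv_toLp (Fin m))
  have h2 : MeasurePreserving e2 :=
    (volume_preserving_piFinSuccAbove (fun _ : Fin (m + 1) => ℝ) 0).symm _
  have h3 : MeasurePreserving e3 := PiLp.volume_preserving_toLp _
  have he : consE m = e3 ∘ e2 ∘ e1 := by
    funext p
    ext i
    refine Fin.cases ?_ (fun j => ?_) i <;> simp [consE, e1, e2, e3, MeasurableEquiv.piFinSuccAbove] <;> rfl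
  rw [he]
  exact ⟨h3.comp (h2.comp h1), e3.measurableEmbedding.comp (e2.measurableEmbedding.comp e1.measurableEmbedding)⟩

lemma fiber_mono (T T' : Set ℝ) (hT : Convex ℝ T) (hTm : MeasurableSet T) (hTm' : MeasurableSet T')
    (W : ℝ) (hW : ∀ s ∈ T, |s| ≤ W) (t : ℝ) (ht0 : 0 < t) (ht1 : t ≤ 1)
    (hsub : ∀ p ∈ T, ∀ q ∈ T, (1 + t) / 2 * p - (1 - t) / 2 * q ∈ T') :
    ∫ s in T, Real.exp (-s ^ 2) ≤ ∫ s in T', Real.exp (-s ^ 2) := by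
  have hgInt : Integrable (fun s : ℝ => Real.exp (-s ^ 2)) := by
    simpa using integrable_exp_neg_mul_sq one_pos
  have hpos : ∀ s : ℝ, 0 ≤ Real.exp (-s ^ 2) := fun s => (Real.exp_pos _).le
  rcases T.eq_empty_or_nonempty with rfl | hne
  · simp only [Measure.restrict_empty, integral_zero_measure]
    exact integral_nonneg hpos
  have hbb : BddBelow T := ⟨-W, fun s hs => (abs_le.1 (hW s hs)).1⟩
  have hba : BddAbove T := ⟨W, fun s hs => (abs_le.1 (hW s hs)).2⟩
  set a := sInf T
  set b := sSup T
  have hab : a ≤ b := by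
    obtain ⟨s, hs⟩ := hne
    exact (csInf_le hbb hs).trans (le_csSup hba hs)
  have h1 : T ⊆ Set.Icc a b := fun s hs => ⟨csInf_le hbb hs, le_csSup hba hs⟩
  have h2 : Set.Ioo a b ⊆ T := IsConnected.Ioo_csInf_csSup_subset ⟨hne, hT.isPreconnected⟩ hbb hba
  set δ := (1 - t) * ((a + b) / 2) with hδ
  have h3 : Set.Ioo (a - δ) (b - δ) ⊆ T' := by
    intro x hx
    have hp : x + δ ∈ Set.Ioo a b := ⟨by linarith [hx.1], by linarith [hx.2]⟩
    have hq : a + b - (x + δ) ∈ Set.Ioo a b := ⟨by linarith [hx.2], by linarith [hx.1]⟩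
    have := hsub _ (h2 hp) _ (h2 hq)
    convert this using 1
    rw [hδ]; ring
  calc ∫ s in T, Real.exp (-s ^ 2) ≤ ∫ s in Set.Icc a b, Real.exp (-s ^ 2) :=
        setIntegral_mono_set hgInt.integrableOn (ae_of_all _ hpos) h1.eventuallyLE
    _ = ∫ s in a..b, Real.exp (-s ^ 2) := by
        rw [intervalIntegral.integral_of_le hab, integral_Icc_eq_integral_Ioc]
    _ ≤ ∫ s in (a - δ)..(b - δ), Real.exp (-s ^ 2) := interval_shift a b t hab ht0.le ht1
    _ = ∫ s in Set.Ioo (a - δ) (b - δ), Real.exp (-s ^ 2) := by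
        rw [intervalIntegral.integral_of_le (by linarith), integral_Ioc_eq_integral_Ioo]
    _ ≤ _ := setIntegral_mono_set hgInt.integrableOn (ae_of_all _ hpos) h3.eventuallyLE

lemma sym_ineq (m : ℕ) (S : Set (EuclideanSpace ℝ (Fin (m + 1)))) (hS : Convex ℝ S)
    (hSm : MeasurableSet S) (hsym : ∀ w ∈ S, -w ∈ S) (W : ℝ) (hW : ∀ w ∈ S, |w 0| ≤ W) :
    0 ≤ ∫ w, S.indicator 1 w * (((m : ℝ) + 2 * W - 2 * ‖w‖ ^ 2) * Real.exp (-‖w‖ ^ 2)) := by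
  classical
  rcases S.eq_empty_or_nonempty with rfl | ⟨w0, hw0⟩
  · simp
  have hW0 : 0 ≤ W := (abs_nonneg _).trans (hW w0 hw0)
  have h0S : (0 : EuclideanSpace ℝ (Fin (m + 1))) ∈ S := by
    have := hS hw0 (hsym _ hw0) (by norm_num : (0 : ℝ) ≤ 1 / 2) (by norm_num : (0 : ℝ) ≤ 1 / 2) (by norm_num)
    simpa using this
  have hind0 : ∀ w, 0 ≤ S.indicator (1 : EuclideanSpace ℝ (Fin (m + 1)) → ℝ) w :=
    fun w => Set.indicator_nonneg (fun _ _ => zero_le_one) w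
  have hind1 : ∀ w, S.indicator (1 : EuclideanSpace ℝ (Fin (m + 1)) → ℝ) w ≤ 1 :=
    fun w => Set.indicator_le_self' (fun _ _ => zero_le_one) w
  have hindm : Measurable (S.indicator (1 : EuclideanSpace ℝ (Fin (m + 1)) → ℝ)) :=
    measurable_one.indicator hSm
  have hbd : ∀ w, ‖S.indicator (1 : EuclideanSpace ℝ (Fin (m + 1)) → ℝ) w‖ ≤ 1 := fun w => by
    rw [Real.norm_of_nonneg (hind0 w)]; exact hind1 w
  have i0 : Integrable (fun v : EuclideanSpace ℝ (Fin (m + 1)) => Real.exp (-‖v‖ ^ 2)) := by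
    simpa using gauss_int0 (V := EuclideanSpace ℝ (Fin (m + 1))) one_pos
  have i2 : Integrable (fun v : EuclideanSpace ℝ (Fin (m + 1)) => ‖v‖ ^ 2 * Real.exp (-‖v‖ ^ 2)) := by
    simpa using gauss_int2 (V := EuclideanSpace ℝ (Fin (m + 1))) one_pos
  have iA : ∀ A : ℝ, Integrable (fun w : EuclideanSpace ℝ (Fin (m + 1)) =>
      S.indicator 1 w * ((A - 2 * ‖w‖ ^ 2) * Real.exp (-‖w‖ ^ 2))) := fun A => by
    refine Integrable.bdd_mul ?_ hindm.aestronglyMeasurable (ae_of_all _ hbd)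
    refine ((i0.const_mul A).sub (i2.const_mul 2)).congr (ae_of_all _ fun v => ?_)
    simp only [Pi.sub_apply]; ring
  rcases le_total (1 / 2) W with hc | hc
  · have hA := star_ineq (S.indicator (1 : EuclideanSpace ℝ (Fin (m + 1)) → ℝ)) hindm hind0 1 hind1
      (by
        intro v t ht0 ht1
        by_cases hv : v ∈ S
        · have : t • v ∈ S := by
            have := hS hv h0S ht0.le (sub_nonneg.2 ht1) (by ring)
            simpa using this
          simp [hv, this]
        · rw [Set.indicator_of_notMem hv]; exact hind0 _)
    refine hA.trans (integral_mono (iA _) (iA _) fun w => ?_)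
    refine mul_le_mul_of_nonneg_left (mul_le_mul_of_nonneg_right ?_ (Real.exp_pos _).le) (hind0 w)
    simp only [finrank_euclideanSpace, Fintype.card_fin]
    push_cast
    linarith
  · obtain ⟨hmp, hemb⟩ := consE_mp m
    have hJm := hmp.measurable
    rw [← hmp.integral_comp hemb]
    have iB := (hmp.integrable_comp_emb hemb).2 (iA (m + 2 * W))
    -- the Gaussian measure of the fibres
    set G : EuclideanSpace ℝ (Fin m) → ℝ := fun v =>
      ∫ s : ℝ, S.indicator 1 (consE m (s, v)) * Real.exp (-s ^ 2) with hG
    have hTm : ∀ v, MeasurableSet {s : ℝ | consE m (s, v) ∈ S} := fun v =>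
      (hJm.comp (measurable_id.prodMk measurable_const)) hSm
    have hgInt : Integrable (fun s : ℝ => Real.exp (-s ^ 2)) := by
      simpa using integrable_exp_neg_mul_sq one_pos
    have hG' : ∀ v, G v = ∫ s in {s : ℝ | consE m (s, v) ∈ S}, Real.exp (-s ^ 2) := fun v => by
      rw [← integral_indicator (hTm v)]
      refine integral_congr_ae (ae_of_all _ fun s => ?_)
      by_cases h : consE m (s, v) ∈ S <;> simp [h]
    have hGm : Measurable G := by
      have : StronglyMeasurable fun p : EuclideanSpace ℝ (Fin m) × ℝ =>
          S.indicator (1 : EuclideanSpace ℝ (Fin (m + 1)) → ℝ) (consE m (p.2, p.1)) * Real.exp (-p.2 ^ 2) := by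
        apply Measurable.stronglyMeasurable
        exact (hindm.comp (hJm.comp (measurable_snd.prodMk measurable_fst))).mul (by fun_prop)
      exact (this.integral_prod_right (ν := volume)).measurable
    have hG0 : ∀ v, 0 ≤ G v := fun v =>
      integral_nonneg fun s => mul_nonneg (hind0 _) (Real.exp_pos _).le
    have hG1 : ∀ v, G v ≤ ∫ s : ℝ, Real.exp (-s ^ 2) := fun v => by
      rw [hG' v]
      exact setIntegral_le_integral hgInt (ae_of_all _ fun s => (Real.exp_pos _).le)
    have hst := star_ineq G hGm hG0 _ hG1 (by
      intro v t ht0 ht1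
      rw [hG' v, hG' (t • v)]
      refine fiber_mono _ _ ?_ (hTm _) (hTm _) W ?_ t ht0 ht1 ?_
      · intro s hs r hr α β hα hβ hαβ
        have := hS hs hr hα hβ hαβ
        rw [consE_lin] at this
        simp only [Prod.smul_mk, Prod.mk_add_mk, ← add_smul, hαβ, one_smul] at this
        exact this
      · intro s hs
        have := hW _ hs
        rwa [consE_zero] at this
      · intro p hp q hq
        have := hS hp (hsym _ hq) (by linarith : 0 ≤ (1 + t) / 2) (by linarith : 0 ≤ (1 - t) / 2) (by ring)
        rw [smul_neg, ← neg_smul, consE_lin] at this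
        simp only [Prod.smul_mk, Prod.mk_add_mk, ← add_smul] at this
        have e : (1 + t) / 2 + -((1 - t) / 2) = t := by ring
        rw [e] at this
        change consE m (_, _) ∈ S
        convert this using 3
        simp; ring)
    have iC : Integrable (fun p : ℝ × EuclideanSpace ℝ (Fin m) => S.indicator 1 (consE m p) *
        (Real.exp (-p.1 ^ 2) * (((m : ℝ) - 2 * ‖p.2‖ ^ 2) * Real.exp (-‖p.2‖ ^ 2)))) := by
      refine Integrable.bdd_mul ?_ (hindm.comp hJm).aestronglyMeasurable (ae_of_all _ fun p => hbd _)
      refine Integrable.mul_prod (f := fun s : ℝ => Real.exp (-s ^ 2))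
        (g := fun v : EuclideanSpace ℝ (Fin m) => ((m : ℝ) - 2 * ‖v‖ ^ 2) * Real.exp (-‖v‖ ^ 2)) hgInt ?_
      have k0 : Integrable (fun v : EuclideanSpace ℝ (Fin m) => Real.exp (-‖v‖ ^ 2)) := by
        simpa using gauss_int0 (V := EuclideanSpace ℝ (Fin m)) one_pos
      have k2 : Integrable (fun v : EuclideanSpace ℝ (Fin m) => ‖v‖ ^ 2 * Real.exp (-‖v‖ ^ 2)) := by
        simpa using gauss_int2 (V := EuclideanSpace ℝ (Fin m)) one_pos
      refine ((k0.const_mul m).sub (k2.const_mul 2)).congr (ae_of_all _ fun v => ?_)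
      simp only [Pi.sub_apply]; ring
    have e1 : ∫ p : ℝ × EuclideanSpace ℝ (Fin m), S.indicator 1 (consE m p) *
        (Real.exp (-p.1 ^ 2) * (((m : ℝ) - 2 * ‖p.2‖ ^ 2) * Real.exp (-‖p.2‖ ^ 2)))
        = ∫ v, G v * (((Module.finrank ℝ (EuclideanSpace ℝ (Fin m)) : ℝ) - 2 * ‖v‖ ^ 2) * Real.exp (-‖v‖ ^ 2)) := by
      rw [Measure.volume_eq_prod, integral_prod_symm _ iC]
      refine integral_congr_ae (ae_of_all _ fun v => ?_)
      simp only [finrank_euclideanSpace, Fintype.card_fin, hG]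
      rw [← integral_mul_const]
      congr 1; funext s; ring
    rw [← e1] at hst
    refine hst.trans (integral_mono iC iB fun p => ?_)
    by_cases hp : consE m p ∈ S
    · have hp1 := hW _ hp
      rw [consE_zero] at hp1
      have hsq : p.1 ^ 2 ≤ W := by
        have : p.1 ^ 2 ≤ W ^ 2 := sq_le_sq' (abs_le.1 hp1).1 (abs_le.1 hp1).2
        nlinarith
      simp only [hp, Set.indicator_of_mem, Pi.one_apply, one_mul]
      rw [consE_norm, show -(p.1 ^ 2 + ‖p.2‖ ^ 2) = -p.1 ^ 2 + -‖p.2‖ ^ 2 by ring, Real.exp_add]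
      have := mul_pos (Real.exp_pos (-p.1 ^ 2)) (Real.exp_pos (-‖p.2‖ ^ 2))
      nlinarith
    · simp [hp]

abbrev Eu (m : ℕ) := EuclideanSpace ℝ (Fin (m + 1))

lemma pair_ineq (m : ℕ) (K : Set (EuclideanSpace ℝ (Fin (m + 1)))) (hK : Convex ℝ K)
    (hKm : MeasurableSet K) (a : ℝ) (ha : ∀ x ∈ K, x 0 ≤ a) :
    0 ≤ ∫ z : EuclideanSpace ℝ (Fin (m + 1)) × EuclideanSpace ℝ (Fin (m + 1)),
      (K.indicator 1 z.1 * Real.exp (-(1 / 2 * ‖z.1‖ ^ 2))) *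
      (K.indicator 1 z.2 * Real.exp (-(1 / 2 * ‖z.2‖ ^ 2))) *
      (m + 2 * a - z.1 0 - z.2 0 - ‖z.1 - z.2‖ ^ 2 / 2) := by
  set f : Eu m × Eu m → ℝ := fun z => (K.indicator 1 z.1 * Real.exp (-(1 / 2 * ‖z.1‖ ^ 2))) *
      (K.indicator 1 z.2 * Real.exp (-(1 / 2 * ‖z.2‖ ^ 2))) *
      (m + 2 * a - z.1 0 - z.2 0 - ‖z.1 - z.2‖ ^ 2 / 2) with hf
  let L : ((Eu m) × (Eu m)) ≃ₗ[ℝ] ((Eu m) × (Eu m)) :=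
    { toFun := fun p => (p.1 + p.2, p.1 - p.2)
      invFun := fun p => ((1 / 2 : ℝ) • (p.1 + p.2), (1 / 2 : ℝ) • (p.1 - p.2))
      map_add' := fun p q => Prod.ext (by dsimp; module) (by dsimp; module)
      map_smul' := fun r p => Prod.ext (by dsimp; module) (by dsimp; module)
      left_inv := fun p => Prod.ext (by dsimp; module) (by dsimp; module)
      right_inv := fun p => Prod.ext (by dsimp; module) (by dsimp; module) }
  have hdet : LinearMap.det (L : ((Eu m) × (Eu m)) →ₗ[ℝ] ((Eu m) × (Eu m))) ≠ 0 := (LinearEquiv.isUnit_det' L).ne_zero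
  haveI : (volume : Measure ((Eu m) × (Eu m))).IsAddHaarMeasure := by
    rw [Measure.volume_eq_prod]; infer_instance
  have hmap := Measure.map_linearMap_addHaar_eq_smul_addHaar (volume : Measure ((Eu m) × (Eu m))) hdet
  have hemb : MeasurableEmbedding L := L.toContinuousLinearEquiv.toHomeomorph.measurableEmbedding
  have h1 : ∫ p, f (L p) = |(LinearMap.det (L : ((Eu m) × (Eu m)) →ₗ[ℝ] ((Eu m) × (Eu m))))⁻¹| * ∫ z, f z := by
    rw [← hemb.integral_map]
    change ∫ z, f z ∂(Measure.map (L : ((Eu m) × (Eu m)) →ₗ[ℝ] ((Eu m) × (Eu m))) volume) = _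
    rw [hmap, integral_smul_measure, ENNReal.toReal_ofReal (abs_nonneg _), smul_eq_mul]
  have h2 : 0 ≤ ∫ p, f (L p) := by
    by_cases hi : Integrable (fun p => f (L p))
    · rw [Measure.volume_eq_prod] at hi ⊢
      rw [integral_prod _ hi]
      refine integral_nonneg fun c => ?_
      have hs := sym_ineq m {w | c + w ∈ K ∧ c - w ∈ K}
        (by
          intro x hx y hy α β hα hβ hαβ
          constructor
          · have := hK hx.1 hy.1 hα hβ hαβ
            convert this using 1
            rw [smul_add, smul_add, add_add_add_comm, ← add_smul, hαβ, one_smul]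
          · have := hK hx.2 hy.2 hα hβ hαβ
            convert this using 1
            rw [smul_sub, smul_sub, sub_add_sub_comm, ← add_smul, hαβ, one_smul])
        (((measurable_const_add c) hKm).inter ((measurable_const.sub measurable_id) hKm))
        (by
          intro w hw
          refine ⟨?_, ?_⟩
          · simpa [sub_eq_add_neg] using hw.2
          · simpa using hw.1)
        (a - c 0)
        (by
          intro w hw
          have e1 := ha _ hw.1
          have e2 := ha _ hw.2
          simp only [PiLp.add_apply, PiLp.sub_apply] at e1 e2
          rw [abs_le]
          constructor <;> linarith)
      have h3 : ∫ w, f (L (c, w)) = Real.exp (-‖c‖ ^ 2) * ∫ w : Eu m, Set.indicator {w | c + w ∈ K ∧ c - w ∈ K} 1 w *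
          (((m : ℝ) + 2 * (a - c 0) - 2 * ‖w‖ ^ 2) * Real.exp (-‖w‖ ^ 2)) := by
        rw [← integral_const_mul]
        congr 1; funext w
        change f (c + w, c - w) = _
        simp only [hf]
        have hexp : Real.exp (-(1 / 2 * ‖c + w‖ ^ 2)) * Real.exp (-(1 / 2 * ‖c - w‖ ^ 2))
            = Real.exp (-‖c‖ ^ 2) * Real.exp (-‖w‖ ^ 2) := by
          rw [← Real.exp_add, ← Real.exp_add]
          congr 1
          have := parallelogram_law_with_norm ℝ c w
          nlinarith
        have hpoly : (m : ℝ) + 2 * a - (c + w) 0 - (c - w) 0 - ‖(c + w) - (c - w)‖ ^ 2 / 2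
            = (m : ℝ) + 2 * (a - c 0) - 2 * ‖w‖ ^ 2 := by
          have : (c + w) - (c - w) = (2 : ℝ) • w := by rw [two_smul]; abel
          rw [this, norm_smul]
          simp only [PiLp.add_apply, PiLp.sub_apply, Real.norm_ofNat]
          ring
        rw [hpoly]
        by_cases p1 : c + w ∈ K <;> by_cases p2 : c - w ∈ K
        · simp only [p1, p2, Set.indicator_of_mem, Pi.one_apply, one_mul]
          rw [Set.indicator_of_mem (show w ∈ {w | c + w ∈ K ∧ c - w ∈ K} from ⟨p1, p2⟩), hexp]
          simp only [Pi.one_apply]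
          ring
        all_goals
          rw [Set.indicator_of_notMem (s := {w | c + w ∈ K ∧ c - w ∈ K}) (fun h => by
            first | exact p1 h.1 | exact p2 h.2)]
          simp [p1, p2]
      change 0 ≤ ∫ w, f (L (c, w))
      rw [h3]
      exact mul_nonneg (Real.exp_pos _).le hs
    · rw [integral_undef hi]
  rw [h1] at h2
  exact nonneg_of_mul_nonneg_right h2 (abs_pos.2 (inv_ne_zero hdet))

lemma moment_ineq (m : ℕ) (K : Set (EuclideanSpace ℝ (Fin (m + 1)))) (hK : Convex ℝ K)
    (hKm : MeasurableSet K) (a : ℝ) (ha : ∀ x ∈ K, x 0 ≤ a) :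
    0 ≤ (m + 2 * a) * (∫ x, K.indicator 1 x * Real.exp (-(1 / 2 * ‖x‖ ^ 2))) ^ 2
      - 2 * (∫ x, K.indicator 1 x * Real.exp (-(1 / 2 * ‖x‖ ^ 2))) *
        (∫ x : EuclideanSpace ℝ (Fin (m + 1)), (K.indicator 1 x * Real.exp (-(1 / 2 * ‖x‖ ^ 2))) • x) 0
      - (∫ x, K.indicator 1 x * Real.exp (-(1 / 2 * ‖x‖ ^ 2))) *
        (∫ x, K.indicator 1 x * Real.exp (-(1 / 2 * ‖x‖ ^ 2)) * ‖x‖ ^ 2)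
      + ‖∫ x : EuclideanSpace ℝ (Fin (m + 1)), (K.indicator 1 x * Real.exp (-(1 / 2 * ‖x‖ ^ 2))) • x‖ ^ 2 := by
  have hp := pair_ineq m K hK hKm a ha
  set ρ : Eu m → ℝ := fun x => K.indicator 1 x * Real.exp (-(1 / 2 * ‖x‖ ^ 2)) with hρ
  have hindm : Measurable (K.indicator (1 : Eu m → ℝ)) := measurable_one.indicator hKm
  have hbd : ∀ w, ‖K.indicator (1 : Eu m → ℝ) w‖ ≤ 1 := fun w => by
    by_cases h : w ∈ K <;> simp [h]
  have r0 : Integrable ρ :=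
    (gauss_int0 (by norm_num)).bdd_mul hindm.aestronglyMeasurable (ae_of_all _ hbd)
  have r2 : Integrable (fun x => ρ x * ‖x‖ ^ 2) := by
    refine ((gauss_int2 (V := Eu m) (b := 1 / 2) (by norm_num)).bdd_mul hindm.aestronglyMeasurable
      (ae_of_all _ hbd)).congr (ae_of_all _ fun x => ?_)
    simp only [hρ]; ring
  have hρm : Measurable ρ := hindm.mul (by fun_prop)
  have hρ0 : ∀ x, 0 ≤ ρ x := fun x =>
    mul_nonneg (Set.indicator_nonneg (fun _ _ => zero_le_one) x) (Real.exp_pos _).le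
  have rv : Integrable (fun x : Eu m => ρ x • x) := by
    refine (r0.add r2).mono' (hρm.smul measurable_id).aestronglyMeasurable (ae_of_all _ fun x => ?_)
    rw [norm_smul, Real.norm_of_nonneg (hρ0 x)]
    simp only [Pi.add_apply]
    have : ‖x‖ ≤ 1 + ‖x‖ ^ 2 := by nlinarith [sq_nonneg (‖x‖ - 1)]
    nlinarith [mul_le_mul_of_nonneg_left this (hρ0 x)]
  have ri : ∀ i, Integrable (fun x : Eu m => ρ x * x i) := fun i =>
    (EuclideanSpace.proj (𝕜 := ℝ) i).integrable_comp rv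
  have hMi : ∀ i, (∫ x : Eu m, ρ x • x) i = ∫ x : Eu m, ρ x * x i := fun i =>
    ((EuclideanSpace.proj (𝕜 := ℝ) i).integral_comp_comm rv).symm
  set Z := ∫ x, ρ x
  set N := ∫ x, ρ x * ‖x‖ ^ 2
  have hfe : ∀ z : Eu m × Eu m, ρ z.1 * ρ z.2 * (m + 2 * a - z.1 0 - z.2 0 - ‖z.1 - z.2‖ ^ 2 / 2)
      = ((((m + 2 * a) * (ρ z.1 * ρ z.2) - (ρ z.1 * z.1 0) * ρ z.2) - ρ z.1 * (ρ z.2 * z.2 0))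
        - (1 / 2) * ((ρ z.1 * ‖z.1‖ ^ 2) * ρ z.2) - (1 / 2) * (ρ z.1 * (ρ z.2 * ‖z.2‖ ^ 2)))
        + ∑ i, (ρ z.1 * z.1 i) * (ρ z.2 * z.2 i) := by
    intro z
    have e1 : ∑ i, (ρ z.1 * z.1 i) * (ρ z.2 * z.2 i) = ρ z.1 * ρ z.2 * inner ℝ z.1 z.2 := by
      rw [PiLp.inner_apply, Finset.mul_sum]
      refine Finset.sum_congr rfl fun i _ => ?_
      simp; ring
    rw [e1, norm_sub_sq_real]
    ring
  have t0 := r0.mul_prod r0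
  have t1 := (ri 0).mul_prod r0
  have t2 := r0.mul_prod (ri 0)
  have t3 := r2.mul_prod r0
  have t4 := r0.mul_prod r2
  have t5 : Integrable (fun z : Eu m × Eu m => ∑ i, (ρ z.1 * z.1 i) * (ρ z.2 * z.2 i)) (volume.prod volume) :=
    integrable_finsetSum _ fun i _ => (ri i).mul_prod (ri i)
  have hmain : ∫ z : Eu m × Eu m, ρ z.1 * ρ z.2 * (m + 2 * a - z.1 0 - z.2 0 - ‖z.1 - z.2‖ ^ 2 / 2)
      = (m + 2 * a) * (Z * Z) - (∫ x : Eu m, ρ x * x 0) * Z - Z * (∫ x : Eu m, ρ x * x 0)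
        - (1 / 2) * (N * Z) - (1 / 2) * (Z * N) + ∑ i, (∫ x : Eu m, ρ x * x i) * (∫ x : Eu m, ρ x * x i) := by
    simp_rw [hfe]
    rw [Measure.volume_eq_prod]
    rw [integral_add (((((t0.const_mul _).sub' t1).sub' t2).sub' (t3.const_mul _)).sub' (t4.const_mul _)) t5,
      integral_sub ((((t0.const_mul _).sub' t1).sub' t2).sub' (t3.const_mul _)) (t4.const_mul _),
      integral_sub (((t0.const_mul _).sub' t1).sub' t2) (t3.const_mul _),
      integral_sub ((t0.const_mul _).sub' t1) t2, integral_sub (t0.const_mul _) t1,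
      integral_finsetSum _ (fun i _ => (ri i).mul_prod (ri i))]
    simp only [integral_const_mul]
    rw [integral_prod_mul ρ ρ, integral_prod_mul (fun x : Eu m => ρ x * x 0) ρ,
      integral_prod_mul ρ (fun x : Eu m => ρ x * x 0), integral_prod_mul (fun x : Eu m => ρ x * ‖x‖ ^ 2) ρ,
      integral_prod_mul ρ (fun x : Eu m => ρ x * ‖x‖ ^ 2)]
    congr 1
    refine Finset.sum_congr rfl fun i _ => ?_
    exact integral_prod_mul (fun x : Eu m => ρ x * x i) (fun x : Eu m => ρ x * x i)
  change 0 ≤ ∫ z : Eu m × Eu m, ρ z.1 * ρ z.2 * (m + 2 * a - z.1 0 - z.2 0 - ‖z.1 - z.2‖ ^ 2 / 2) at hp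
  rw [hmain] at hp
  change 0 ≤ (m + 2 * a) * Z ^ 2 - 2 * Z * (∫ x : Eu m, ρ x • x) 0 - Z * N + ‖∫ x : Eu m, ρ x • x‖ ^ 2
  rw [EuclideanSpace.real_norm_sq_eq]
  simp_rw [hMi]
  refine hp.trans (le_of_eq ?_)
  simp_rw [sq]
  ring

lemma std_integral (n : ℕ) (K : Set (EuclideanSpace ℝ (Fin n))) (hKm : MeasurableSet K)
    {G : Type*} [NormedAddCommGroup G] [NormedSpace ℝ G] (f : EuclideanSpace ℝ (Fin n) → G) :
    ∫ x in K, f x ∂(stdGaussian n) = ((2 * π) ^ (-(n : ℝ) / 2) : ℝ) •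
      ∫ x, (K.indicator 1 x * Real.exp (-(1 / 2 * ‖x‖ ^ 2))) • f x := by
  have hm : Measurable fun x : EuclideanSpace ℝ (Fin n) =>
      ENNReal.ofReal ((2 * π) ^ (-(n : ℝ) / 2) * Real.exp (-‖x‖ ^ 2 / 2)) := by fun_prop
  rw [_root_.stdGaussian, ← integral_indicator hKm,
    integral_withDensity_eq_integral_toReal_smul hm (ae_of_all _ fun x => ENNReal.ofReal_lt_top),
    ← integral_smul]
  congr 1; funext x
  rw [ENNReal.toReal_ofReal (by positivity)]
  by_cases hx : x ∈ K
  · simp only [hx, Set.indicator_of_mem, Pi.one_apply, one_mul, smul_smul]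
    congr 3; ring
  · simp [hx]

/-- if a convex set `K` of positive Gaussian volume lies in the halfspace
`{x : x₁ ≤ 0.1}`, and the center of mass `μ` of `N(0,I_n)|K` has `μ_i = 0` for all
coordinates `i ≥ 3` and `‖μ‖² < 0.06`, then `E[‖x‖²] ≤ n - 0.05`. -/
theorem truncated_gaussian_small_inradius_centered_case
    (n : ℕ) (hn : 2 ≤ n) (K : Set (EuclideanSpace ℝ (Fin n)))
    (hconv : Convex ℝ K) (hmeas : MeasurableSet K)
    (hpos : 0 < (stdGaussian n K).toReal)
    (hK : K ⊆ {x | x ⟨0, by omega⟩ ≤ 0.1})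
    (μ : EuclideanSpace ℝ (Fin n)) (hμ : μ = ∫ x, x ∂(truncGaussian n K))
    (hμtail : ∀ i : Fin n, 2 ≤ (i : ℕ) → μ i = 0)
    (hμnorm : ‖μ‖ ^ 2 < 0.06) :
    ∫ x, ‖x‖ ^ 2 ∂(truncGaussian n K) ≤ n - 0.05 := by
  obtain ⟨m, rfl⟩ : ∃ m, n = m + 1 := ⟨n - 1, by omega⟩
  have hKa : ∀ x ∈ K, x 0 ≤ 0.1 := fun x hx => hK hx
  set ρ : EuclideanSpace ℝ (Fin (m + 1)) → ℝ :=
    fun x => K.indicator 1 x * Real.exp (-(1 / 2 * ‖x‖ ^ 2)) with hρ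
  set Z := ∫ x, ρ x with hZ
  set κ : ℝ := (2 * π) ^ (-((m + 1 : ℕ) : ℝ) / 2) with hκ
  have hκ0 : 0 < κ := by positivity
  have hvol : (stdGaussian (m + 1) K).toReal = κ * Z := by
    have h := std_integral (m + 1) K hmeas (fun _ => (1 : ℝ))
    simp only [integral_const, smul_eq_mul, mul_one, measureReal_def, Measure.restrict_apply_univ] at h
    exact h
  have hZ0 : 0 < Z := by
    rw [hvol] at hpos
    exact pos_of_mul_pos_right hpos hκ0.le
  have hμ' : Z • μ = ∫ x, ρ x • x := by
    rw [hμ, truncGaussian, integral_smul_measure, std_integral _ _ hmeas, ENNReal.toReal_inv, hvol,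
      smul_smul, smul_smul]
    have : Z * (κ * Z)⁻¹ * κ = 1 := by field_simp
    rw [← hκ, this, one_smul]
  have hN : Z * (∫ x, ‖x‖ ^ 2 ∂(truncGaussian (m + 1) K)) = ∫ x, ρ x * ‖x‖ ^ 2 := by
    rw [truncGaussian, integral_smul_measure, std_integral _ _ hmeas, ENNReal.toReal_inv, hvol]
    simp only [smul_eq_mul]
    rw [← mul_assoc, ← mul_assoc, ← hκ]
    have : Z * (κ * Z)⁻¹ * κ = 1 := by field_simp
    rw [this, one_mul]
  have key := moment_ineq m K hconv hmeas 0.1 hKa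
  simp only [← hρ, ← hZ] at key
  rw [← hN, ← hμ'] at key
  set N := ∫ x, ‖x‖ ^ 2 ∂(truncGaussian (m + 1) K)
  rw [norm_smul, Real.norm_of_nonneg hZ0.le, PiLp.smul_apply, smul_eq_mul] at key
  have hk2 : 0 ≤ Z ^ 2 * (m + 2 * 0.1 - 2 * μ 0 - N + ‖μ‖ ^ 2) := by
    refine key.trans (le_of_eq ?_); ring
  have hk3 : 0 ≤ m + 2 * 0.1 - 2 * μ 0 - N + ‖μ‖ ^ 2 := by
    by_contra hneg
    push Not at hneg
    have := mul_neg_of_pos_of_neg (pow_pos hZ0 2) hneg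
    linarith
  have h0 : (μ 0) ^ 2 ≤ ‖μ‖ ^ 2 := by
    rw [EuclideanSpace.real_norm_sq_eq]
    exact Finset.single_le_sum (f := fun i => (μ i) ^ 2) (fun i _ => sq_nonneg _) (Finset.mem_univ 0)
  have h1 : -0.25 ≤ μ 0 := by nlinarith
  push_cast
  linarith
end
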